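/- (Induction proposition, second kernel.) Let m ≥ 2, Δ > 1, 0 < α < 1/m, and let 0 < l ≤ m be an integer. There is a constant C, depending only on Δ, α, m and l, such that the following holds under the induction hypotheses. With Π := Π^J and Θ̃ the m×m diagonal matrix whose i-th diagonal entry is 0 for i ≤ l and 1 for i > l, set K(t,x) := ∫_{ℝ^m} |t D Π^T Θ̃ ξ|² g(t D Π^T ξ) e^{2πi ξ^T Π x} dξ. Then |Λ(𝒯,J,K)((F_j)_{j∈𝒞})| ≤ C (∏_{h=1}^m max(d_h^{2α}, d_h^{−2})) |Q_𝒯| ∏_{j∈𝒞} M_α(F_j)(A_j𝒯). -/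

import Mathlib

open MeasureTheory Matrix
open scoped ENNReal NNReal BigOperators

noncomputable section

namespace SBL

/-- The set of corners of the `m`-dimensional cube: functions `{1,…,m} → {0,1}`. -/
abbrev Corner (m : ℕ) := Fin m → Fin 2

/-- Index type for `ℝ^{2m}`: coordinates `x^0_i` (left) and `x^1_i` (right). -/
abbrev Idx (m : ℕ) := Fin m ⊕ Fin m

/-- The coordinate of `ℝ^{2m}` selected by the corner `j` at position `i`. -/
def sel {m : ℕ} (j : Corner m) (i : Fin m) : Idx m :=
  if j i = 0 then Sum.inl i else Sum.inr i

/-- The projection `Π_j : ℝ^{2m} → ℝ^m`, `Π_j x = (x_1^{j(1)},…,x_m^{j(m)})`. -/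
def proj {m : ℕ} (j : Corner m) (x : Idx m → ℝ) : Fin m → ℝ := fun i => x (sel j i)

/-- The projection `Π_j` as an `m × 2m` matrix. -/
def projM {m : ℕ} (j : Corner m) : Matrix (Fin m) (Idx m) ℝ :=
  Matrix.of fun i k => if k = sel j i then 1 else 0

/-- `A_j := Π_j J`, the `m × m` matrix obtained by applying `Π_j` to (the columns of) a
`2m × m` matrix `J`, i.e. selecting rows of `J` according to the corner `j`. -/
def Amat {m : ℕ} (J : Matrix (Idx m) (Fin m) ℝ) (j : Corner m) : Matrix (Fin m) (Fin m) ℝ :=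
  Matrix.of fun i k => J (sel j i) k

/-- Euclidean norm on a finite pi type. -/
def en {ι : Type*} [Fintype ι] (x : ι → ℝ) : ℝ := Real.sqrt (∑ i, (x i) ^ 2)

/-- Operator norm of a matrix with respect to the Euclidean norms. -/
def opNorm {ι κ : Type*} [Fintype ι] [Fintype κ] [DecidableEq κ] (A : Matrix ι κ ℝ) : ℝ :=
  ‖LinearMap.toContinuousLinearMap (Matrix.toEuclideanLin A)‖

/-- `Δ`-regularity of a square matrix: `max(‖A‖, |det A|⁻¹) ≤ Δ` (in particular `det A ≠ 0`). -/
def IsReg {m : ℕ} (Δ : ℝ) (A : Matrix (Fin m) (Fin m) ℝ) : Prop :=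
  opNorm A ≤ Δ ∧ A.det ≠ 0 ∧ |A.det|⁻¹ ≤ Δ

/-- A Calderón–Zygmund kernel of order `n` in `ℝ^m`, given by its multiplier `K̂` on
`ℝ^m ∖ {0}`: it is `n` times continuously differentiable there and satisfies the symbol
estimates `‖D^k K̂(η)‖ ≤ |η|^{-k}` for all `k ≤ n`. -/
def IsCZ {m : ℕ} (n : ℕ) (Khat : (Fin m → ℝ) → ℂ) : Prop :=
  ContDiffOn ℝ n Khat {0}ᶜ ∧
  ∀ k : ℕ, k ≤ n → ∀ η : Fin m → ℝ, η ≠ 0 →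
    ‖iteratedFDerivWithin ℝ k Khat {0}ᶜ η‖ ≤ (en η) ^ (-(k : ℝ))

/-- Fourier transform of a (nice) function on `ℝ^{2m}`. -/
def fourierT {m : ℕ} (φ : (Idx m → ℝ) → ℝ) (ξ : Idx m → ℝ) : ℂ :=
  ∫ x : Idx m → ℝ, Complex.exp (-2 * Real.pi * Complex.I * (∑ k, x k * ξ k)) * (φ x : ℂ)

/-- The principal value `p.v. ∫_{ℝ^{2m}} (∏_j F_j(Π_j x)) K(Πx) dx`, defined as
`∫_{ℝ^m} φ̂(−Π^T η) K̂(η) dη` with `φ = ∏_j F_j ∘ Π_j`. -/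
def pv {m : ℕ} (P : Matrix (Fin m) (Idx m) ℝ) (Khat : (Fin m → ℝ) → ℂ)
    (F : Corner m → (Fin m → ℝ) → ℝ) : ℂ :=
  ∫ η : Fin m → ℝ, fourierT (fun x => ∏ j, F j (proj j x)) (-(P.transpose.mulVec η)) * Khat η

/-- Upper `m×m` block `J^0` of a `2m×m` matrix. -/
def Jb0 {m : ℕ} (J : Matrix (Idx m) (Fin m) ℝ) : Matrix (Fin m) (Fin m) ℝ :=
  J.submatrix Sum.inl id

/-- Lower `m×m` block `J^1` of a `2m×m` matrix. -/
def Jb1 {m : ℕ} (J : Matrix (Idx m) (Fin m) ℝ) : Matrix (Fin m) (Fin m) ℝ :=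
  J.submatrix Sum.inr id

/-- `Π^J := (I, −J^0 (J^1)⁻¹)`. -/
def PiJ {m : ℕ} (J : Matrix (Idx m) (Fin m) ℝ) : Matrix (Fin m) (Idx m) ℝ :=
  Matrix.fromCols 1 (-(Jb0 J * (Jb1 J)⁻¹))

/-- The dyadic cube with parameters `Q = (k, n)`: `∏_i [2^k n_i, 2^k (n_i+1))`. -/
def dC {m : ℕ} (Q : ℤ × (Fin m → ℤ)) : Set (Fin m → ℝ) :=
  {x | ∀ i, (2:ℝ)^Q.1 * (Q.2 i : ℝ) ≤ x i ∧ x i < (2:ℝ)^Q.1 * ((Q.2 i : ℝ) + 1)}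

/-- `Q*`: the cube with the same center as `Q` and three times the side length. -/
def dCstar {m : ℕ} (Q : ℤ × (Fin m → ℤ)) : Set (Fin m → ℝ) :=
  {x | ∀ i, (2:ℝ)^Q.1 * ((Q.2 i : ℝ) - 1) ≤ x i ∧ x i < (2:ℝ)^Q.1 * ((Q.2 i : ℝ) + 2)}

/-- A (1/2-)sparse collection of dyadic cubes. -/
def IsSparse {m : ℕ} (S : Set (ℤ × (Fin m → ℤ))) : Prop :=
  ∀ Q ∈ S,
    (∑' Q' : {q : ℤ × (Fin m → ℤ) // q ∈ S ∧ dC q ⊆ dC Q}, volume (dC Q'.val)) ≤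
      2 * volume (dC Q)

/-- The average `[F]_S := (|S|⁻¹ ∫_S |F|^{2^{m-1}})^{2^{1-m}}`. -/
def avg {m : ℕ} (S : Set (Fin m → ℝ)) (F : (Fin m → ℝ) → ℝ) : ℝ :=
  (((volume S).toReal)⁻¹ * ∫ x in S, |F x| ^ (2^(m-1) : ℕ)) ^ ((2:ℝ) ^ ((1:ℤ) - (m:ℤ)))

/-- The closed axis-parallel box `∏_i [a_i, b_i]`. -/
def box {m : ℕ} (a b : Fin m → ℝ) : Set (Fin m → ℝ) := {x | ∀ i, a i ≤ x i ∧ x i ≤ b i}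

/-- Reciprocal eccentricity `ε_R = (min_i |I_i|)/(max_i |I_i|)` of the box `∏_i [a_i,b_i]`. -/
def ecc {m : ℕ} (a b : Fin m → ℝ) : ℝ := (⨅ i, (b i - a i)) / (⨆ i, (b i - a i))

/-- Modified strong maximal function evaluated on a set `S`:
`sup { (ε_R^α)^{2^{1-m}} [F]_R : R ∈ ℛ, S ⊆ R }` (as an extended real). -/
def Mal {m : ℕ} (α : ℝ) (F : (Fin m → ℝ) → ℝ) (S : Set (Fin m → ℝ)) : ℝ≥0∞ :=
  ⨆ (a : Fin m → ℝ) (b : Fin m → ℝ) (_ : ∀ i, a i < b i) (_ : S ⊆ box a b),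
    ENNReal.ofReal ((ecc a b ^ α) ^ ((2:ℝ) ^ ((1:ℤ) - (m:ℤ))) * avg (box a b) F)

/-- `M_α(F)(A𝒯) := sup_{Q ∈ 𝒯} M_α(F)(AQ)`. -/
def MalTree {m : ℕ} (α : ℝ) (F : (Fin m → ℝ) → ℝ) (A : Matrix (Fin m) (Fin m) ℝ)
    (T : Set (ℤ × (Fin m → ℤ))) : ℝ≥0∞ :=
  ⨆ Q ∈ T, Mal α F (A.mulVec '' dC Q)

/-- A convex tree of dyadic cubes with top cube `Qt`. -/
def ConvexTree {m : ℕ} (T : Set (ℤ × (Fin m → ℤ))) (Qt : ℤ × (Fin m → ℤ)) : Prop :=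
  Qt ∈ T ∧ (∀ Q ∈ T, dC Q ⊆ dC Qt) ∧
  ∀ Q ∈ T, ∀ Q' : ℤ × (Fin m → ℤ), dC Q ⊆ dC Q' → dC Q' ⊆ dC Qt → Q' ∈ T

/-- The Gaussian `g(x) = e^{−π|x|²}` on `ℝ^{2m}`. -/
def gss {m : ℕ} (x : Idx m → ℝ) : ℝ := Real.exp (-Real.pi * ∑ k, (x k) ^ 2)

/-- The mixed partial derivative `∂^0_i ∂^1_i g`. -/
def ddg {m : ℕ} (i : Fin m) (x : Idx m → ℝ) : ℝ :=
  fderiv ℝ (fun y : Idx m → ℝ => fderiv ℝ gss y (Pi.single (Sum.inl i) (1:ℝ))) x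
    (Pi.single (Sum.inr i) (1:ℝ))

/-- Isotropic `L¹` dilation on `ℝ^{2m}`: `φ_t(x) = t^{-2m} φ(t⁻¹ x)`. -/
def dil {m : ℕ} (t : ℝ) (φ : (Idx m → ℝ) → ℝ) (x : Idx m → ℝ) : ℝ :=
  (t ^ (2*m))⁻¹ * φ (t⁻¹ • x)

/-- Matrix dilation: `φ_D(x) = (det D)⁻¹ φ(D⁻¹ x)`. -/
def dilM {m : ℕ} (D : Matrix (Idx m) (Idx m) ℝ) (φ : (Idx m → ℝ) → ℝ) (x : Idx m → ℝ) : ℝ :=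
  (D.det)⁻¹ * φ (D⁻¹.mulVec x)

/-- The region `Ω_𝒯 = ∪_{Q∈𝒯} Q × (ℓ(Q)/2, ℓ(Q))` in the upper half space. -/
def Omega {m : ℕ} (T : Set (ℤ × (Fin m → ℤ))) : Set ((Fin m → ℝ) × ℝ) :=
  ⋃ Q ∈ T, (dC Q) ×ˢ Set.Ioo ((2:ℝ)^Q.1 / 2) ((2:ℝ)^Q.1)

/-- The localized form `Λ_𝒯((F_j)_j)`. -/
def LambdaT {m : ℕ} (J : Matrix (Idx m) (Fin m) ℝ) (T : Set (ℤ × (Fin m → ℤ)))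
    (c : ℝ → ℂ) (u : Idx m → ℝ) (i : Fin m) (F : Corner m → (Fin m → ℝ) → ℝ) : ℂ :=
  ∫ z in Omega T, c z.2 * Complex.ofReal ((1 + en u ^ (4*m))⁻¹ * (z.2)⁻¹ *
    ∫ x : Idx m → ℝ, (∏ j, F j (proj j x)) * dil z.2 (ddg i) (x - J.mulVec z.1 + z.2 • u))

/-- `T_k := ∪ {Q ∈ 𝒯 : ℓ(Q) = 2^k}`. -/
def Tkset {m : ℕ} (T : Set (ℤ × (Fin m → ℤ))) (k : ℤ) : Set (Fin m → ℝ) :=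
  ⋃ Q ∈ {q ∈ T | q.1 = k}, dC Q

/-- The form `Λ̃_𝒯((F_j)_j)` with localization in the `x` variables. -/
def LambdaTilde {m : ℕ} (J : Matrix (Idx m) (Fin m) ℝ) (T : Set (ℤ × (Fin m → ℤ)))
    (c : ℝ → ℂ) (u : Idx m → ℝ) (i : Fin m) (F : Corner m → (Fin m → ℝ) → ℝ) : ℂ :=
  ∑' k : ℤ, ∫ t in Set.Ioc ((2:ℝ)^(k-1)) ((2:ℝ)^k),
    c t * Complex.ofReal ((1 + en u ^ (4*m))⁻¹ * t⁻¹ *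
      ∫ p : Fin m → ℝ, ∫ x : Idx m → ℝ,
        (∏ j, Set.indicator ((Amat J j).mulVec '' Tkset T k) (F j) (proj j x)) *
          dil t (ddg i) (x - J.mulVec p + t • u))

/-- The form `Λ(𝒯,J,K)((F_j)_j)` from the induction proposition. -/
def LambdaK {m : ℕ} (J : Matrix (Idx m) (Fin m) ℝ) (T : Set (ℤ × (Fin m → ℤ)))
    (K : ℝ → (Idx m → ℝ) → ℂ) (F : Corner m → (Fin m → ℝ) → ℝ) : ℂ :=
  ∑' k : ℤ, ∫ x : Idx m → ℝ,
    Complex.ofReal (∏ j, Set.indicator ((Amat J j).mulVec '' Tkset T k) (F j) (proj j x)) *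
      ∫ t in Set.Ioc ((2:ℝ)^(k-1)) ((2:ℝ)^k), K t x * (t : ℂ)⁻¹

/-- The reflected corner `i∗j`, differing from `j` exactly at position `i`. -/
def istar {m : ℕ} (i : Fin m) (j : Corner m) : Corner m :=
  fun k => if k = i then 1 - j i else j k

/-- The diagonal matrix `Θ̃` with entry 0 at positions `i ≤ l` and 1 at positions `i > l`
(1-based), i.e. 0 for `i < l` and 1 otherwise in 0-based indexing. -/
def Th {m : ℕ} (l : ℕ) : Matrix (Fin m) (Fin m) ℝ :=
  Matrix.diagonal fun i => if (i : ℕ) < l then 0 else 1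

/-- The block diagonal matrix `Θ = diag(Θ̃, Θ̃)`. -/
def ThB {m : ℕ} (l : ℕ) : Matrix (Idx m) (Idx m) ℝ :=
  Matrix.diagonal (Sum.elim (fun i : Fin m => if (i:ℕ) < l then (0:ℝ) else 1)
    (fun i : Fin m => if (i:ℕ) < l then (0:ℝ) else 1))

end SBL

namespace SBL

/-- The one-dimensional Gaussian `e^{-πx²}`. -/
def gz (x : ℝ) : ℝ := Real.exp (-Real.pi * x ^ 2)

/-- The `L¹`-dilate by `s` of the `r`-th derivative of the Gaussian. -/
def hk (r : ℕ) (s x : ℝ) : ℝ := s⁻¹ * iteratedDeriv r gz (x / s)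

/-- The Fourier transform of `hk r s`. -/
def mg (r : ℕ) (s η : ℝ) : ℂ :=
  (2 * Real.pi * Complex.I * ((s * η : ℝ) : ℂ)) ^ r * ((Real.exp (-Real.pi * (s * η) ^ 2) : ℝ) : ℂ)

theorem gz_contDiff : ContDiff ℝ ⊤ gz := by
  unfold gz
  fun_prop

theorem gz_hasDerivAt (x : ℝ) : HasDerivAt gz (-2 * Real.pi * x * gz x) x := by
  have h : HasDerivAt (fun y : ℝ => -Real.pi * y ^ 2) (-Real.pi * (2 * x)) x := by
    simpa using (hasDerivAt_pow 2 x).const_mul (-Real.pi)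
  have := h.exp
  unfold gz
  convert this using 1
  ring

theorem iteratedDeriv_gz (r : ℕ) :
    ∃ P : Polynomial ℝ, ∀ x, iteratedDeriv r gz x = P.eval x * gz x := by
  induction r with
  | zero => exact ⟨1, fun x => by simp⟩
  | succ r ih =>
    obtain ⟨P, hP⟩ := ih
    refine ⟨P.derivative - Polynomial.C (2 * Real.pi) * Polynomial.X * P, fun x => ?_⟩
    rw [iteratedDeriv_succ, funext hP]
    have := ((P.hasDerivAt x).mul (gz_hasDerivAt x)).deriv
    rw [show (fun x => Polynomial.eval x P * gz x) = (fun x => Polynomial.eval x P) * gz from rfl,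
      this]
    simp
    ring

theorem polynomial_le_exp_sq (P : Polynomial ℝ) :
    ∃ C : ℝ, 0 < C ∧ ∀ x : ℝ, |P.eval x| ≤ C * Real.exp (Real.pi / 2 * x ^ 2) := by
  induction P using Polynomial.induction_on' with
  | add p q hp hq =>
    obtain ⟨C, hC, hp⟩ := hp
    obtain ⟨C', hC', hq⟩ := hq
    refine ⟨C + C', by positivity, fun x => ?_⟩
    rw [Polynomial.eval_add, add_mul]
    exact (abs_add_le _ _).trans (add_le_add (hp x) (hq x))
  | monomial n a =>
    refine ⟨(|a| + 1) * (n.factorial * Real.exp 1), by positivity, fun x => ?_⟩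
    have h1 : |x| ^ n ≤ n.factorial * Real.exp |x| := by
      have := Real.pow_div_factorial_le_exp |x| (abs_nonneg x) n
      rw [div_le_iff₀ (by positivity)] at this
      linarith
    have h2 : Real.exp |x| ≤ Real.exp 1 * Real.exp (Real.pi / 2 * x ^ 2) := by
      rw [← Real.exp_add]
      apply Real.exp_le_exp.2
      have := Real.pi_gt_three
      nlinarith [sq_nonneg (|x| - 1), sq_abs x, sq_nonneg x]
    rw [Polynomial.eval_monomial, abs_mul, abs_pow]
    calc |a| * |x| ^ n
        ≤ (|a| + 1) * (n.factorial * (Real.exp 1 * Real.exp (Real.pi / 2 * x ^ 2))) := by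
          gcongr
          · linarith
          · exact h1.trans (by gcongr)
      _ = _ := by ring

theorem hk_bound (r : ℕ) : ∃ C : ℝ, 0 < C ∧ ∀ s : ℝ, 0 < s → ∀ x,
    |hk r s x| ≤ C * (s⁻¹ * Real.exp (-(Real.pi / 2) * (x / s) ^ 2)) := by
  obtain ⟨P, hP⟩ := iteratedDeriv_gz r
  obtain ⟨C, hC, hb⟩ := polynomial_le_exp_sq P
  refine ⟨C, hC, fun s hs x => ?_⟩
  rw [hk, hP, abs_mul, abs_mul, abs_of_pos (inv_pos.2 hs), gz, Real.abs_exp]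
  calc s⁻¹ * (|P.eval (x / s)| * Real.exp (-Real.pi * (x / s) ^ 2))
      ≤ s⁻¹ * (C * Real.exp (Real.pi / 2 * (x / s) ^ 2) * Real.exp (-Real.pi * (x / s) ^ 2)) := by
        gcongr
        exact hb _
    _ = _ := by
        rw [mul_assoc C, ← Real.exp_add]
        ring_nf

theorem hk_zero (s x : ℝ) : hk 0 s x = s⁻¹ * Real.exp (-Real.pi * (x / s) ^ 2) := by
  simp [hk, gz]

theorem hk_zero_nonneg {s : ℝ} (hs : 0 < s) (x : ℝ) : 0 ≤ hk 0 s x := by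
  rw [hk_zero]; positivity

theorem hk_continuous (r : ℕ) (s : ℝ) : Continuous (hk r s) := by
  unfold hk
  have : Continuous (iteratedDeriv r gz) :=
    gz_contDiff.continuous_iteratedDeriv r (by exact_mod_cast le_top)
  fun_prop

theorem integrable_exp_neg_sq_div {b s : ℝ} (hb : 0 < b) (hs : 0 < s) :
    Integrable (fun x : ℝ => Real.exp (-b * (x / s) ^ 2)) := by
  have := integrable_exp_neg_mul_sq (b := b / s ^ 2) (by positivity)
  refine this.congr (ae_of_all _ fun x => ?_)
  field_simp

theorem hk_integrable (r : ℕ) {s : ℝ} (hs : 0 < s) : Integrable (hk r s) := by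
  obtain ⟨C, hC, hb⟩ := hk_bound r
  refine Integrable.mono' (((integrable_exp_neg_sq_div (b := Real.pi / 2)
    (by positivity) hs).const_mul s⁻¹).const_mul C) (hk_continuous r s).aestronglyMeasurable
    (ae_of_all _ fun x => ?_)
  exact hb s hs x

theorem hk_bounded (r : ℕ) {s : ℝ} (hs : 0 < s) : ∃ C : ℝ, ∀ x, |hk r s x| ≤ C := by
  obtain ⟨C, hC, hb⟩ := hk_bound r
  refine ⟨C * s⁻¹, fun x => (hb s hs x).trans ?_⟩
  have : Real.exp (-(Real.pi / 2) * (x / s) ^ 2) ≤ 1 := by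
    apply Real.exp_le_one_iff.2
    have := Real.pi_pos
    nlinarith [mul_nonneg this.le (sq_nonneg (x / s))]
  have : s⁻¹ * Real.exp (-(Real.pi / 2) * (x / s) ^ 2) ≤ s⁻¹ * 1 := by gcongr
  calc _ ≤ C * (s⁻¹ * 1) := by gcongr
    _ = _ := by ring

theorem mg_continuous (r : ℕ) (s : ℝ) : Continuous (mg r s) := by
  unfold mg
  fun_prop

theorem mg_norm (r : ℕ) (s η : ℝ) :
    ‖mg r s η‖ = (2 * Real.pi * |s * η|) ^ r * Real.exp (-Real.pi * (s * η) ^ 2) := by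
  rw [mg, norm_mul, norm_pow]
  congr 1
  · simp [abs_of_pos Real.pi_pos]
  · rw [Complex.norm_real, Real.norm_of_nonneg (Real.exp_pos _).le]

theorem mg_bound (r : ℕ) : ∃ C : ℝ, 0 < C ∧ ∀ s η : ℝ,
    ‖mg r s η‖ ≤ C * Real.exp (-(Real.pi / 2) * (s * η) ^ 2) := by
  obtain ⟨C, hC, hb⟩ := polynomial_le_exp_sq ((2 * Polynomial.C Real.pi * Polynomial.X) ^ r)
  refine ⟨C, hC, fun s η => ?_⟩
  rw [mg_norm]
  have := hb (s * η)
  simp only [Polynomial.eval_pow, Polynomial.eval_mul, Polynomial.eval_ofNat, Polynomial.eval_C,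
    Polynomial.eval_X, abs_pow, abs_mul, abs_of_pos Real.pi_pos, Nat.abs_ofNat] at this
  rw [abs_mul]
  calc _ ≤ C * Real.exp (Real.pi / 2 * (s * η) ^ 2) * Real.exp (-Real.pi * (s * η) ^ 2) := by
        gcongr
    _ = _ := by
        rw [mul_assoc C, ← Real.exp_add]
        ring_nf

theorem mg_integrable (r : ℕ) {s : ℝ} (hs : 0 < s) : Integrable (mg r s) := by
  obtain ⟨C, hC, hb⟩ := mg_bound r
  have := integrable_exp_neg_sq_div (b := Real.pi / 2) (s := s⁻¹) (by positivity) (by positivity)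
  refine Integrable.mono' (this.const_mul C) (mg_continuous r s).aestronglyMeasurable
    (ae_of_all _ fun x => (hb s x).trans ?_)
  rw [div_inv_eq_mul, mul_comm x s]

theorem gz_ofReal_eq : (fun x : ℝ => ((gz x : ℝ) : ℂ)) =
    fun x : ℝ => Complex.exp (-Real.pi * 1 * (x : ℂ) ^ 2) := by
  funext x
  simp [gz]

theorem fourier_gz :
    FourierTransform.fourier (fun x : ℝ => ((gz x : ℝ) : ℂ)) = fun x : ℝ => ((gz x : ℝ) : ℂ) := by
  have := fourier_gaussian_pi (b := 1) (by simp)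
  rw [gz_ofReal_eq, this]
  funext x
  simp

theorem iteratedDeriv_ofReal_gz (r : ℕ) :
    iteratedDeriv r (fun x : ℝ => ((gz x : ℝ) : ℂ)) =
      fun x => ((iteratedDeriv r gz x : ℝ) : ℂ) := by
  induction r with
  | zero => simp
  | succ r ih =>
    funext x
    rw [iteratedDeriv_succ, ih, iteratedDeriv_succ]
    have : DifferentiableAt ℝ (iteratedDeriv r gz) x :=
      (gz_contDiff.differentiable_iteratedDeriv r (by exact_mod_cast WithTop.coe_lt_top _)) x
    exact this.hasDerivAt.ofReal_comp.deriv

theorem gz_ofReal_contDiff : ContDiff ℝ ((⊤ : ℕ∞) : WithTop ℕ∞) (fun x : ℝ => ((gz x : ℝ) : ℂ)) :=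
  Complex.ofRealCLM.contDiff.comp (gz_contDiff.of_le le_top)

theorem iteratedDeriv_gz_integrable (r : ℕ) : Integrable (iteratedDeriv r gz) := by
  have := hk_integrable r one_pos
  refine this.congr (ae_of_all _ fun x => ?_)
  simp [hk]

theorem hk_fourier (r : ℕ) {s : ℝ} (hs : 0 < s) (η : ℝ) :
    ∫ x : ℝ, (hk r s x : ℂ) * Complex.exp (-(2 * Real.pi * Complex.I * (x * η : ℝ))) =
      mg r s η := by
  have h := Real.fourier_iteratedDeriv (n := r) (N := ⊤) gz_ofReal_contDiff
    (fun n _ => by rw [iteratedDeriv_ofReal_gz]; exact (iteratedDeriv_gz_integrable n).ofReal)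
    le_top
  rw [fourier_gz, iteratedDeriv_ofReal_gz] at h
  have h2 := congrFun h (s * η)
  rw [Real.fourier_eq'] at h2
  have h3 : ∫ x : ℝ, (hk r s x : ℂ) * Complex.exp (-(2 * Real.pi * Complex.I * (x * η : ℝ))) =
      ∫ x : ℝ, (s⁻¹ : ℝ) • (fun v : ℝ =>
        Complex.exp (((-2 * Real.pi * inner ℝ v (s * η) : ℝ) : ℂ) * Complex.I) •
          ((iteratedDeriv r gz v : ℝ) : ℂ)) (x / s) := by
    congr 1
    funext x
    simp only [hk, smul_eq_mul, Complex.real_smul]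
    rw [show ((-2 * Real.pi * inner ℝ (x / s) (s * η) : ℝ) : ℂ) * Complex.I =
      -(2 * Real.pi * Complex.I * (x * η : ℝ)) by
        have : inner ℝ (x / s) (s * η) = x * η := by
          simp [inner]
          field_simp
        rw [this]
        push_cast
        ring]
    push_cast
    ring
  rw [h3, integral_smul, Measure.integral_comp_div (fun v : ℝ =>
    Complex.exp (((-2 * Real.pi * inner ℝ v (s * η) : ℝ) : ℂ) * Complex.I) •
        ((iteratedDeriv r gz v : ℝ) : ℂ)) s, h2, abs_of_pos hs, smul_smul, inv_mul_cancel₀ hs.ne',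
    one_smul]
  simp [mg, gz]

theorem gz_pow_integrable (n : ℕ) : Integrable (fun x : ℝ => x ^ n • ((gz x : ℝ) : ℂ)) := by
  have := (mg_integrable n one_pos).const_mul ((2 * Real.pi * Complex.I)⁻¹ ^ n)
  refine this.congr (ae_of_all _ fun x => ?_)
  have hpi : (2 * Real.pi * Complex.I) ≠ 0 := by simp [Real.pi_ne_zero]
  simp only [mg, gz, one_mul, Complex.real_smul]
  rw [mul_pow _ (x : ℂ), mul_assoc _ ((x : ℂ) ^ n), ← mul_assoc, ← mul_pow, inv_mul_cancel₀ hpi,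
    one_pow, one_mul, Complex.ofReal_pow]

theorem hk_inv (r : ℕ) {s : ℝ} (hs : 0 < s) (x : ℝ) :
    ∫ η : ℝ, mg r s η * Complex.exp (2 * Real.pi * Complex.I * (η * x : ℝ)) = hk r s x := by
  have h := Real.iteratedDeriv_fourier (n := r) (N := ⊤) (f := fun x : ℝ => ((gz x : ℝ) : ℂ))
    (fun n _ => gz_pow_integrable n) le_top
  rw [fourier_gz, iteratedDeriv_ofReal_gz] at h
  have h2 := congrFun h (x / s)
  rw [Real.fourier_eq'] at h2
  rw [hk]
  push_cast
  rw [h2, ← integral_neg_eq_self (fun v : ℝ =>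
    Complex.exp (((-2 * Real.pi * inner ℝ v (x / s) : ℝ) : ℂ) * Complex.I) •
        ((-2 * Real.pi * Complex.I * (v : ℂ)) ^ r • ((gz v : ℝ) : ℂ)))]
  have h3 := Measure.integral_comp_mul_left (fun v : ℝ =>
     Complex.exp (((-2 * Real.pi * inner ℝ (-v) (x / s) : ℝ) : ℂ) * Complex.I) •
        ((-2 * Real.pi * Complex.I * ((-v : ℝ) : ℂ)) ^ r • ((gz (-v) : ℝ) : ℂ))) s
  rw [abs_of_pos (inv_pos.2 hs), Complex.real_smul, Complex.ofReal_inv] at h3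
  rw [← h3]
  congr 1
  funext η
  rw [show ((-2 * Real.pi * inner ℝ (-(s * η)) (x / s) : ℝ) : ℂ) * Complex.I =
      2 * Real.pi * Complex.I * (η * x : ℝ) by
        have : inner ℝ (-(s * η)) (x / s) = -(η * x) := by
          simp [inner]
          field_simp
        rw [this]
        push_cast
        ring]
  simp only [mg, gz, smul_eq_mul]
  push_cast
  ring_nf

theorem mg_add (a b : ℕ) (s η : ℝ) :
    mg (a + b) s η = ((Real.sqrt 2 ^ (a + b) : ℝ) : ℂ) *
      (mg b (s / Real.sqrt 2) η * mg a (s / Real.sqrt 2) η) := by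
  have h2 : (Real.sqrt 2 : ℂ) ≠ 0 := by
    norm_cast
    positivity
  have he : Real.exp (-Real.pi * (s * η) ^ 2) =
      Real.exp (-Real.pi * (s / Real.sqrt 2 * η) ^ 2) *
        Real.exp (-Real.pi * (s / Real.sqrt 2 * η) ^ 2) := by
    rw [← Real.exp_add]
    congr 1
    have : (Real.sqrt 2) ^ 2 = 2 := Real.sq_sqrt (by norm_num)
    rw [mul_pow, mul_pow, div_pow, this]
    ring
  simp only [mg, he]
  push_cast
  rw [pow_add, pow_add, show (s : ℂ) / (Real.sqrt 2 : ℂ) * η = (s * η) / (Real.sqrt 2 : ℂ) by ring,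
    show 2 * (Real.pi : ℂ) * Complex.I * (s * η / (Real.sqrt 2 : ℂ)) =
      (2 * Real.pi * Complex.I * (s * η)) / (Real.sqrt 2 : ℂ) by ring]
  generalize 2 * (Real.pi : ℂ) * Complex.I * (s * η) = A
  rw [div_pow A _ a, div_pow A _ b]
  have ha := pow_ne_zero a h2
  have hb := pow_ne_zero b h2
  generalize (Real.sqrt 2 : ℂ) ^ a = y at *
  generalize (Real.sqrt 2 : ℂ) ^ b = z at *
  field_simp

theorem hk_conv (a b : ℕ) {s : ℝ} (hs : 0 < s) (x : ℝ) :
    hk (a + b) s x = Real.sqrt 2 ^ (a + b) *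
      ∫ v : ℝ, hk b (s / Real.sqrt 2) v * hk a (s / Real.sqrt 2) (x - v) := by
  have hs2 : 0 < s / Real.sqrt 2 := by positivity
  set s' := s / Real.sqrt 2 with hs'
  have key : ((hk (a + b) s x : ℝ) : ℂ) = ((Real.sqrt 2 ^ (a + b) : ℝ) : ℂ) *
      ∫ v : ℝ, (hk b s' v : ℂ) * (hk a s' (x - v) : ℂ) := by
    rw [← hk_inv (a + b) hs]
    simp_rw [mg_add a b s, mul_assoc]
    rw [integral_const_mul]
    congr 1
    simp_rw [← hs', ← hk_fourier b hs2, ← integral_mul_const]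
    rw [integral_integral_swap]
    · congr 1
      funext v
      rw [← hk_inv a hs2, ← integral_const_mul]
      congr 1
      funext η
      rw [mul_assoc, mul_left_comm _ (mg a s' η), ← Complex.exp_add]
      congr 3
      push_cast
      ring
    · have : Integrable (fun z : ℝ × ℝ => mg a s' z.1 * (hk b s' z.2 : ℂ)) (volume.prod volume) :=
        (mg_integrable a hs2).mul_prod (hk_integrable b hs2).ofReal
      refine this.mono ?_ (ae_of_all _ fun z => ?_)
      · apply Continuous.aestronglyMeasurable
        have := mg_continuous a s'
        have := hk_continuous b s'
        unfold Function.uncurry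
        fun_prop
      · simp only [Function.uncurry, norm_mul]
        rw [show -(2 * Real.pi * Complex.I * ((z.2 * z.1 : ℝ) : ℂ)) =
          ((-(2 * Real.pi * (z.2 * z.1)) : ℝ) : ℂ) * Complex.I by push_cast; ring,
          show 2 * (Real.pi * (Complex.I * ((z.1 * x : ℝ) : ℂ))) =
          ((2 * Real.pi * (z.1 * x) : ℝ) : ℂ) * Complex.I by push_cast; ring,
          Complex.norm_exp_ofReal_mul_I, Complex.norm_exp_ofReal_mul_I]
        ring_nf
        exact le_rfl
  have h2 : (∫ v : ℝ, (hk b s' v : ℂ) * (hk a s' (x - v) : ℂ)) =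
      ((∫ v : ℝ, hk b s' v * hk a s' (x - v) : ℝ) : ℂ) := by
    rw [← integral_complex_ofReal]
    simp
  rw [h2] at key
  exact_mod_cast key

theorem proj_apply {m : ℕ} (j : Corner m) (x : Idx m → ℝ) (i : Fin m) : proj j x i = x (sel j i) :=
  rfl

theorem Amat_apply {m : ℕ} (J : Matrix (Idx m) (Fin m) ℝ) (j : Corner m) (i k : Fin m) :
    Amat J j i k = J (sel j i) k := rfl

/-- The position of an index of `ℝ^{2m}`. -/
def base {m : ℕ} : Idx m → Fin m := Sum.elim id id

@[simp] theorem base_inl {m : ℕ} (h : Fin m) : base (Sum.inl h : Idx m) = h := rfl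

@[simp] theorem base_inr {m : ℕ} (h : Fin m) : base (Sum.inr h : Idx m) = h := rfl

@[simp] theorem base_sel {m : ℕ} (j : Corner m) (h : Fin m) : base (sel j h) = h := by
  unfold sel
  split_ifs <;> rfl

/-- The corner opposite to `j`. -/
def opp {m : ℕ} (j : Corner m) : Corner m := fun i => 1 - j i

theorem sel_zero {m : ℕ} {j : Corner m} {h : Fin m} (hj : j h = 0) : sel j h = Sum.inl h := by
  simp [sel, hj]

theorem sel_one {m : ℕ} {j : Corner m} {h : Fin m} (hj : j h = 1) : sel j h = Sum.inr h := by
  simp [sel, hj]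

theorem sel_congr {m : ℕ} {j j' : Corner m} {h : Fin m} (hj : j h = j' h) : sel j h = sel j' h := by
  simp [sel, hj]

theorem sel_eq_or {m : ℕ} (j : Corner m) (h : Fin m) :
    (sel j h = Sum.inl h ∧ sel (opp j) h = Sum.inr h) ∨
      (sel j h = Sum.inr h ∧ sel (opp j) h = Sum.inl h) := by
  rcases Fin.exists_fin_two.1 ⟨j h, rfl⟩ with hj | hj
  · exact Or.inl ⟨sel_zero hj, sel_one (by simp [opp, hj])⟩
  · exact Or.inr ⟨sel_one hj, sel_zero (by simp [opp, hj])⟩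

/-- A corner splits the `2m` coordinates into the selected and the opposite ones. -/
def selEquiv {m : ℕ} (j : Corner m) : Fin m ⊕ Fin m ≃ Idx m where
  toFun := Sum.elim (sel j) (sel (opp j))
  invFun κ := if sel j (base κ) = κ then Sum.inl (base κ) else Sum.inr (base κ)
  left_inv := by
    rintro (h | h)
    · simp
    · rcases sel_eq_or j h with h' | h' <;> simp [h']
  right_inv := by
    rintro (h | h)
    · rcases sel_eq_or j h with h' | h' <;> simp [h']
    · rcases sel_eq_or j h with h' | h' <;> simp [h']

theorem prod_sel {m : ℕ} {M : Type*} [CommMonoid M] (j : Corner m) (f : Idx m → M) :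
    ∏ κ, f κ = (∏ h, f (sel j h)) * ∏ h, f (sel (opp j) h) := by
  rw [← Equiv.prod_comp (selEquiv j), Fintype.prod_sum_type]
  rfl

theorem sum_sel {m : ℕ} {M : Type*} [AddCommMonoid M] (j : Corner m) (f : Idx m → M) :
    ∑ κ, f κ = (∑ h, f (sel j h)) + ∑ h, f (sel (opp j) h) := by
  rw [← Equiv.sum_comp (selEquiv j), Fintype.sum_sum_type]
  rfl

/-- Entrywise form of the regularity of all matrices `A_j`. -/
def Reg {m : ℕ} (Δ : ℝ) (J : Matrix (Idx m) (Fin m) ℝ) : Prop :=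
  ∀ j : Corner m, (∀ i k, |Amat J j i k| ≤ Δ) ∧ (Amat J j).det ≠ 0 ∧ |(Amat J j).det|⁻¹ ≤ Δ

/-- The rows of `J` with positions in `L` are symmetric. -/
def SymRows {m : ℕ} (L : Finset (Fin m)) (J : Matrix (Idx m) (Fin m) ℝ) : Prop :=
  ∀ h ∈ L, ∀ k, J (Sum.inl h) k = J (Sum.inr h) k

theorem entry_le_opNorm {m : ℕ} (A : Matrix (Fin m) (Fin m) ℝ) (i k : Fin m) :
    |A i k| ≤ opNorm A := by
  have h1 := (LinearMap.toContinuousLinearMap (Matrix.toEuclideanLin A)).le_opNorm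
    (EuclideanSpace.single k (1 : ℝ))
  simp only [PiLp.norm_single, norm_one, mul_one] at h1
  refine le_trans ?_ h1
  have h2 := PiLp.norm_apply_le ((LinearMap.toContinuousLinearMap (Matrix.toEuclideanLin A))
    (EuclideanSpace.single k (1 : ℝ))) i
  refine le_trans (le_of_eq ?_) h2
  simp [Matrix.toLpLin_apply]

theorem reg_of_isReg {m : ℕ} {Δ : ℝ} {J : Matrix (Idx m) (Fin m) ℝ}
    (h : ∀ j : Corner m, IsReg Δ (Amat J j)) : Reg Δ J :=
  fun j => ⟨fun i k => (entry_le_opNorm _ i k).trans (h j).1, (h j).2⟩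

theorem Reg.row_le {m : ℕ} {Δ : ℝ} {J : Matrix (Idx m) (Fin m) ℝ} (h : Reg Δ J) (κ : Idx m)
    (k : Fin m) : |J κ k| ≤ Δ := by
  rcases κ with i | i
  · have := (h (fun _ => 0)).1 i k
    rwa [Amat_apply, sel_zero rfl] at this
  · have := (h (fun _ => 1)).1 i k
    rwa [Amat_apply, sel_one rfl] at this

theorem inv_entry_bound (m : ℕ) (Δ : ℝ) (hΔ : 1 ≤ Δ) : ∃ C : ℝ, 1 ≤ C ∧
    ∀ A : Matrix (Fin m) (Fin m) ℝ, (∀ i k, |A i k| ≤ Δ) → |A.det|⁻¹ ≤ Δ →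
      ∀ i k, |A⁻¹ i k| ≤ C := by
  refine ⟨Δ * (m.factorial * Δ ^ m), ?_, fun A hA hd i k => ?_⟩
  · have h1 : (1 : ℝ) ≤ m.factorial := by exact_mod_cast Nat.factorial_pos m
    have h2 : (1 : ℝ) ≤ Δ ^ m := one_le_pow₀ hΔ
    nlinarith [mul_nonneg (sub_nonneg.2 h1) (sub_nonneg.2 h2)]
  · rw [Matrix.inv_def, Matrix.smul_apply, smul_eq_mul, abs_mul, Ring.inverse_eq_inv', abs_inv,
      Matrix.adjugate_apply]
    have := Matrix.det_le (A := A.updateRow k (Pi.single i 1)) (abv := AbsoluteValue.abs)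
      (x := Δ) (fun a b => by
        rw [Matrix.updateRow_apply]
        split_ifs
        · by_cases hb : b = i
          · subst hb; simpa using hΔ
          · simpa [hb] using (zero_le_one.trans hΔ)
        · exact hA a b)
    simp only [AbsoluteValue.abs_apply, Fintype.card_fin, nsmul_eq_mul] at this
    exact mul_le_mul hd this (abs_nonneg _) (by linarith)

/-- The transition matrix `A_{j̄} A_j⁻¹`. -/
def Nm {m : ℕ} (J : Matrix (Idx m) (Fin m) ℝ) (j : Corner m) : Matrix (Fin m) (Fin m) ℝ :=
  Amat J (opp j) * (Amat J j)⁻¹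

theorem Nm_bound (m : ℕ) (Δ : ℝ) (hΔ : 1 ≤ Δ) : ∃ C : ℝ, 1 ≤ C ∧
    ∀ J : Matrix (Idx m) (Fin m) ℝ, Reg Δ J → ∀ j i k, |Nm J j i k| ≤ C := by
  obtain ⟨C, hC, hb⟩ := inv_entry_bound m Δ hΔ
  refine ⟨(m + 1) * (Δ * C), ?_, fun J hJ j i k => ?_⟩
  · have : 1 ≤ Δ * C := one_le_mul_of_one_le_of_one_le hΔ hC
    nlinarith [(Nat.cast_nonneg m : (0 : ℝ) ≤ m)]
  · rw [Nm, Matrix.mul_apply]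
    refine (Finset.abs_sum_le_sum_abs _ _).trans ?_
    have : ∀ a ∈ Finset.univ, |Amat J (opp j) i a * (Amat J j)⁻¹ a k| ≤ Δ * C := fun a _ => by
      rw [abs_mul]
      exact mul_le_mul ((hJ _).1 _ _) (hb _ (hJ j).1 (hJ j).2.2 _ _) (abs_nonneg _) (by linarith)
    refine (Finset.sum_le_card_nsmul _ _ _ this).trans ?_
    simp only [Finset.card_univ, Fintype.card_fin, nsmul_eq_mul]
    have : 0 ≤ Δ * C := by positivity
    nlinarith

theorem Reg.isUnit {m : ℕ} {Δ : ℝ} {J : Matrix (Idx m) (Fin m) ℝ} (h : Reg Δ J) (j : Corner m) :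
    IsUnit (Amat J j).det := isUnit_iff_ne_zero.2 (h j).2.1

theorem Nm_row_sym {m : ℕ} {Δ : ℝ} {J : Matrix (Idx m) (Fin m) ℝ} (hJ : Reg Δ J)
    {L : Finset (Fin m)} (hs : SymRows L J) (j : Corner m) {h : Fin m} (hh : h ∈ L) (k : Fin m) :
    Nm J j h k = if h = k then 1 else 0 := by
  have h1 : ∀ a, Amat J (opp j) h a = Amat J j h a := fun a => by
    rw [Amat_apply, Amat_apply]
    rcases sel_eq_or j h with h' | h' <;> simp [h', hs h hh a]
  rw [Nm, Matrix.mul_apply]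
  simp_rw [h1]
  rw [← Matrix.mul_apply, Matrix.mul_nonsing_inv _ (hJ.isUnit j), Matrix.one_apply]

theorem Jb0_eq {m : ℕ} (J : Matrix (Idx m) (Fin m) ℝ) : Jb0 J = Amat J (fun _ => 0) := by
  ext i k
  rw [Amat_apply, sel_zero rfl]
  rfl

theorem Jb1_eq {m : ℕ} (J : Matrix (Idx m) (Fin m) ℝ) : Jb1 J = Amat J (fun _ => 1) := by
  ext i k
  rw [Amat_apply, sel_one rfl]
  rfl

/-- The frequency vector `Π^T ξ` of `ℝ^{2m}`. -/
def eta {m : ℕ} (J : Matrix (Idx m) (Fin m) ℝ) (ξ : Fin m → ℝ) : Idx m → ℝ :=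
  (PiJ J).transpose.mulVec ξ

theorem eta_inl {m : ℕ} (J : Matrix (Idx m) (Fin m) ℝ) (ξ : Fin m → ℝ) (i : Fin m) :
    eta J ξ (Sum.inl i) = ξ i := by
  simp [eta, PiJ, Matrix.mulVec, dotProduct, Matrix.one_apply]

theorem eta_inr {m : ℕ} (J : Matrix (Idx m) (Fin m) ℝ) (ξ : Fin m → ℝ) (i : Fin m) :
    eta J ξ (Sum.inr i) = -∑ k, Nm J (fun _ => 1) k i * ξ k := by
  have : opp (fun _ : Fin m => (1 : Fin 2)) = fun _ => 0 := by funext i; simp [opp]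
  simp [eta, PiJ, Matrix.mulVec, dotProduct, Nm, this, Jb0_eq, Jb1_eq]

theorem PiJ_mul {m : ℕ} {Δ : ℝ} {J : Matrix (Idx m) (Fin m) ℝ} (hJ : Reg Δ J) :
    PiJ J * J = 0 := by
  have h : J = Matrix.fromRows (Jb0 J) (Jb1 J) := by
    ext (i | i) k <;> rfl
  have hu : IsUnit (Jb1 J).det := by rw [Jb1_eq]; exact hJ.isUnit _
  have h2 : PiJ J * J = PiJ J * Matrix.fromRows (Jb0 J) (Jb1 J) := by rw [← h]
  rw [h2, PiJ, Matrix.fromCols_mul_fromRows, Matrix.one_mul, Matrix.neg_mul, Matrix.mul_assoc,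
    Matrix.nonsing_inv_mul _ hu]
  simp

theorem eta_vecMul {m : ℕ} {Δ : ℝ} {J : Matrix (Idx m) (Fin m) ℝ} (hJ : Reg Δ J)
    (ξ : Fin m → ℝ) : eta J ξ ᵥ* J = 0 := by
  rw [eta, Matrix.mulVec_transpose, Matrix.vecMul_vecMul, PiJ_mul hJ, Matrix.vecMul_zero]

theorem eta_sel {m : ℕ} {Δ : ℝ} {J : Matrix (Idx m) (Fin m) ℝ} (hJ : Reg Δ J) (ξ : Fin m → ℝ)
    (j : Corner m) (i : Fin m) :
    eta J ξ (sel j i) = -∑ k, Nm J j k i * eta J ξ (sel (opp j) k) := by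
  have h1 : proj j (eta J ξ) ᵥ* Amat J j + proj (opp j) (eta J ξ) ᵥ* Amat J (opp j) = 0 := by
    funext k
    have := congrFun (eta_vecMul hJ ξ) k
    rw [Matrix.vecMul, dotProduct, sum_sel j] at this
    exact this
  have h2 : proj j (eta J ξ) = -(proj (opp j) (eta J ξ) ᵥ* Nm J j) := by
    have h3 := congrArg (fun v => v ᵥ* (Amat J j)⁻¹) (eq_neg_of_add_eq_zero_left h1)
    simp only [Matrix.vecMul_vecMul, Matrix.mul_nonsing_inv _ (hJ.isUnit j), Matrix.vecMul_one,
      Matrix.neg_vecMul] at h3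
    exact h3
  have := congrFun h2 i
  rw [proj_apply] at this
  rw [this, Pi.neg_apply, Matrix.vecMul, dotProduct]
  simp [proj_apply, mul_comm]

theorem eta_sel_off {m : ℕ} {Δ : ℝ} {J : Matrix (Idx m) (Fin m) ℝ} (hJ : Reg Δ J)
    {L : Finset (Fin m)} (hs : SymRows L J) (ξ : Fin m → ℝ) (j : Corner m) {i : Fin m}
    (hi : i ∉ L) :
    eta J ξ (sel j i) = -∑ k ∈ Lᶜ, Nm J j k i * eta J ξ (sel (opp j) k) := by
  rw [eta_sel hJ, neg_inj]
  symm
  apply Finset.sum_subset (Finset.subset_univ _)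
  intro k _ hk
  have hk' : k ∈ L := by simpa using hk
  rw [Nm_row_sym hJ hs j hk', if_neg (by rintro rfl; exact hi hk'), zero_mul]

theorem eta_inl_add_inr {m : ℕ} {Δ : ℝ} {J : Matrix (Idx m) (Fin m) ℝ} (hJ : Reg Δ J)
    {L : Finset (Fin m)} (hs : SymRows L J) (ξ : Fin m → ℝ) {h : Fin m} (hh : h ∈ L) :
    eta J ξ (Sum.inl h) + eta J ξ (Sum.inr h) =
      -∑ k ∈ Lᶜ, Nm J (fun _ => 1) k h * eta J ξ (Sum.inl k) := by
  rw [eta_inr, eta_inl]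
  simp_rw [eta_inl]
  rw [← Finset.sum_add_sum_compl L (fun k => Nm J (fun _ => 1) k h * ξ k)]
  have : ∑ k ∈ L, Nm J (fun _ => 1) k h * ξ k = ξ h := by
    rw [Finset.sum_congr rfl fun k hk => by rw [Nm_row_sym hJ hs _ hk]]
    simp [hh]
  rw [this]
  ring

/-- A word with letters off `L` that contains both letters at some position. -/
def OffPair {m : ℕ} {ι : Type*} (L : Finset (Fin m)) (w : ι → Idx m) : Prop :=
  (∀ a, base (w a) ∉ L) ∧ ∃ i a b, w a = Sum.inl i ∧ w b = Sum.inr i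

/-- `P` is a combination, with coefficients bounded by `B`, of monomials in `Π^T ξ` each of which
contains both letters at some position off `L`. -/
def Expand {m : ℕ} (L : Finset (Fin m)) (J : Matrix (Idx m) (Fin m) ℝ) (ι : Type) [Fintype ι]
    [DecidableEq ι] (B : ℝ) (P : (Fin m → ℝ) → ℝ) : Prop :=
  ∃ c : (ι → Idx m) → ℝ, (∀ w, |c w| ≤ B) ∧ (∀ w, c w ≠ 0 → OffPair L w) ∧
    ∀ ξ, P ξ = ∑ w, c w * ∏ a, eta J ξ (w a)

section expand

variable {m : ℕ} {L : Finset (Fin m)} {J : Matrix (Idx m) (Fin m) ℝ} {ι : Type} [Fintype ι]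
  [DecidableEq ι]

theorem Expand.mono {B B' : ℝ} {P : (Fin m → ℝ) → ℝ} (h : Expand L J ι B P) (hB : B ≤ B') :
    Expand L J ι B' P := by
  obtain ⟨c, h1, h2, h3⟩ := h
  exact ⟨c, fun w => (h1 w).trans hB, h2, h3⟩

theorem Expand.sum {β : Type*} (s : Finset β) {B : ℝ} {P : β → (Fin m → ℝ) → ℝ}
    (h : ∀ a ∈ s, Expand L J ι B (P a)) : Expand L J ι (s.card * B) (fun ξ => ∑ a ∈ s, P a ξ) := by
  choose! c h1 h2 h3 using h
  refine ⟨fun w => ∑ a ∈ s, c a w, fun w => ?_, fun w hw => ?_, fun ξ => ?_⟩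
  · refine (Finset.abs_sum_le_sum_abs _ _).trans ?_
    simpa using Finset.sum_le_card_nsmul s (fun a => |c a w|) B (fun a ha => h1 a ha w)
  · obtain ⟨a, ha, hne⟩ := Finset.exists_ne_zero_of_sum_ne_zero hw
    exact h2 a ha w hne
  · simp_rw [Finset.sum_mul]
    rw [Finset.sum_comm]
    exact Finset.sum_congr rfl fun a ha => h3 a ha ξ

theorem Expand.const_mul {B D r : ℝ} {P : (Fin m → ℝ) → ℝ} (h : Expand L J ι B P) (hr : |r| ≤ D) :
    Expand L J ι (D * B) (fun ξ => r * P ξ) := by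
  obtain ⟨c, h1, h2, h3⟩ := h
  refine ⟨fun w => r * c w, fun w => ?_, fun w hw => h2 w (right_ne_zero_of_mul hw), fun ξ => ?_⟩
  · rw [abs_mul]
    exact mul_le_mul hr (h1 w) (abs_nonneg _) ((abs_nonneg _).trans hr)
  · simp only [h3, Finset.mul_sum]
    simp [mul_assoc]

theorem Expand.congr {B : ℝ} {P P' : (Fin m → ℝ) → ℝ} (h : Expand L J ι B P)
    (hP : ∀ ξ, P' ξ = P ξ) : Expand L J ι B P' := by
  obtain ⟨c, h1, h2, h3⟩ := h
  exact ⟨c, h1, h2, fun ξ => (hP ξ).trans (h3 ξ)⟩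

theorem Expand.add {B B' : ℝ} {P P' : (Fin m → ℝ) → ℝ} (h : Expand L J ι B P)
    (h' : Expand L J ι B' P') : Expand L J ι (B + B') (fun ξ => P ξ + P' ξ) := by
  obtain ⟨c, h1, h2, h3⟩ := h
  obtain ⟨c', h1', h2', h3'⟩ := h'
  refine ⟨fun w => c w + c' w, fun w => (abs_add_le _ _).trans (add_le_add (h1 w) (h1' w)),
    fun w hw => ?_, fun ξ => ?_⟩
  · by_cases hc : c w = 0
    · exact h2' w (by simpa [hc] using hw)
    · exact h2 w hc
  · simp only [h3, h3', ← Finset.sum_add_distrib]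
    simp [add_mul]

theorem OffPair.expand {w : ι → Idx m} (hw : OffPair L w) :
    Expand L J ι 1 (fun ξ => ∏ a, eta J ξ (w a)) := by
  classical
  refine ⟨fun w' => if w' = w then 1 else 0, fun w' => ?_, fun w' h => ?_, fun ξ => ?_⟩
  · dsimp only
    split_ifs <;> simp
  · have : w' = w := by
      by_contra hne
      simp [hne] at h
    rwa [this]
  · simp

/-- Replacing one of two equal letters using the linear relations between the coordinates of
`Π^T ξ` either creates a pair or a word with a larger set of positions. -/
theorem word_replace {w : ι → Idx m} (hw : ∀ a, base (w a) ∉ L) (hp : ¬ OffPair L w)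
    (hc : Lᶜ.card < Fintype.card ι) : ∃ (j : Corner m) (a : ι), w a = sel j (base (w a)) ∧
      ∀ k ∈ Lᶜ, (∀ b, base (Function.update w a (sel (opp j) k) b) ∉ L) ∧
        (OffPair L (Function.update w a (sel (opp j) k)) ∨
          (Finset.univ.image (base ∘ w)).card <
            (Finset.univ.image (base ∘ Function.update w a (sel (opp j) k))).card) := by
  classical
  obtain ⟨a, b, hab, hba⟩ : ∃ a b, a ≠ b ∧ base (w a) = base (w b) := by
    have := Finset.exists_ne_map_eq_of_card_lt_of_maps_to (s := Finset.univ) (t := Lᶜ)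
      (f := base ∘ w) (by simpa using hc) (fun a _ => by simpa using hw a)
    obtain ⟨a, _, b, _, h1, h2⟩ := this
    exact ⟨a, b, h1, h2⟩
  have hnp : ∀ i a b, w a = Sum.inl i → w b ≠ Sum.inr i := fun i a b h1 h2 =>
    hp ⟨hw, i, a, b, h1, h2⟩
  let j : Corner m := fun h => if ∃ a, w a = Sum.inr h then 1 else 0
  have hj : ∀ a, w a = sel j (base (w a)) := by
    intro a
    rcases hwa : w a with h | h
    · rw [base_inl, sel_zero]
      simp only [j]
      rw [if_neg]
      rintro ⟨b, hb⟩
      exact hnp h a b hwa hb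
    · rw [base_inr, sel_one]
      simp only [j]
      rw [if_pos ⟨a, hwa⟩]
  refine ⟨j, a, hj a, fun k hk => ?_⟩
  have hoff : ∀ b, base (Function.update w a (sel (opp j) k) b) ∉ L := by
    intro b
    by_cases hb : b = a
    · subst hb; simpa using hk
    · rw [Function.update_of_ne hb]; exact hw b
  refine ⟨hoff, ?_⟩
  by_cases hks : ∃ c, base (w c) = k
  · left
    obtain ⟨c, hca, hck⟩ : ∃ c, c ≠ a ∧ base (w c) = k := by
      obtain ⟨c, hc⟩ := hks
      by_cases h : c = a
      · exact ⟨b, hab.symm, by rw [← hba, ← h, hc]⟩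
      · exact ⟨c, h, hc⟩
    refine ⟨hoff, k, ?_⟩
    have h1 : Function.update w a (sel (opp j) k) c = sel j k := by
      rw [Function.update_of_ne hca, hj c, hck]
    have h2 : Function.update w a (sel (opp j) k) a = sel (opp j) k := by simp
    rcases sel_eq_or j k with h | h
    · exact ⟨c, a, h1.trans h.1, h2.trans h.2⟩
    · exact ⟨a, c, h2.trans h.2, h1.trans h.1⟩
  · right
    apply Finset.card_lt_card
    refine ⟨?_, fun hsub => ?_⟩
    · intro i hi
      simp only [Finset.mem_image, Finset.mem_univ, true_and, Function.comp] at hi ⊢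
      obtain ⟨c, hc⟩ := hi
      by_cases h : c = a
      · exact ⟨b, by rw [Function.update_of_ne hab.symm, ← hba, ← h, hc]⟩
      · exact ⟨c, by rw [Function.update_of_ne h, hc]⟩
    · have : k ∈ Finset.univ.image (base ∘ w) := hsub (by
        simp only [Finset.mem_image, Finset.mem_univ, true_and, Function.comp]
        exact ⟨a, by simp⟩)
      simp only [Finset.mem_image, Finset.mem_univ, true_and, Function.comp] at this
      exact hks this

end expand

theorem word_expand {m : ℕ} (L : Finset (Fin m)) (ι : Type) [Fintype ι] [DecidableEq ι]
    (hc : Lᶜ.card < Fintype.card ι) (Δ : ℝ) (hΔ : 1 ≤ Δ) : ∃ B : ℝ, 0 ≤ B ∧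
      ∀ J : Matrix (Idx m) (Fin m) ℝ, Reg Δ J → SymRows L J → ∀ w : ι → Idx m,
        (∀ a, base (w a) ∉ L) → Expand L J ι B (fun ξ => ∏ a, eta J ξ (w a)) := by
  classical
  obtain ⟨D, hD, hN⟩ := Nm_bound m Δ hΔ
  have key : ∀ K : ℕ, ∃ B : ℝ, 0 ≤ B ∧
      ∀ J : Matrix (Idx m) (Fin m) ℝ, Reg Δ J → SymRows L J → ∀ w : ι → Idx m,
        (∀ a, base (w a) ∉ L) →
        (OffPair L w ∨ Lᶜ.card < (Finset.univ.image (base ∘ w)).card + K) →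
        Expand L J ι B (fun ξ => ∏ a, eta J ξ (w a)) := by
    intro K
    induction K with
    | zero =>
      refine ⟨1, zero_le_one, fun J _ _ w hw h => ?_⟩
      rcases h with h | h
      · exact h.expand
      · exfalso
        have : (Finset.univ.image (base ∘ w)).card ≤ Lᶜ.card := by
          apply Finset.card_le_card
          intro i hi
          simp only [Finset.mem_image, Finset.mem_univ, true_and, Function.comp] at hi
          obtain ⟨a, rfl⟩ := hi
          simpa using hw a
        omega
    | succ K ih =>
      obtain ⟨B, hB, ih⟩ := ih
      refine ⟨1 + Lᶜ.card * (D * B), by positivity, fun J hJ hs w hw h => ?_⟩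
      by_cases hp : OffPair L w
      · exact hp.expand.mono (by have : 0 ≤ Lᶜ.card * (D * B) := by positivity
                                 linarith)
      · obtain ⟨j, a, hja, hk⟩ := word_replace hw hp hc
        have h' := h.resolve_left hp
        have : ∀ k ∈ Lᶜ, Expand L J ι (D * B) (fun ξ => -Nm J j k (base (w a)) *
            ∏ b, eta J ξ (Function.update w a (sel (opp j) k) b)) := by
          intro k hkL
          refine Expand.const_mul (ih J hJ hs _ (hk k hkL).1 ?_) (by
            rw [abs_neg]; exact hN J hJ _ _ _)
          rcases (hk k hkL).2 with h1 | h1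
          · exact Or.inl h1
          · right; omega
        refine ((Expand.sum _ this).congr fun ξ => ?_).mono (by linarith)
        rw [← Finset.mul_prod_erase _ _ (Finset.mem_univ a), hja,
          eta_sel_off hJ hs ξ j (hw a), ← Finset.sum_neg_distrib, Finset.sum_mul]
        refine Finset.sum_congr rfl fun k _ => ?_
        have hpr : ∏ b ∈ Finset.univ.erase a, eta J ξ (Function.update w a (sel (opp j) k) b) =
            ∏ b ∈ Finset.univ.erase a, eta J ξ (w b) := Finset.prod_congr rfl fun b hb => by
          rw [Function.update_of_ne (Finset.ne_of_mem_erase hb)]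
        rw [← Finset.mul_prod_erase _ _ (Finset.mem_univ a), Function.update_self,
          base_sel, hpr]
        ring
  obtain ⟨B, hB, h⟩ := key (Lᶜ.card + 1)
  exact ⟨B, hB, fun J hJ hs w hw => h J hJ hs w hw (Or.inr (by omega))⟩

/-- The indices of `ℝ^{2m}` with position off `L`. -/
def offIdx {m : ℕ} (L : Finset (Fin m)) : Finset (Idx m) := Finset.univ.filter fun κ => base κ ∉ L

/-- Index type for monomials of degree `2 N + 2`. -/
abbrev WordIdx (N : ℕ) := Fin 2 ⊕ (Fin N × Fin 2)

theorem symbol_expand {m : ℕ} (L : Finset (Fin m)) (N : ℕ) (hc : Lᶜ.card < 2 * N + 2)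
    (Δ : ℝ) (hΔ : 1 ≤ Δ) : ∃ B : ℝ, 0 ≤ B ∧
      ∀ J : Matrix (Idx m) (Fin m) ℝ, Reg Δ J → SymRows L J → ∀ ρ : Fin m → ℝ,
        (∀ h, |ρ h| ≤ 1) → Expand L J (WordIdx N) B (fun ξ =>
          (∑ κ ∈ offIdx L, eta J ξ κ ^ 2 +
            ∑ h ∈ L, ρ h * (eta J ξ (Sum.inl h) + eta J ξ (Sum.inr h)) ^ 2) *
            (∑ κ ∈ offIdx L, eta J ξ κ ^ 2) ^ N) := by
  classical
  obtain ⟨D, hD, hN⟩ := Nm_bound m Δ hΔ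
  obtain ⟨B, hB, hw⟩ := word_expand L (WordIdx N) (by simp; omega) Δ hΔ
  have hquad : ∀ J : Matrix (Idx m) (Fin m) ℝ, Reg Δ J → SymRows L J → ∀ κ κ', base κ ∉ L →
      base κ' ∉ L → Expand L J (WordIdx N) ((Fintype.piFinset fun _ : Fin N => offIdx L).card * B)
        (fun ξ => eta J ξ κ * eta J ξ κ' * (∑ κ ∈ offIdx L, eta J ξ κ ^ 2) ^ N) := by
    intro J hJ hs κ κ' hκ hκ'
    have : ∀ u ∈ Fintype.piFinset (fun _ : Fin N => offIdx L), Expand L J (WordIdx N) B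
        (fun ξ => ∏ a, eta J ξ ((Sum.elim ![κ, κ'] (fun p : Fin N × Fin 2 => u p.1)) a)) := by
      intro u hu
      apply hw J hJ hs
      rintro (a | a)
      · fin_cases a
        · exact hκ
        · exact hκ'
      · have := (Fintype.mem_piFinset.1 hu) a.1
        simpa [offIdx] using this
    refine (Expand.sum _ this).congr fun ξ => ?_
    rw [← Fin.prod_const, Finset.prod_univ_sum, Finset.mul_sum]
    refine Finset.sum_congr rfl fun u _ => ?_
    rw [Fintype.prod_sum_type, Fin.prod_univ_two, Fintype.prod_prod_type]
    simp [pow_two]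
  set P : ℝ := (Fintype.piFinset fun _ : Fin N => offIdx L).card * B with hP
  have hP0 : 0 ≤ P := by positivity
  refine ⟨(offIdx L).card * P + L.card * (Lᶜ.card * (Lᶜ.card * (D * D * P))), by positivity,
    fun J hJ hs ρ hρ => ?_⟩
  have h1 := Expand.sum (offIdx L) (fun κ hκ => hquad J hJ hs κ κ (by simpa [offIdx] using hκ)
    (by simpa [offIdx] using hκ))
  have h2 : Expand L J (WordIdx N) _ _ := Expand.sum L (fun h (_ : h ∈ L) =>
    Expand.sum Lᶜ fun k hk => Expand.sum Lᶜ fun k' hk' =>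
    Expand.const_mul (r := ρ h * (Nm J (fun _ => 1) k h * Nm J (fun _ => 1) k' h)) (D := D * D)
      (hquad J hJ hs (Sum.inl k) (Sum.inl k') (by simpa using hk) (by simpa using hk')) (by
        rw [abs_mul, abs_mul]
        calc |ρ h| * (|Nm J (fun _ => 1) k h| * |Nm J (fun _ => 1) k' h|) ≤ 1 * (D * D) := by
              gcongr
              · exact hρ h
              · exact hN J hJ _ _ _
              · exact hN J hJ _ _ _
          _ = _ := by ring))
  refine (h1.add h2).congr fun ξ => ?_
  rw [add_mul, Finset.sum_mul, Finset.sum_mul]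
  congr 1
  · exact Finset.sum_congr rfl fun κ _ => by ring
  · refine Finset.sum_congr rfl fun h hh => ?_
    rw [eta_inl_add_inr hJ hs ξ hh, neg_sq, pow_two, Finset.sum_mul_sum, Finset.mul_sum,
      Finset.sum_mul]
    refine Finset.sum_congr rfl fun k _ => ?_
    rw [Finset.mul_sum, Finset.sum_mul]
    exact Finset.sum_congr rfl fun k' _ => by ring

theorem mulVec_measurableEmbedding {m : ℕ} {A : Matrix (Fin m) (Fin m) ℝ} (hA : A.det ≠ 0) :
    MeasurableEmbedding (fun p : Fin m → ℝ => A *ᵥ p) := by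
  have h1 : Function.LeftInverse (fun p : Fin m → ℝ => A⁻¹ *ᵥ p) (fun p => A *ᵥ p) := fun p => by
    simp [Matrix.mulVec_mulVec, Matrix.nonsing_inv_mul _ (isUnit_iff_ne_zero.2 hA)]
  have h2 : Function.RightInverse (fun p : Fin m → ℝ => A⁻¹ *ᵥ p) (fun p => A *ᵥ p) := fun p => by
    simp [Matrix.mulVec_mulVec, Matrix.mul_nonsing_inv _ (isUnit_iff_ne_zero.2 hA)]
  let e : (Fin m → ℝ) ≃ₜ (Fin m → ℝ) :=
    { toFun := fun p => A *ᵥ p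
      invFun := fun p => A⁻¹ *ᵥ p
      left_inv := h1
      right_inv := h2
      continuous_toFun := by fun_prop
      continuous_invFun := by fun_prop }
  exact e.measurableEmbedding

theorem map_mulVec_volume {m : ℕ} {A : Matrix (Fin m) (Fin m) ℝ} (hA : A.det ≠ 0) :
    Measure.map (fun p : Fin m → ℝ => A *ᵥ p) volume = ENNReal.ofReal |A.det|⁻¹ • volume := by
  have := Real.map_matrix_volume_pi_eq_smul_volume_pi hA
  rw [abs_inv] at this
  rw [← this]
  rfl

theorem lintegral_comp_mulVec {m : ℕ} {A : Matrix (Fin m) (Fin m) ℝ} (hA : A.det ≠ 0)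
    (f : (Fin m → ℝ) → ℝ≥0∞) :
    ∫⁻ p, f (A *ᵥ p) = ENNReal.ofReal |A.det|⁻¹ * ∫⁻ p, f p := by
  rw [← (mulVec_measurableEmbedding hA).lintegral_map, map_mulVec_volume hA, lintegral_smul_measure,
    smul_eq_mul]

theorem integral_comp_mulVec {m : ℕ} {A : Matrix (Fin m) (Fin m) ℝ} (hA : A.det ≠ 0)
    (f : (Fin m → ℝ) → ℂ) :
    ∫ p, f (A *ᵥ p) = ((|A.det|⁻¹ : ℝ) : ℂ) * ∫ p, f p := by
  rw [← (mulVec_measurableEmbedding hA).integral_map, map_mulVec_volume hA, integral_smul_measure,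
    ENNReal.toReal_ofReal (by positivity), Complex.real_smul]

theorem card_corner_filter {m : ℕ} (i : Fin m) (e : Fin 2) :
    (Finset.univ.filter fun j : Corner m => j i = e).card = 2 ^ (m - 1) := by
  classical
  have : (Finset.univ.filter fun j : Corner m => j i = e) =
      Fintype.piFinset (fun k => if k = i then {e} else Finset.univ) := by
    ext j
    simp only [Finset.mem_filter, Finset.mem_univ, true_and, Fintype.mem_piFinset]
    refine ⟨fun h k => ?_, fun h => by simpa using h i⟩
    split_ifs with hk
    · subst hk; simpa using h
    · simp
  rw [this, Fintype.card_piFinset, ← Finset.mul_prod_erase _ _ (Finset.mem_univ i),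
    Finset.prod_congr rfl fun k hk => by rw [if_neg (Finset.ne_of_mem_erase hk)]]
  simp

theorem card_sel_filter {m : ℕ} (κ : Idx m) :
    (Finset.univ.filter fun j : Corner m => sel j (base κ) = κ).card = 2 ^ (m - 1) ∧
    (Finset.univ.filter fun j : Corner m => ¬ sel j (base κ) = κ).card = 2 ^ (m - 1) := by
  classical
  rcases κ with i | i
  · rw [← card_corner_filter i 0]
    nth_rw 2 [card_corner_filter i 0]
    rw [← card_corner_filter i 1]
    constructor <;> congr 1 <;> ext j <;> rcases Fin.exists_fin_two.1 ⟨j i, rfl⟩ with h | h <;>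
      simp only [Finset.mem_filter, Finset.mem_univ, true_and, base_inl] <;>
      simp [h, sel]
  · rw [← card_corner_filter i 1]
    nth_rw 2 [card_corner_filter i 1]
    rw [← card_corner_filter i 0]
    constructor <;> congr 1 <;> ext j <;> rcases Fin.exists_fin_two.1 ⟨j i, rfl⟩ with h | h <;>
      simp only [Finset.mem_filter, Finset.mem_univ, true_and, base_inr] <;>
      simp [h, sel]

theorem finner_marginal {m : ℕ} (μ : Idx m → Measure ℝ) [∀ κ, IsFiniteMeasure (μ κ)]
    (G : Corner m → (Idx m → ℝ) → ℝ≥0∞) (hG : ∀ j, Measurable (G j))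
    (hd : ∀ j κ, sel j (base κ) ≠ κ → ∀ x y, G j (Function.update x κ y) = G j x)
    (S : Finset (Idx m)) (x : Idx m → ℝ) :
    (∏ κ ∈ S, μ κ Set.univ) *
      (∫⋯∫⁻_S, (fun x => ∏ j, G j x ^ ((2 ^ (m - 1) : ℕ) : ℝ)⁻¹) ∂μ) x ≤
      ∏ j, ((∫⋯∫⁻_S, G j ∂μ) x) ^ ((2 ^ (m - 1) : ℕ) : ℝ)⁻¹ := by
  classical
  set q : ℕ := 2 ^ (m - 1) with hq
  have hq0 : (q : ℝ) ≠ 0 := by positivity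
  have hGm : Measurable (fun x => ∏ j, G j x ^ (q : ℝ)⁻¹) :=
    Finset.measurable_prod _ fun j _ => (hG j).pow_const _
  induction S using Finset.induction generalizing x with
  | empty => simp
  | insert κ S hκ ih =>
    rw [lmarginal_insert _ hGm hκ, Finset.prod_insert hκ, mul_assoc]
    have hins : ∀ j, (∫⋯∫⁻_insert κ S, G j ∂μ) x =
        ∫⁻ y, (∫⋯∫⁻_S, G j ∂μ) (Function.update x κ y) ∂μ κ :=
      fun j => lmarginal_insert _ (hG j) hκ x
    have hconst : ∀ j, ¬ sel j (base κ) = κ → ∀ y,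
        (∫⋯∫⁻_S, G j ∂μ) (Function.update x κ y) = (∫⋯∫⁻_S, G j ∂μ) x := by
      intro j hj y
      have hz : G j ∘ (Function.update · κ y) = G j := funext fun z => hd j κ hj z y
      rw [lmarginal_update_of_notMem (hG j) hκ, hz]
    have hm : ∀ j, Measurable (fun y => (∫⋯∫⁻_S, G j ∂μ) (Function.update x κ y)) := fun j =>
      ((hG j).lmarginal μ).comp (measurable_update x)
    have hsplit : ∀ f : Corner m → ℝ≥0∞, ∏ j, f j =
        (∏ j with sel j (base κ) = κ, f j) * ∏ j with ¬ sel j (base κ) = κ, f j := fun f =>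
      (Finset.prod_filter_mul_prod_filter_not _ _ _).symm
    calc μ κ Set.univ * ((∏ κ ∈ S, μ κ Set.univ) *
          ∫⁻ y, (∫⋯∫⁻_S, (fun x => ∏ j, G j x ^ (q : ℝ)⁻¹) ∂μ) (Function.update x κ y) ∂μ κ)
        ≤ μ κ Set.univ *
            ∫⁻ y, ∏ j, ((∫⋯∫⁻_S, G j ∂μ) (Function.update x κ y)) ^ (q : ℝ)⁻¹ ∂μ κ := by
          gcongr
          rw [← lintegral_const_mul]
          · exact lintegral_mono fun y => ih _
          · exact (hGm.lmarginal μ).comp (measurable_update x)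
      _ = μ κ Set.univ * ∫⁻ y, (∏ j with sel j (base κ) = κ,
            ((∫⋯∫⁻_S, G j ∂μ) (Function.update x κ y)) ^ (q : ℝ)⁻¹) *
            (∏ j with ¬ sel j (base κ) = κ, ((∫⋯∫⁻_S, G j ∂μ) x) ^ (q : ℝ)⁻¹) ∂μ κ := by
          congr 1
          refine lintegral_congr fun y => ?_
          rw [hsplit]
          congr 1
          refine Finset.prod_congr rfl fun j hj => ?_
          rw [hconst j (Finset.mem_filter.1 hj).2]
      _ = (∫⁻ y, (∏ j with sel j (base κ) = κ,
            ((∫⋯∫⁻_S, G j ∂μ) (Function.update x κ y)) ^ (q : ℝ)⁻¹) ∂μ κ) *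
            (μ κ Set.univ *
            ∏ j with ¬ sel j (base κ) = κ, ((∫⋯∫⁻_S, G j ∂μ) x) ^ (q : ℝ)⁻¹) := by
          rw [lintegral_mul_const]
          · ring
          · exact Finset.measurable_prod _ fun j _ => (hm j).pow_const _
      _ ≤ (∏ j with sel j (base κ) = κ,
            (∫⁻ y, (∫⋯∫⁻_S, G j ∂μ) (Function.update x κ y) ∂μ κ) ^ (q : ℝ)⁻¹) *
            ∏ j with ¬ sel j (base κ) = κ,
              (∫⁻ y, (∫⋯∫⁻_S, G j ∂μ) (Function.update x κ y) ∂μ κ) ^ (q : ℝ)⁻¹ := by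
          apply mul_le_mul'
          · apply ENNReal.lintegral_prod_norm_pow_le
            · exact fun j _ => (hm j).aemeasurable
            · rw [Finset.sum_const, (card_sel_filter κ).1, nsmul_eq_mul, ← hq]
              exact mul_inv_cancel₀ hq0
            · exact fun _ _ => by positivity
          · apply le_of_eq
            have h1 : ∀ j ∈ Finset.univ.filter (fun j : Corner m => ¬ sel j (base κ) = κ),
                (∫⁻ y, (∫⋯∫⁻_S, G j ∂μ) (Function.update x κ y) ∂μ κ) ^ (q : ℝ)⁻¹ =
                (μ κ Set.univ) ^ (q : ℝ)⁻¹ * ((∫⋯∫⁻_S, G j ∂μ) x) ^ (q : ℝ)⁻¹ := by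
              intro j hj
              simp_rw [hconst j (Finset.mem_filter.1 hj).2]
              rw [lintegral_const, ENNReal.mul_rpow_of_nonneg _ _ (by positivity), mul_comm]
            rw [Finset.prod_congr rfl h1, Finset.prod_mul_distrib, Finset.prod_const,
              (card_sel_filter κ).2, ← hq, ← ENNReal.rpow_natCast, ← ENNReal.rpow_mul,
              inv_mul_cancel₀ hq0, ENNReal.rpow_one]
      _ = _ := by
          rw [← hsplit]
          simp_rw [hins]

/-- A point of `ℝ^{2m}` is determined by its projections to a corner and to the opposite one. -/
theorem measurePreserving_split {m : ℕ} (μ : Idx m → Measure ℝ) [∀ κ, SigmaFinite (μ κ)]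
    (j : Corner m) : MeasurePreserving (fun x : Idx m → ℝ => (proj j x, proj (opp j) x))
      (Measure.pi μ) ((Measure.pi fun h => μ (sel j h)).prod
        (Measure.pi fun h => μ (sel (opp j) h))) := by
  have h1 := (measurePreserving_piCongrLeft μ (selEquiv j)).symm
  have h2 := measurePreserving_sumPiEquivProdPi (fun a => μ (selEquiv j a))
  exact h2.comp h1

theorem lintegral_split {m : ℕ} (μ : Idx m → Measure ℝ) [∀ κ, SigmaFinite (μ κ)]
    (j : Corner m) {f : (Fin m → ℝ) → ℝ≥0∞} (hf : Measurable f) :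
    ∫⁻ x, f (proj j x) ∂(Measure.pi μ) =
      (∏ h, μ (sel (opp j) h) Set.univ) * ∫⁻ y, f y ∂(Measure.pi fun h => μ (sel j h)) := by
  have h := (measurePreserving_split μ j).lintegral_comp (f := fun z => f z.1)
    (hf.comp measurable_fst)
  rw [h, lintegral_prod (fun z => f z.1) (hf.comp measurable_fst).aemeasurable]
  simp only [lintegral_const, Measure.pi_univ]
  rw [lintegral_mul_const _ hf, mul_comm]

theorem finner {m : ℕ} (μ : Idx m → Measure ℝ) [∀ κ, IsFiniteMeasure (μ κ)]
    (hμ : ∀ κ, μ κ Set.univ ≠ 0)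
    (g : Corner m → (Fin m → ℝ) → ℝ≥0∞) (hg : ∀ j, Measurable (g j)) :
    ∫⁻ x, ∏ j, g j (proj j x) ∂(Measure.pi μ) ≤
      ∏ j, (∫⁻ y, g j y ^ (2 ^ (m - 1) : ℕ) ∂(Measure.pi fun h => μ (sel j h))) ^
        ((2 ^ (m - 1) : ℕ) : ℝ)⁻¹ := by
  classical
  set q : ℕ := 2 ^ (m - 1) with hq
  have hq0 : (q : ℝ) ≠ 0 := by positivity
  have hpm : ∀ j : Corner m, Measurable (proj j : (Idx m → ℝ) → _) := fun j =>
    measurable_pi_lambda _ fun i => measurable_pi_apply _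
  have h := finner_marginal μ (fun j x => g j (proj j x) ^ q)
    (fun j => ((hg j).comp (hpm j)).pow_const _) (by
      intro j κ hκ x y
      congr 2
      funext i
      rw [proj_apply, proj_apply, Function.update_of_ne]
      rintro rfl
      simp at hκ) Finset.univ 0
  simp only [lmarginal_univ] at h
  have hroot : ∀ z : ℝ≥0∞, (z ^ q) ^ (q : ℝ)⁻¹ = z := fun z => by
    rw [← ENNReal.rpow_natCast, ← ENNReal.rpow_mul, mul_inv_cancel₀ hq0, ENNReal.rpow_one]
  rw [← hq] at h
  simp_rw [hroot] at h
  have h2 : ∀ j : Corner m, (∫⁻ x, g j (proj j x) ^ q ∂(Measure.pi μ)) ^ (q : ℝ)⁻¹ =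
      (∏ h, μ (sel (opp j) h) Set.univ) ^ (q : ℝ)⁻¹ *
        (∫⁻ y, g j y ^ q ∂(Measure.pi fun h => μ (sel j h))) ^ (q : ℝ)⁻¹ := fun j => by
    rw [lintegral_split μ j ((hg j).pow_const q), ENNReal.mul_rpow_of_nonneg _ _ (by positivity)]
  simp_rw [h2] at h
  rw [Finset.prod_mul_distrib] at h
  have h3 : ∏ j : Corner m, (∏ h, μ (sel (opp j) h) Set.univ) ^ (q : ℝ)⁻¹ =
      ∏ κ, μ κ Set.univ := by
    have : ∀ j : Corner m, (∏ h, μ (sel (opp j) h) Set.univ) ^ (q : ℝ)⁻¹ =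
        ∏ κ, if ¬ sel j (base κ) = κ then (μ κ Set.univ) ^ (q : ℝ)⁻¹ else 1 := by
      intro j
      rw [prod_sel j, Finset.prod_eq_one (s := Finset.univ)
        (f := fun h => if ¬sel j (base (sel j h)) = sel j h then _ else _)
        (fun h _ => by simp), one_mul, ← ENNReal.prod_rpow_of_nonneg (by positivity)]
      refine Finset.prod_congr rfl fun h _ => ?_
      rw [if_pos]
      rcases sel_eq_or j h with h' | h' <;> simp [h']
    simp_rw [this]
    rw [Finset.prod_comm]
    refine Finset.prod_congr rfl fun κ _ => ?_
    rw [← Finset.prod_filter, Finset.prod_const, (card_sel_filter κ).2, ← hq,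
      ← ENNReal.rpow_natCast, ← ENNReal.rpow_mul, inv_mul_cancel₀ hq0, ENNReal.rpow_one]
  rw [h3] at h
  refine (ENNReal.mul_le_mul_iff_right ?_ ?_).1 h
  · exact Finset.prod_ne_zero_iff.2 fun κ _ => hμ κ
  · exact ENNReal.prod_ne_top fun κ _ => measure_ne_top _ _

/-- The superposition of Gaussians centred on the range of `J`. -/
def gaussMass {m : ℕ} (J : Matrix (Idx m) (Fin m) ℝ) (s : Fin m → ℝ) (x : Idx m → ℝ) : ℝ≥0∞ :=
  ∫⁻ p : Fin m → ℝ, ∏ κ, ENNReal.ofReal (hk 0 (s (base κ)) (x κ - (J *ᵥ p) κ))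

theorem lintegral_prod_pi {ι : Type*} [Fintype ι] (μ : ι → Measure ℝ) [∀ i, SigmaFinite (μ i)]
    (f : ι → ℝ → ℝ≥0∞) (hf : ∀ i, Measurable (f i)) :
    ∫⁻ x, ∏ i, f i (x i) ∂(Measure.pi μ) = ∏ i, ∫⁻ y, f i y ∂(μ i) := by
  classical
  have hm : Measurable fun x : ι → ℝ => ∏ i, f i (x i) :=
    Finset.measurable_prod _ fun i _ => (hf i).comp (measurable_pi_apply i)
  have key : ∀ (S : Finset ι) (x : ι → ℝ), (∫⋯∫⁻_S, (fun x => ∏ i, f i (x i)) ∂μ) x =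
      (∏ i ∈ S, ∫⁻ y, f i y ∂(μ i)) * ∏ i ∈ Sᶜ, f i (x i) := by
    intro S
    induction S using Finset.induction with
    | empty => simp
    | insert i S hi ih =>
      intro x
      have hc : Sᶜ = insert i (insert i S)ᶜ := by
        ext k
        by_cases hk : k = i <;> simp [hk, hi]
      have h1 : ∀ y, ∏ k ∈ Sᶜ, f k (Function.update x i y k) =
          f i y * ∏ k ∈ (insert i S)ᶜ, f k (x k) := by
        intro y
        rw [hc, Finset.prod_insert (by simp), Function.update_self]
        congr 1
        refine Finset.prod_congr rfl fun k hk => ?_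
        rw [Function.update_of_ne]
        rintro rfl
        simp at hk
      rw [lmarginal_insert _ hm hi, Finset.prod_insert hi]
      simp_rw [ih, h1, ← mul_assoc]
      rw [lintegral_mul_const _ ((hf i).const_mul _), lintegral_const_mul _ (hf i)]
      ring
  have h := key Finset.univ 0
  rw [lmarginal_univ] at h
  simpa using h

theorem mulVec_sel {m : ℕ} (J : Matrix (Idx m) (Fin m) ℝ) (j : Corner m) (p : Fin m → ℝ)
    (h : Fin m) : (J *ᵥ p) (sel j h) = (Amat J j *ᵥ p) h := rfl

theorem gaussMass_eq {m : ℕ} {Δ : ℝ} {J : Matrix (Idx m) (Fin m) ℝ} (hJ : Reg Δ J)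
    (s : Fin m → ℝ) (x : Idx m → ℝ) (j : Corner m) :
    gaussMass J s x = ENNReal.ofReal |(Amat J j).det|⁻¹ * ∫⁻ u : Fin m → ℝ,
      ∏ h, (ENNReal.ofReal (hk 0 (s h) (u h)) * ENNReal.ofReal (hk 0 (s h)
        (proj (opp j) x h - (Nm J j *ᵥ proj j x) h + (Nm J j *ᵥ u) h))) := by
  obtain ⟨Φ, hΦ⟩ : ∃ Φ : (Fin m → ℝ) → ℝ≥0∞, ∀ v, Φ v =
      ∏ h, (ENNReal.ofReal (hk 0 (s h) ((proj j x - v) h)) *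
        ENNReal.ofReal (hk 0 (s h) (proj (opp j) x h - (Nm J j *ᵥ v) h))) := ⟨_, fun _ => rfl⟩
  have h1 : ∀ p : Fin m → ℝ, ∏ κ, ENNReal.ofReal (hk 0 (s (base κ)) (x κ - (J *ᵥ p) κ)) =
      Φ (Amat J j *ᵥ p) := by
    intro p
    rw [hΦ, prod_sel j, ← Finset.prod_mul_distrib]
    refine Finset.prod_congr rfl fun h _ => ?_
    rw [mulVec_sel, mulVec_sel, base_sel, base_sel, Nm, Matrix.mulVec_mulVec, Matrix.mul_assoc,
      Matrix.nonsing_inv_mul _ (hJ.isUnit j), Matrix.mul_one]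
    rfl
  refine ((lintegral_congr h1).trans (lintegral_comp_mulVec (hJ j).2.1 _)).trans ?_
  rw [← lintegral_sub_left_eq_self _ (proj j x)]
  congr 1
  refine lintegral_congr fun u => (hΦ _).trans (Finset.prod_congr rfl fun h _ => ?_)
  rw [sub_sub_cancel, Matrix.mulVec_sub, Pi.sub_apply]
  congr 3
  ring

theorem lintegral_gauss_half {s : ℝ} (hs : 0 < s) :
    ∫⁻ x : ℝ, ENNReal.ofReal (s⁻¹ * Real.exp (-(Real.pi / 2) * (x / s) ^ 2)) =
      ENNReal.ofReal (Real.sqrt 2) := by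
  rw [← ofReal_integral_eq_lintegral_ofReal
    ((integrable_exp_neg_sq_div (by positivity) hs).const_mul _)
    (Filter.Eventually.of_forall fun x => by positivity), integral_const_mul,
    Measure.integral_comp_div (fun x => Real.exp (-(Real.pi / 2) * x ^ 2)), integral_gaussian,
    smul_eq_mul, abs_of_pos hs, inv_mul_cancel_left₀ hs.ne']
  congr 2
  field_simp

/-- Pointwise Gaussian decay of `gaussMass` away from the range of `J`. -/
theorem gaussMass_le (m : ℕ) (Δ : ℝ) (hΔ : 1 ≤ Δ) : ∃ C c : ℝ, 0 < C ∧ 0 < c ∧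
    ∀ (J : Matrix (Idx m) (Fin m) ℝ) (L : Finset (Fin m)) (s : Fin m → ℝ), Reg Δ J →
      SymRows L J → (∀ h, 0 < s h) → (∀ h ∉ L, ∀ k, s k ≤ s h) →
      ∀ (x : Idx m → ℝ) (j : Corner m) (h : Fin m),
        gaussMass J s x ≤ ENNReal.ofReal (C * (∏ k, (s k)⁻¹) *
          Real.exp (-c * ((proj (opp j) x h - (Nm J j *ᵥ proj j x) h) / s h) ^ 2)) := by
  obtain ⟨B, hB1, hB⟩ := Nm_bound m Δ hΔ
  have hB0 : 0 < B := by linarith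
  have hc : 0 < Real.pi / (4 * (B ^ 2 * m + 1)) := by positivity
  refine ⟨Δ * Real.sqrt 2 ^ m, Real.pi / (4 * (B ^ 2 * m + 1)), by positivity, hc, ?_⟩
  set c := Real.pi / (4 * (B ^ 2 * m + 1)) with hcdef
  have hcπ : c * (4 * (B ^ 2 * m + 1)) = Real.pi := by rw [hcdef]; field_simp
  intro J L s hJ hS hs hL x j h
  rw [gaussMass_eq hJ s x j]
  set w : Fin m → ℝ := fun h => proj (opp j) x h - (Nm J j *ᵥ proj j x) h with hw
  have hNu : ∀ u : Fin m → ℝ, ((Nm J j *ᵥ u) h / s h) ^ 2 ≤ B ^ 2 * m * ∑ k, (u k / s k) ^ 2 := by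
    intro u
    by_cases hh : h ∈ L
    · have : (Nm J j *ᵥ u) h = u h := by
        simp [Matrix.mulVec, dotProduct, Nm_row_sym hJ hS j hh]
      rw [this]
      have h1 : (u h / s h) ^ 2 ≤ ∑ k, (u k / s k) ^ 2 :=
        Finset.single_le_sum (f := fun k => (u k / s k) ^ 2) (fun k _ => sq_nonneg _)
          (Finset.mem_univ h)
      have h2 : (1 : ℝ) ≤ m := by exact_mod_cast (Fin.pos h)
      have h3 : (1 : ℝ) ≤ B ^ 2 * m := by nlinarith
      nlinarith [Finset.sum_nonneg (s := Finset.univ) (f := fun k => (u k / s k) ^ 2)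
        (fun k _ => sq_nonneg _)]
    · have h1 : (Nm J j *ᵥ u) h / s h = ∑ k, Nm J j h k * (u k / s h) := by
        simp only [Matrix.mulVec, dotProduct, Finset.sum_div, mul_div_assoc]
      have h2 : |(Nm J j *ᵥ u) h / s h| ≤ ∑ k, B * |u k / s k| := by
        rw [h1]
        refine (Finset.abs_sum_le_sum_abs _ _).trans (Finset.sum_le_sum fun k _ => ?_)
        rw [abs_mul]
        refine mul_le_mul (hB J hJ j h k) ?_ (abs_nonneg _) hB0.le
        rw [abs_div, abs_div, abs_of_pos (hs h), abs_of_pos (hs k)]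
        exact div_le_div_of_nonneg_left (abs_nonneg _) (hs k) (hL h hh k)
      calc ((Nm J j *ᵥ u) h / s h) ^ 2 = |(Nm J j *ᵥ u) h / s h| ^ 2 := (sq_abs _).symm
        _ ≤ (∑ k, B * |u k / s k|) ^ 2 := by gcongr
        _ ≤ (Finset.univ : Finset (Fin m)).card * ∑ k, (B * |u k / s k|) ^ 2 :=
          sq_sum_le_card_mul_sum_sq
        _ = B ^ 2 * m * ∑ k, (u k / s k) ^ 2 := by
          simp only [mul_pow, sq_abs, ← Finset.mul_sum, Finset.card_univ, Fintype.card_fin]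
          ring
  have key : ∀ u : Fin m → ℝ,
      (∏ h, (ENNReal.ofReal (hk 0 (s h) (u h)) * ENNReal.ofReal (hk 0 (s h)
        (w h + (Nm J j *ᵥ u) h)))) ≤
      ENNReal.ofReal ((∏ k, (s k)⁻¹) * Real.exp (-c * (w h / s h) ^ 2)) *
        ∏ k, ENNReal.ofReal ((s k)⁻¹ * Real.exp (-(Real.pi / 2) * (u k / s k) ^ 2)) := by
    intro u
    rw [← ENNReal.ofReal_prod_of_nonneg (fun k _ => by have := hs k; positivity),
      ← ENNReal.ofReal_mul (mul_nonneg (Finset.prod_nonneg fun k _ => (inv_pos.2 (hs k)).le)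
        (Real.exp_pos _).le)]
    simp_rw [← ENNReal.ofReal_mul (hk_zero_nonneg (hs _) _)]
    rw [← ENNReal.ofReal_prod_of_nonneg (fun k _ => mul_nonneg (hk_zero_nonneg (hs k) _)
      (hk_zero_nonneg (hs k) _))]
    apply ENNReal.ofReal_le_ofReal
    simp only [hk_zero, Finset.prod_mul_distrib, ← Real.exp_sum]
    have e1 : -Real.pi * ∑ k, (u k / s k) ^ 2 + -Real.pi * ((w h + (Nm J j *ᵥ u) h) / s h) ^ 2 ≤
        -c * (w h / s h) ^ 2 + -(Real.pi / 2) * ∑ k, (u k / s k) ^ 2 := by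
      have h1 := hNu u
      set a := (Nm J j *ᵥ u) h / s h
      set σ := ∑ k, (u k / s k) ^ 2
      set b := w h / s h
      have hσ : 0 ≤ σ := Finset.sum_nonneg fun k _ => sq_nonneg _
      rw [add_div]
      have h2 : b ^ 2 ≤ 2 * (b + a) ^ 2 + 2 * a ^ 2 := by nlinarith [sq_nonneg (b + 2 * a)]
      have h3 : c * b ^ 2 ≤ 2 * c * (b + a) ^ 2 + 2 * c * (B ^ 2 * m * σ) := by nlinarith
      have h4 : 2 * c * (B ^ 2 * m * σ) ≤ Real.pi / 2 * σ := by
        rw [← hcπ]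
        nlinarith [mul_nonneg hc.le hσ]
      have h5 : 2 * c * (b + a) ^ 2 ≤ Real.pi * (b + a) ^ 2 := by
        gcongr
        rw [← hcπ]
        have : 0 ≤ c * (B ^ 2 * m) := by positivity
        nlinarith
      nlinarith
    have e2 : ∑ k, -Real.pi * ((w k + (Nm J j *ᵥ u) k) / s k) ^ 2 ≤
        -Real.pi * ((w h + (Nm J j *ᵥ u) h) / s h) ^ 2 := by
      rw [← Finset.mul_sum]
      have := Finset.single_le_sum (f := fun k => ((w k + (Nm J j *ᵥ u) k) / s k) ^ 2)
        (fun k _ => sq_nonneg _) (Finset.mem_univ h)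
      nlinarith [Real.pi_pos]
    have hP : 0 ≤ ∏ k, (s k)⁻¹ := Finset.prod_nonneg fun k _ => (inv_pos.2 (hs k)).le
    calc (∏ k, (s k)⁻¹) * Real.exp (∑ k, -Real.pi * (u k / s k) ^ 2) *
          ((∏ k, (s k)⁻¹) * Real.exp (∑ k, -Real.pi * ((w k + (Nm J j *ᵥ u) k) / s k) ^ 2))
        = (∏ k, (s k)⁻¹) * (∏ k, (s k)⁻¹) * Real.exp (∑ k, -Real.pi * (u k / s k) ^ 2 +
          ∑ k, -Real.pi * ((w k + (Nm J j *ᵥ u) k) / s k) ^ 2) := by rw [Real.exp_add]; ring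
      _ ≤ (∏ k, (s k)⁻¹) * (∏ k, (s k)⁻¹) * Real.exp (-c * (w h / s h) ^ 2 +
          ∑ k, -(Real.pi / 2) * (u k / s k) ^ 2) := by
        refine mul_le_mul_of_nonneg_left (Real.exp_le_exp.2 ?_) (mul_nonneg hP hP)
        rw [← Finset.mul_sum, ← Finset.mul_sum, ← Finset.mul_sum]
        rw [← Finset.mul_sum] at e2
        linarith
      _ = _ := by rw [Real.exp_add]; ring
  calc ENNReal.ofReal |(Amat J j).det|⁻¹ * ∫⁻ u : Fin m → ℝ,
      ∏ h, (ENNReal.ofReal (hk 0 (s h) (u h)) * ENNReal.ofReal (hk 0 (s h)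
        (w h + (Nm J j *ᵥ u) h)))
      ≤ ENNReal.ofReal Δ * ∫⁻ u : Fin m → ℝ,
        ENNReal.ofReal ((∏ k, (s k)⁻¹) * Real.exp (-c * (w h / s h) ^ 2)) *
        ∏ k, ENNReal.ofReal ((s k)⁻¹ * Real.exp (-(Real.pi / 2) * (u k / s k) ^ 2)) := by
        gcongr with u
        · exact (hJ j).2.2
        · exact key u
    _ = ENNReal.ofReal Δ * (ENNReal.ofReal ((∏ k, (s k)⁻¹) * Real.exp (-c * (w h / s h) ^ 2)) *
        ENNReal.ofReal (Real.sqrt 2) ^ m) := by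
        rw [lintegral_const_mul' _ _ ENNReal.ofReal_ne_top, volume_pi,
          lintegral_prod_pi (fun _ : Fin m => (volume : Measure ℝ))
            (fun k a => ENNReal.ofReal ((s k)⁻¹ * Real.exp (-(Real.pi / 2) * (a / s k) ^ 2)))
            (fun k => by fun_prop)]
        simp_rw [lintegral_gauss_half (hs _)]
        simp
    _ = _ := by
        have hP : 0 ≤ ∏ k, (s k)⁻¹ := Finset.prod_nonneg fun k _ => (inv_pos.2 (hs k)).le
        rw [← ENNReal.ofReal_pow (by positivity), ← ENNReal.ofReal_mul (by positivity),
          ← ENNReal.ofReal_mul (by linarith)]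
        congr 1
        ring

theorem prod_corner_sel {m : ℕ} {M : Type*} [CommMonoid M] (f : Idx m → M) :
    ∏ j : Corner m, ∏ h, f (sel j h) = (∏ κ, f κ) ^ (2 ^ (m - 1)) := by
  classical
  rw [Finset.prod_comm, Fintype.prod_sum_type, mul_pow, ← Finset.prod_pow, ← Finset.prod_pow,
    ← Finset.prod_mul_distrib]
  refine Finset.prod_congr rfl fun h _ => ?_
  rw [← Finset.prod_filter_mul_prod_filter_not Finset.univ (fun j : Corner m => j h = 0)]
  congr 1
  · rw [Finset.prod_congr rfl fun j hj => by rw [sel_zero (Finset.mem_filter.1 hj).2],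
      Finset.prod_const, card_corner_filter]
  · have : (Finset.univ.filter fun j : Corner m => ¬ j h = 0) =
        Finset.univ.filter fun j : Corner m => j h = 1 := by
      ext j
      simp only [Finset.mem_filter, Finset.mem_univ, true_and]
      omega
    rw [this, Finset.prod_congr rfl fun j hj => by rw [sel_one (Finset.mem_filter.1 hj).2],
      Finset.prod_const, card_corner_filter]

theorem box_eq_Icc {m : ℕ} (a b : Fin m → ℝ) : box a b = Set.Icc a b := by
  ext x
  simp only [box, Set.mem_ofPred_eq, Set.mem_Icc, Pi.le_def]
  exact forall_and

theorem two_zpow_eq {m : ℕ} (hm : 0 < m) :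
    (2 : ℝ) ^ ((1 : ℤ) - (m : ℤ)) = ((2 ^ (m - 1) : ℕ) : ℝ)⁻¹ := by
  obtain ⟨n, rfl⟩ : ∃ n, m = n + 1 := ⟨m - 1, by omega⟩
  have : (1 : ℤ) - ((n + 1 : ℕ) : ℤ) = -(n : ℤ) := by push_cast; ring
  rw [this, _root_.zpow_neg, zpow_natCast, Nat.add_sub_cancel]
  push_cast
  rfl

theorem lintegral_box_eq {m : ℕ} (hm : 0 < m) {F : (Fin m → ℝ) → ℝ} (hF : Continuous F)
    {a b : Fin m → ℝ} (hab : ∀ i, a i < b i) :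
    (∫⁻ y in box a b, ‖F y‖ₑ ^ (2 ^ (m - 1) : ℕ)) ^ ((2 ^ (m - 1) : ℕ) : ℝ)⁻¹ =
      ENNReal.ofReal ((∏ i, (b i - a i)) ^ ((2 ^ (m - 1) : ℕ) : ℝ)⁻¹ * avg (box a b) F) := by
  set q : ℕ := 2 ^ (m - 1) with hq
  have hI : IntegrableOn (fun y => |F y| ^ q) (box a b) := by
    rw [box_eq_Icc]
    exact (Continuous.continuousOn (by fun_prop)).integrableOn_compact isCompact_Icc
  have hV : 0 < ∏ i, (b i - a i) := Finset.prod_pos fun i _ => sub_pos.2 (hab i)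
  have hvol : (volume (box a b)).toReal = ∏ i, (b i - a i) := by
    rw [box_eq_Icc, Real.volume_Icc_pi_toReal fun i => (hab i).le]
  have hI0 : 0 ≤ ∫ y in box a b, |F y| ^ q := integral_nonneg fun y => by positivity
  have h1 : ∫⁻ y in box a b, ‖F y‖ₑ ^ q = ENNReal.ofReal (∫ y in box a b, |F y| ^ q) := by
    rw [ofReal_integral_eq_lintegral_ofReal hI (Filter.Eventually.of_forall fun y => by positivity)]
    refine lintegral_congr fun y => ?_
    rw [ENNReal.ofReal_pow (abs_nonneg _), ← Real.norm_eq_abs, ofReal_norm]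
  rw [h1, ENNReal.ofReal_rpow_of_nonneg hI0 (by positivity), avg, hvol, two_zpow_eq hm, ← hq,
    ← Real.mul_rpow hV.le (by positivity), mul_inv_cancel_left₀ hV.ne']

theorem proj_measurable {m : ℕ} (j : Corner m) : Measurable (proj j : (Idx m → ℝ) → Fin m → ℝ) :=
  measurable_pi_lambda _ fun _ => measurable_pi_apply _

theorem box_bound {m : ℕ} (hm : 0 < m) {α : ℝ} (hα : 0 ≤ α) {F : Corner m → (Fin m → ℝ) → ℝ}
    (hF : ∀ j, Continuous (F j)) {M : Corner m → ℝ} {c r : Idx m → ℝ} (hr : ∀ κ, 0 < r κ)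
    {ε : ℝ} (hε : 0 < ε) (hεe : ∀ j, ε ≤ ecc (proj j (c - r)) (proj j (c + r)))
    (hM : ∀ j, (ecc (proj j (c - r)) (proj j (c + r)) ^ α) ^ ((2 : ℝ) ^ ((1 : ℤ) - (m : ℤ))) *
      avg (box (proj j (c - r)) (proj j (c + r))) (F j) ≤ M j) :
    ∫⁻ x in Set.univ.pi fun κ => Set.Icc (c κ - r κ) (c κ + r κ), ∏ j, ‖F j (proj j x)‖ₑ ≤
      ENNReal.ofReal ((∏ κ, 2 * r κ) * ε ^ (-(2 * α)) * ∏ j, M j) := by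
  set q : ℕ := 2 ^ (m - 1) with hq
  have hq0 : (0 : ℝ) < q := by positivity
  have hμ : ∀ κ, (volume.restrict (Set.Icc (c κ - r κ) (c κ + r κ))) Set.univ ≠ 0 := fun κ => by
    rw [Measure.restrict_apply_univ, Real.volume_Icc]
    simp only [ne_eq, ENNReal.ofReal_eq_zero, not_le]
    linarith [hr κ]
  have h1 := finner (fun κ => volume.restrict (Set.Icc (c κ - r κ) (c κ + r κ))) hμ
    (fun j y => ‖F j y‖ₑ) (fun j => (hF j).measurable.enorm)
  rw [← Measure.restrict_pi_pi, ← volume_pi] at h1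
  refine h1.trans ?_
  have h2 : ∀ j : Corner m, (∫⁻ y, ‖F j y‖ₑ ^ q ∂(Measure.pi fun h =>
      volume.restrict (Set.Icc (c (sel j h) - r (sel j h)) (c (sel j h) + r (sel j h))))) ^
        (q : ℝ)⁻¹ ≤ ENNReal.ofReal ((∏ h, 2 * r (sel j h)) ^ (q : ℝ)⁻¹ *
          (((ε ^ α) ^ (q : ℝ)⁻¹)⁻¹ * M j)) := by
    intro j
    have hb : (Set.univ.pi fun h => Set.Icc (c (sel j h) - r (sel j h)) (c (sel j h) + r (sel j h)))
        = box (proj j (c - r)) (proj j (c + r)) := by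
      rw [box_eq_Icc, ← Set.pi_univ_Icc]
      rfl
    rw [← Measure.restrict_pi_pi, ← volume_pi, hb, hq, lintegral_box_eq hm (hF j)
      (fun i => by simp only [proj_apply, Pi.sub_apply, Pi.add_apply]; linarith [hr (sel j i)]),
      ← hq]
    apply ENNReal.ofReal_le_ofReal
    have h3 : ∀ i, proj j (c + r) i - proj j (c - r) i = 2 * r (sel j i) := fun i => by
      simp only [proj_apply, Pi.sub_apply, Pi.add_apply]; ring
    simp_rw [h3]
    have hp : 0 < (ε ^ α) ^ (q : ℝ)⁻¹ := by positivity
    have ha : 0 ≤ avg (box (proj j (c - r)) (proj j (c + r))) (F j) := by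
      unfold avg
      positivity
    refine mul_le_mul_of_nonneg_left ?_
      (Real.rpow_nonneg (Finset.prod_nonneg fun h _ => by linarith [hr (sel j h)]) _)
    rw [le_inv_mul_iff₀ hp]
    refine le_trans ?_ (hM j)
    rw [two_zpow_eq hm, ← hq]
    refine mul_le_mul_of_nonneg_right ?_ ha
    exact Real.rpow_le_rpow (by positivity) (Real.rpow_le_rpow hε.le (hεe j) hα) (by positivity)
  have hM0 : ∀ j, 0 ≤ M j := fun j => le_trans (mul_nonneg (by
    have := hε.trans_le (hεe j); positivity) (by unfold avg; positivity)) (hM j)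
  have h2r : ∀ κ, 0 ≤ 2 * r κ := fun κ => by linarith [hr κ]
  refine (Finset.prod_le_prod' fun j _ => h2 j).trans ?_
  rw [← ENNReal.ofReal_prod_of_nonneg (fun j _ => mul_nonneg (Real.rpow_nonneg
    (Finset.prod_nonneg fun h _ => h2r _) _) (mul_nonneg (by positivity) (hM0 j)))]
  apply le_of_eq
  congr 1
  rw [Finset.prod_mul_distrib, Finset.prod_mul_distrib, ← mul_assoc]
  congr 2
  · rw [Real.finsetProd_rpow _ _ (fun j _ => Finset.prod_nonneg fun h _ => h2r _),
      prod_corner_sel (fun κ => 2 * r κ), ← hq,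
      Real.pow_rpow_inv_natCast (Finset.prod_nonneg fun κ _ => h2r κ) (by positivity)]
  · rw [Finset.prod_const, inv_pow, ← Real.rpow_mul hε.le, ← Real.rpow_natCast,
      ← Real.rpow_mul hε.le, Real.rpow_neg hε.le]
    congr 2
    have : (Finset.univ : Finset (Corner m)).card = 2 * q := by
      rw [hq, Finset.card_univ, Fintype.card_fun, Fintype.card_fin, Fintype.card_fin, ← pow_succ',
        Nat.sub_add_cancel hm]
    rw [this]
    push_cast
    field_simp

theorem dC_eq_pi {m : ℕ} (Q : ℤ × (Fin m → ℤ)) : dC Q =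
    Set.univ.pi fun i => Set.Ico ((2 : ℝ) ^ Q.1 * Q.2 i) ((2 : ℝ) ^ Q.1 * (Q.2 i + 1)) := by
  ext x
  simp [dC]

theorem dC_measurableSet {m : ℕ} (Q : ℤ × (Fin m → ℤ)) : MeasurableSet (dC Q) := by
  rw [dC_eq_pi]
  exact MeasurableSet.univ_pi fun i => measurableSet_Ico

theorem volume_dC {m : ℕ} (Q : ℤ × (Fin m → ℤ)) :
    volume (dC Q) = ENNReal.ofReal (((2 : ℝ) ^ Q.1) ^ m) := by
  rw [dC_eq_pi, volume_pi_pi, ENNReal.ofReal_pow (by positivity)]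
  simp_rw [Real.volume_Ico, mul_add, add_sub_cancel_left]
  simp

theorem dC_diff_le {m : ℕ} {Δ : ℝ} {J : Matrix (Idx m) (Fin m) ℝ} (hJ : Reg Δ J)
    {Q : ℤ × (Fin m → ℤ)} {p : Fin m → ℝ} (hp : p ∈ dC Q) (κ : Idx m) :
    |(J *ᵥ p) κ - (J *ᵥ fun i => (2 : ℝ) ^ Q.1 * Q.2 i) κ| ≤ m * Δ * (2 : ℝ) ^ Q.1 := by
  rw [← Pi.sub_apply, ← Matrix.mulVec_sub, Matrix.mulVec, dotProduct]
  refine (Finset.abs_sum_le_sum_abs _ _).trans ?_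
  calc ∑ k, |J κ k * (p - fun i => (2 : ℝ) ^ Q.1 * Q.2 i) k|
      ≤ ∑ _k : Fin m, Δ * (2 : ℝ) ^ Q.1 := by
        refine Finset.sum_le_sum fun k _ => ?_
        rw [abs_mul]
        refine mul_le_mul (hJ.row_le κ k) ?_ (abs_nonneg _) ((abs_nonneg _).trans (hJ.row_le κ k))
        have := hp k
        rw [Pi.sub_apply, abs_of_nonneg (by linarith)]
        linarith
    _ = m * Δ * (2 : ℝ) ^ Q.1 := by simp; ring

/-- The hypotheses of the induction. The positions in `L` are already symmetric. -/
structure Adm {m : ℕ} (Δ α : ℝ) (L : Finset (Fin m)) (J : Matrix (Idx m) (Fin m) ℝ)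
    (T : Set (ℤ × (Fin m → ℤ))) (Qt : ℤ × (Fin m → ℤ)) (d : Fin m → ℝ)
    (F : Corner m → (Fin m → ℝ) → ℝ) (M : Corner m → ℝ) : Prop where
  reg : Reg Δ J
  sym : SymRows L J
  tree : ConvexTree T Qt
  dpos : ∀ h, 0 < d h
  dle : ∀ h ∈ L, ∀ i ∉ L, d h ≤ d i
  deq : ∀ i ∉ L, ∀ i' ∉ L, d i = d i'
  cont : ∀ j, Continuous (F j)
  supp : ∀ j, HasCompactSupport (F j)
  symF : ∀ j, ∀ i ∈ L, ∀ e, F (Function.update j i e) = F j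
  nonneg : ∀ j, 0 ≤ M j
  bound : ∀ j, ∀ Q ∈ T, ∀ a b, (∀ i, a i < b i) → (Amat J j).mulVec '' dC Q ⊆ box a b →
    (ecc a b ^ α) ^ ((2 : ℝ) ^ ((1 : ℤ) - (m : ℤ))) * avg (box a b) (F j) ≤ M j

/-- The cost of the anisotropy of the Gaussians. -/
def cost {m : ℕ} (α : ℝ) (d : Fin m → ℝ) : ℝ :=
  ∏ h, max (d h ^ (2 * α)) (d h ^ (-2 : ℝ))

theorem max_one_rpow_div_le {α d : ℝ} (hd : 0 < d) :
    max 1 d * max 1 d ^ (2 * α) / d ≤ max (d ^ (2 * α)) (d ^ (-2 : ℝ)) := by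
  rcases le_total 1 d with h | h
  · rw [max_eq_right h, mul_div_assoc, mul_div_cancel₀ _ hd.ne']
    exact le_max_left _ _
  · rw [max_eq_left h, Real.one_rpow, mul_one, one_div, ← Real.rpow_neg_one]
    exact (Real.rpow_le_rpow_of_exponent_ge hd h (by norm_num)).trans (le_max_right _ _)

theorem summable_pow_mul_exp_neg_sq {c : ℝ} (hc : 0 < c) (m : ℕ) :
    Summable fun n : ℕ => Real.exp (-c * (n : ℝ) ^ 2) * (4 * ((n : ℝ) + 1)) ^ m *
      (2 * ((n : ℝ) + 1)) ^ 2 := by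
  have h1 := ((summable_nat_add_iff 1).2
    (Real.summable_pow_mul_exp_neg_nat_mul (m + 2) hc)).mul_left (4 ^ m * 4 * Real.exp c)
  refine Summable.of_nonneg_of_le (fun n => by positivity) (fun n => ?_) h1
  push_cast
  have h2 : Real.exp (-c * (n : ℝ) ^ 2) ≤ Real.exp c * Real.exp (-c * (n + 1)) := by
    rw [← Real.exp_add]
    apply Real.exp_le_exp.2
    have : (n : ℝ) ≤ (n : ℝ) ^ 2 := by exact_mod_cast Nat.le_self_pow two_ne_zero n
    nlinarith
  calc _ ≤ (Real.exp c * Real.exp (-c * (n + 1))) * (4 * ((n : ℝ) + 1)) ^ m *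
      (2 * ((n : ℝ) + 1)) ^ 2 := by gcongr
    _ = _ := by rw [mul_pow, mul_pow, pow_add]; ring

theorem gaussMass_measurable {m : ℕ} (J : Matrix (Idx m) (Fin m) ℝ) (s : Fin m → ℝ) :
    Measurable (gaussMass J s) := by
  unfold gaussMass
  refine Measurable.lintegral_prod_right' (f := fun z : (Idx m → ℝ) × (Fin m → ℝ) =>
    ∏ κ, ENNReal.ofReal (hk 0 (s (base κ)) (z.1 κ - (J *ᵥ z.2) κ))) ?_
  refine Finset.measurable_prod _ fun κ _ => ENNReal.measurable_ofReal.comp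
    ((hk_continuous 0 _).comp ?_).measurable
  fun_prop

theorem Adm.offMax {m : ℕ} {Δ α : ℝ} {L : Finset (Fin m)} {J : Matrix (Idx m) (Fin m) ℝ}
    {T : Set (ℤ × (Fin m → ℤ))} {Qt : ℤ × (Fin m → ℤ)} {d : Fin m → ℝ}
    {F : Corner m → (Fin m → ℝ) → ℝ} {M : Corner m → ℝ} (H : Adm Δ α L J T Qt d F M)
    (h : Fin m) (hh : h ∉ L) (k : Fin m) : d k ≤ d h := by
  by_cases hk : k ∈ L
  · exact H.dle k hk h hh
  · exact (H.deq k hk h hh).le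

/-- The single-scale estimate: a cube of the tree controls the form localized to it. -/
theorem size_bound (m : ℕ) (hm : 0 < m) (Δ α : ℝ) (hΔ : 1 ≤ Δ) (hα : 0 ≤ α) (hα1 : α ≤ 1) :
    ∃ C : ℝ, 0 < C ∧ ∀ L J T Qt d F M, Adm (m := m) Δ α L J T Qt d F M →
      ∀ Q ∈ T, ∀ t : ℝ, (2 : ℝ) ^ Q.1 / 4 ≤ t → t ≤ (2 : ℝ) ^ Q.1 → ∀ j₀ : Corner m,
        ∫⁻ x : Idx m → ℝ, ((Amat J j₀).mulVec '' dC Q).indicator 1 (proj j₀ x) *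
          (∏ j, ‖F j (proj j x)‖ₑ) * gaussMass J (fun h => t * d h) x ≤
        ENNReal.ofReal (C * cost α d * ∏ j, M j) * volume (dC Q) := by
  obtain ⟨C, c, hC, hc, hG⟩ := gaussMass_le m Δ hΔ
  have hmR : (1 : ℝ) ≤ m := by exact_mod_cast hm
  set S := ∑' n : ℕ, Real.exp (-c * (n : ℝ) ^ 2) * (4 * ((n : ℝ) + 1)) ^ m *
      (2 * ((n : ℝ) + 1)) ^ 2 with hS
  have hSs := summable_pow_mul_exp_neg_sq hc m
  have hSpos : 0 < S := hSs.tsum_pos (fun n => by positivity) 0 (by positivity)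
  refine ⟨C * (2 * (m * Δ)) ^ m * (4 * (m * Δ)) ^ m * S, by positivity, ?_⟩
  intro L J T Qt d F M H Q hQ t ht1 ht2 j₀
  set ℓ : ℝ := (2 : ℝ) ^ Q.1 with hℓ
  have hℓ0 : 0 < ℓ := by positivity
  have ht0 : 0 < t := by linarith
  set ρ : ℝ := m * Δ * ℓ with hρ
  have hρ0 : 0 < ρ := by positivity
  have hℓρ : ℓ ≤ ρ := by
    rw [hρ]
    exact le_mul_of_one_le_left hℓ0.le (by nlinarith)
  have hρt : ρ / t ≤ 4 * (m * Δ) := by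
    rw [div_le_iff₀ ht0, hρ]
    have : 0 ≤ m * Δ := by positivity
    nlinarith
  set P : ℝ := ∏ h, max 1 (d h) with hP
  have hPs : ∀ s : Finset (Fin m), 1 ≤ ∏ h ∈ s, max 1 (d h) := fun s =>
    Finset.prod_const_one.symm.le.trans
      (Finset.prod_le_prod (fun _ _ => zero_le_one) fun k _ => le_max_left _ _)
  have hP0 : 1 ≤ P := hPs Finset.univ
  have hP1 : ∀ h, max 1 (d h) ≤ P := fun h => by
    rw [hP, ← Finset.mul_prod_erase _ _ (Finset.mem_univ h)]
    exact le_mul_of_one_le_right (zero_le_one.trans (le_max_left _ _)) (hPs _)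
  set q0 : Fin m → ℝ := fun i => ℓ * Q.2 i with hq0
  set r : ℕ → Idx m → ℝ := fun n κ => if sel j₀ (base κ) = κ then ρ
    else 2 * ρ * (n + 1) * max 1 (d (base κ)) with hr
  have hr1 : ∀ n κ, ρ ≤ r n κ := by
    intro n κ
    simp only [hr]
    split_ifs
    · exact le_rfl
    · have h1 : (1 : ℝ) ≤ 2 * (n + 1) := by
        have : (0 : ℝ) ≤ n := n.cast_nonneg
        linarith
      have h2 : (1 : ℝ) ≤ max 1 (d (base κ)) := le_max_left _ _
      nlinarith [mul_le_mul h1 h2 zero_le_one (by positivity)]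
  have hr2 : ∀ n κ, r n κ ≤ 2 * ρ * (n + 1) * P := by
    intro n κ
    simp only [hr]
    split_ifs
    · have h1 : (1 : ℝ) ≤ 2 * (n + 1) := by
        have : (0 : ℝ) ≤ n := n.cast_nonneg
        linarith
      nlinarith [mul_le_mul h1 hP0 zero_le_one (by positivity)]
    · exact mul_le_mul_of_nonneg_left (hP1 _) (by positivity)
  have hselopp : ∀ h, ¬ sel j₀ (base (sel (opp j₀) h)) = sel (opp j₀) h := fun h => by
    rcases sel_eq_or j₀ h with h' | h' <;> simp [h']
  have hrsel : ∀ n h, r n (sel j₀ h) = ρ := fun n h => by simp [hr]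
  have hropp : ∀ n h, r n (sel (opp j₀) h) = 2 * ρ * (n + 1) * max 1 (d h) := fun n h => by
    simp only [hr]
    rw [if_neg (hselopp h), base_sel]
  set ε : ℕ → ℝ := fun n => (2 * ((n : ℝ) + 1) * P)⁻¹ with hε
  have hε0 : ∀ n, 0 < ε n := fun n => by simp only [hε]; positivity
  have hbox : ∀ n : ℕ, ∫⁻ x in Set.univ.pi fun κ => Set.Icc ((J *ᵥ q0) κ - r n κ)
      ((J *ᵥ q0) κ + r n κ), ∏ j, ‖F j (proj j x)‖ₑ ≤
      ENNReal.ofReal ((∏ κ, 2 * r n κ) * ε n ^ (-(2 * α)) * ∏ j, M j) := by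
    intro n
    have : Nonempty (Fin m) := ⟨⟨0, hm⟩⟩
    have hdiff : ∀ j i, proj j (J *ᵥ q0 + r n) i - proj j (J *ᵥ q0 - r n) i =
        2 * r n (sel j i) := fun j i => by
      simp only [proj_apply, Pi.sub_apply, Pi.add_apply]; ring
    refine box_bound hm hα H.cont (fun κ => hρ0.trans_le (hr1 n κ)) (hε0 n) ?_ ?_
    · intro j
      rw [ecc]
      simp_rw [hdiff]
      have hinf : 2 * ρ ≤ ⨅ i, 2 * r n (sel j i) := le_ciInf fun i => by linarith [hr1 n (sel j i)]
      have hsup : ⨆ i, 2 * r n (sel j i) ≤ 2 * (2 * ρ * (n + 1) * P) :=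
        ciSup_le fun i => by linarith [hr2 n (sel j i)]
      have hsup0 : 0 < ⨆ i, 2 * r n (sel j i) :=
        lt_of_lt_of_le (by linarith [hr1 n (sel j ⟨0, hm⟩)])
          (le_ciSup (f := fun i => 2 * r n (sel j i)) (Set.finite_range _).bddAbove ⟨0, hm⟩)
      rw [le_div_iff₀ hsup0]
      calc ε n * ⨆ i, 2 * r n (sel j i) ≤ ε n * (2 * (2 * ρ * (n + 1) * P)) := by
            have := (hε0 n).le
            gcongr
        _ = 2 * ρ := by simp only [hε]; field_simp
        _ ≤ _ := hinf
    · intro j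
      refine H.bound j Q hQ _ _ (fun i => by linarith [hdiff j i, hr1 n (sel j i)]) ?_
      rintro _ ⟨p, hp, rfl⟩ i
      have h1 := abs_le.1 (dC_diff_le H.reg hp (sel j i))
      have h2 := hr1 n (sel j i)
      simp only [proj_apply, Pi.sub_apply, Pi.add_apply, ← mulVec_sel]
      constructor <;> linarith [h1.1, h1.2]
  have hpt : ∀ x : Idx m → ℝ, ((Amat J j₀).mulVec '' dC Q).indicator 1 (proj j₀ x) *
      (∏ j, ‖F j (proj j x)‖ₑ) * gaussMass J (fun h => t * d h) x ≤
      ∑' n : ℕ, ENNReal.ofReal (C * (∏ k, (t * d k)⁻¹) * Real.exp (-c * (n : ℝ) ^ 2)) *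
        (Set.univ.pi fun κ => Set.Icc ((J *ᵥ q0) κ - r n κ)
          ((J *ᵥ q0) κ + r n κ)).indicator (fun x => ∏ j, ‖F j (proj j x)‖ₑ) x := by
    intro x
    by_cases hx : proj j₀ x ∈ (Amat J j₀).mulVec '' dC Q
    swap
    · rw [Set.indicator_of_notMem hx]
      simp
    rw [Set.indicator_of_mem hx, Pi.one_apply, one_mul]
    obtain ⟨p, hp, hpx⟩ := hx
    set w : Fin m → ℝ := fun h => proj (opp j₀) x h - (Nm J j₀ *ᵥ proj j₀ x) h with hw
    have hNp : ∀ h, (Nm J j₀ *ᵥ proj j₀ x) h = (J *ᵥ p) (sel (opp j₀) h) := fun h => by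
      rw [mulVec_sel, Nm, ← hpx, Matrix.mulVec_mulVec, Matrix.mul_assoc,
        Matrix.nonsing_inv_mul _ (H.reg.isUnit j₀), Matrix.mul_one]
    obtain ⟨h0, -, hh0⟩ := Finset.exists_max_image Finset.univ (fun h => |w h / (t * d h)|)
      ⟨⟨0, hm⟩, Finset.mem_univ _⟩
    set n := ⌊|w h0 / (t * d h0)|⌋₊ with hn
    have hn1 : (n : ℝ) ≤ |w h0 / (t * d h0)| := Nat.floor_le (abs_nonneg _)
    have hwle : ∀ h, |w h| ≤ (n + 1) * (t * d h) := fun h => by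
      have h1 := (hh0 h (Finset.mem_univ h)).trans (Nat.lt_floor_add_one _).le
      have h2 : 0 < t * d h := mul_pos ht0 (H.dpos h)
      rwa [abs_div, abs_of_pos h2, div_le_iff₀ h2] at h1
    have hmem : x ∈ Set.univ.pi fun κ => Set.Icc ((J *ᵥ q0) κ - r n κ) ((J *ᵥ q0) κ + r n κ) := by
      intro κ _
      suffices h : |x κ - (J *ᵥ q0) κ| ≤ r n κ by
        rw [abs_le] at h
        constructor <;> linarith [h.1, h.2]
      obtain ⟨a, rfl⟩ := (selEquiv j₀).surjective κ
      have h1 : ∀ κ, |(J *ᵥ p) κ - (J *ᵥ q0) κ| ≤ ρ := fun κ => dC_diff_le H.reg hp κ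
      rcases a with h | h
      · change |x (sel j₀ h) - (J *ᵥ q0) (sel j₀ h)| ≤ r n (sel j₀ h)
        have h2 : x (sel j₀ h) = (J *ᵥ p) (sel j₀ h) := by
          rw [mulVec_sel, hpx, proj_apply]
        rw [h2, hrsel]
        exact h1 _
      · change |x (sel (opp j₀) h) - (J *ᵥ q0) (sel (opp j₀) h)| ≤ r n (sel (opp j₀) h)
        rw [hropp]
        have h2 : x (sel (opp j₀) h) - (J *ᵥ q0) (sel (opp j₀) h) =
            w h + ((J *ᵥ p) (sel (opp j₀) h) - (J *ᵥ q0) (sel (opp j₀) h)) := by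
          simp only [hw, hNp, proj_apply]
          ring
        rw [h2]
        refine (abs_add_le _ _).trans ((add_le_add (hwle h) (h1 _)).trans ?_)
        have h3 : t * d h ≤ ρ * max 1 (d h) :=
          mul_le_mul (ht2.trans hℓρ) (le_max_right _ _) (H.dpos h).le hρ0.le
        have h4 : (0 : ℝ) ≤ n := n.cast_nonneg
        have h5 : (1 : ℝ) ≤ (n + 1) * max 1 (d h) :=
          one_le_mul_of_one_le_of_one_le (by linarith) (le_max_left _ _)
        nlinarith [mul_le_mul_of_nonneg_left h3 (by linarith : (0 : ℝ) ≤ n + 1),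
          mul_le_mul_of_nonneg_left h5 hρ0.le]
    refine le_trans ?_ (ENNReal.le_tsum n)
    rw [Set.indicator_of_mem hmem, mul_comm]
    gcongr
    refine (hG J L (fun h => t * d h) H.reg H.sym (fun h => mul_pos ht0 (H.dpos h))
      (fun h hh k => mul_le_mul_of_nonneg_left (H.offMax h hh k) ht0.le) x j₀ h0).trans ?_
    apply ENNReal.ofReal_le_ofReal
    have h1 : 0 ≤ C * ∏ k, (t * d k)⁻¹ := mul_nonneg hC.le
      (Finset.prod_nonneg fun k _ => inv_nonneg.2 (mul_pos ht0 (H.dpos k)).le)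
    refine mul_le_mul_of_nonneg_left (Real.exp_le_exp.2 ?_) h1
    have h2 : (n : ℝ) ^ 2 ≤ (w h0 / (t * d h0)) ^ 2 := by
      rw [← sq_abs (w h0 / (t * d h0))]
      gcongr
    have h3 : c * (n : ℝ) ^ 2 ≤ c * (w h0 / (t * d h0)) ^ 2 := by gcongr
    linarith
  have hms : ∀ n : ℕ, MeasurableSet (Set.univ.pi fun κ => Set.Icc ((J *ᵥ q0) κ - r n κ)
      ((J *ᵥ q0) κ + r n κ)) := fun n => MeasurableSet.univ_pi fun κ => measurableSet_Icc
  have hFm : Measurable fun x : Idx m → ℝ => ∏ j, ‖F j (proj j x)‖ₑ :=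
    Finset.measurable_prod _ fun j _ => ((H.cont j).measurable.comp (proj_measurable j)).enorm
  have hM0 : 0 ≤ ∏ j, M j := Finset.prod_nonneg fun j _ => H.nonneg j
  have hcost : 0 ≤ cost α d := Finset.prod_nonneg fun h _ =>
    (Real.rpow_nonneg (H.dpos h).le _).trans (le_max_left _ _)
  set K : ℝ := C * (2 * (m * Δ)) ^ m * (4 * (m * Δ)) ^ m * cost α d * (∏ j, M j) * ℓ ^ m with hK
  have hterm : ∀ n : ℕ, C * (∏ k, (t * d k)⁻¹) * Real.exp (-c * (n : ℝ) ^ 2) *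
      ((∏ κ, 2 * r n κ) * ε n ^ (-(2 * α)) * ∏ j, M j) ≤
      K * (Real.exp (-c * (n : ℝ) ^ 2) * (4 * ((n : ℝ) + 1)) ^ m *
      (2 * ((n : ℝ) + 1)) ^ 2) := by
    intro n
    have e1 : ∏ κ, 2 * r n κ = (2 * ρ) ^ m * ((4 * ((n : ℝ) + 1)) ^ m * ρ ^ m * P) := by
      rw [prod_sel j₀]
      simp_rw [hrsel, hropp]
      rw [Finset.prod_const, Finset.card_univ, Fintype.card_fin, hP]
      congr 1
      have h1 : ∀ h, 2 * (2 * ρ * ((n : ℝ) + 1) * max 1 (d h)) =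
          (4 * ((n : ℝ) + 1) * ρ) * max 1 (d h) := fun h => by ring
      simp_rw [h1]
      rw [Finset.prod_mul_distrib, Finset.prod_const, Finset.card_univ, Fintype.card_fin, mul_pow]
    have e2 : ε n ^ (-(2 * α)) ≤ (2 * ((n : ℝ) + 1)) ^ 2 * P ^ (2 * α) := by
      simp only [hε]
      rw [Real.inv_rpow (by positivity), ← Real.rpow_neg (by positivity), neg_neg,
        Real.mul_rpow (by positivity) (by positivity)]
      gcongr
      rw [← Real.rpow_natCast]
      have : (0 : ℝ) ≤ n := n.cast_nonneg
      exact Real.rpow_le_rpow_of_exponent_le (by linarith) (by push_cast; linarith)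
    have e3 : P * P ^ (2 * α) * ∏ k, (d k)⁻¹ ≤ cost α d := by
      rw [hP, ← Real.finsetProd_rpow _ _ (fun k _ => zero_le_one.trans (le_max_left _ _)),
        ← Finset.prod_mul_distrib, ← Finset.prod_mul_distrib]
      refine Finset.prod_le_prod (fun k _ => ?_) fun k _ => ?_
      · have := H.dpos k
        positivity
      · rw [← div_eq_mul_inv]
        exact max_one_rpow_div_le (H.dpos k)
    have e4 : ∏ k, (t * d k)⁻¹ = (t⁻¹) ^ m * ∏ k, (d k)⁻¹ := by
      simp_rw [mul_inv]
      rw [Finset.prod_mul_distrib]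
      simp
    have e5 : (ρ * t⁻¹) ^ m ≤ (4 * (m * Δ)) ^ m := by
      rw [← div_eq_mul_inv]
      gcongr
    have hd0 : 0 ≤ ∏ k, (d k)⁻¹ := Finset.prod_nonneg fun k _ => inv_nonneg.2 (H.dpos k).le
    have hP' : 0 < P := by linarith
    calc C * (∏ k, (t * d k)⁻¹) * Real.exp (-c * (n : ℝ) ^ 2) *
          ((∏ κ, 2 * r n κ) * ε n ^ (-(2 * α)) * ∏ j, M j)
        ≤ C * (∏ k, (t * d k)⁻¹) * Real.exp (-c * (n : ℝ) ^ 2) *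
          ((∏ κ, 2 * r n κ) * ((2 * ((n : ℝ) + 1)) ^ 2 * P ^ (2 * α)) * ∏ j, M j) := by
          rw [e1, e4]
          gcongr
      _ = C * (2 * ρ) ^ m * (ρ * t⁻¹) ^ m * (P * P ^ (2 * α) * ∏ k, (d k)⁻¹) * (∏ j, M j) *
          (Real.exp (-c * (n : ℝ) ^ 2) * (4 * ((n : ℝ) + 1)) ^ m * (2 * ((n : ℝ) + 1)) ^ 2) := by
          rw [e1, e4, mul_pow ρ]
          ring
      _ ≤ C * (2 * ρ) ^ m * (4 * (m * Δ)) ^ m * cost α d * (∏ j, M j) *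
          (Real.exp (-c * (n : ℝ) ^ 2) * (4 * ((n : ℝ) + 1)) ^ m * (2 * ((n : ℝ) + 1)) ^ 2) := by
          gcongr
      _ = _ := by
          rw [hK, hρ]
          ring
  calc ∫⁻ x : Idx m → ℝ, ((Amat J j₀).mulVec '' dC Q).indicator 1 (proj j₀ x) *
          (∏ j, ‖F j (proj j x)‖ₑ) * gaussMass J (fun h => t * d h) x
      ≤ ∫⁻ x : Idx m → ℝ, ∑' n : ℕ, ENNReal.ofReal (C * (∏ k, (t * d k)⁻¹) *
          Real.exp (-c * (n : ℝ) ^ 2)) *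
        (Set.univ.pi fun κ => Set.Icc ((J *ᵥ q0) κ - r n κ)
          ((J *ᵥ q0) κ + r n κ)).indicator (fun x => ∏ j, ‖F j (proj j x)‖ₑ) x :=
        lintegral_mono hpt
    _ = ∑' n : ℕ, ENNReal.ofReal (C * (∏ k, (t * d k)⁻¹) * Real.exp (-c * (n : ℝ) ^ 2)) *
        ∫⁻ x in Set.univ.pi fun κ => Set.Icc ((J *ᵥ q0) κ - r n κ)
          ((J *ᵥ q0) κ + r n κ), ∏ j, ‖F j (proj j x)‖ₑ := by
        rw [lintegral_tsum fun n => ((hFm.indicator (hms n)).const_mul _).aemeasurable]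
        refine tsum_congr fun n => ?_
        rw [lintegral_const_mul _ (hFm.indicator (hms n)), lintegral_indicator (hms n)]
    _ ≤ ∑' n : ℕ, ENNReal.ofReal (K * (Real.exp (-c * (n : ℝ) ^ 2) * (4 * ((n : ℝ) + 1)) ^ m *
      (2 * ((n : ℝ) + 1)) ^ 2)) := by
        refine ENNReal.tsum_le_tsum fun n => (mul_le_mul_right (hbox n) _).trans ?_
        rw [← ENNReal.ofReal_mul (mul_nonneg (mul_nonneg hC.le (Finset.prod_nonneg fun k _ =>
          inv_nonneg.2 (mul_pos ht0 (H.dpos k)).le)) (Real.exp_pos _).le)]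
        exact ENNReal.ofReal_le_ofReal (hterm n)
    _ = ENNReal.ofReal (K * S) := by
        have hK0 : 0 ≤ K := by positivity
        rw [← ENNReal.ofReal_tsum_of_nonneg (fun n => by positivity) (hSs.mul_left K),
          tsum_mul_left]
    _ = _ := by
        rw [volume_dC, ← ENNReal.ofReal_mul (by positivity)]
        congr 1
        rw [hK]
        ring

theorem hk_le_hk_zero (r : ℕ) : ∃ C : ℝ, 0 < C ∧ ∀ s : ℝ, 0 < s → ∀ x,
    |hk r s x| ≤ C * hk 0 (Real.sqrt 2 * s) x := by
  obtain ⟨C, hC, h⟩ := hk_bound r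
  refine ⟨C * Real.sqrt 2, by positivity, fun s hs x => (h s hs x).trans (le_of_eq ?_)⟩
  have h1 : -Real.pi * (x / (Real.sqrt 2 * s)) ^ 2 = -(Real.pi / 2) * (x / s) ^ 2 := by
    rw [div_pow, div_pow, mul_pow, Real.sq_sqrt (by norm_num)]
    field_simp
  rw [hk_zero, h1]
  field_simp

theorem gaussMass_finite {m : ℕ} {Δ : ℝ} {J : Matrix (Idx m) (Fin m) ℝ} (hJ : Reg Δ J)
    {s : Fin m → ℝ} (hs : ∀ h, 0 < s h) : ∃ C : ℝ, ∀ x, gaussMass J s x ≤ ENNReal.ofReal C := by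
  refine ⟨|(Amat J 0).det|⁻¹ * ∏ h, (s h)⁻¹, fun x => ?_⟩
  rw [gaussMass_eq hJ s x 0, ENNReal.ofReal_mul (by positivity)]
  gcongr
  have h1 : ∀ (h : Fin m) (z : ℝ), ENNReal.ofReal (hk 0 (s h) z) ≤ ENNReal.ofReal (s h)⁻¹ := by
    intro h z
    apply ENNReal.ofReal_le_ofReal
    rw [hk_zero]
    have := hs h
    refine mul_le_of_le_one_right (by positivity) (Real.exp_le_one_iff.2 ?_)
    nlinarith [Real.pi_pos, sq_nonneg (z / s h)]
  have h2 : ∀ h : Fin m, ∫⁻ y, ENNReal.ofReal (hk 0 (s h) y) = 1 := by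
    intro h
    rw [← ofReal_integral_eq_lintegral_ofReal (hk_integrable 0 (hs h))
      (Filter.Eventually.of_forall fun x => hk_zero_nonneg (hs h) x)]
    simp_rw [hk_zero]
    rw [integral_const_mul, Measure.integral_comp_div (fun x => Real.exp (-Real.pi * x ^ 2)),
      integral_gaussian, smul_eq_mul, abs_of_pos (hs h), inv_mul_cancel_left₀ (hs h).ne',
      div_self Real.pi_ne_zero, Real.sqrt_one, ENNReal.ofReal_one]
  calc _ ≤ ∫⁻ u : Fin m → ℝ, (∏ h, ENNReal.ofReal (hk 0 (s h) (u h))) *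
        ∏ h, ENNReal.ofReal (s h)⁻¹ := by
        refine lintegral_mono fun u => ?_
        rw [← Finset.prod_mul_distrib]
        exact Finset.prod_le_prod' fun h _ => mul_le_mul_right (h1 h _) _
    _ = ENNReal.ofReal (∏ h, (s h)⁻¹) := by
        rw [lintegral_mul_const' _ _ (ENNReal.prod_ne_top fun h _ => ENNReal.ofReal_ne_top),
          volume_pi, lintegral_prod_pi (fun _ : Fin m => (volume : Measure ℝ))
          (fun h y => ENNReal.ofReal (hk 0 (s h) y))
          (fun h => ENNReal.measurable_ofReal.comp (hk_continuous 0 _).measurable)]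
        simp_rw [h2]
        rw [ENNReal.ofReal_prod_of_nonneg fun h _ => (inv_pos.2 (hs h)).le]
        simp

/-- The product of the functions `f_j` in the corner coordinates. -/
def pr {m : ℕ} (f : Corner m → (Fin m → ℝ) → ℝ) (x : Idx m → ℝ) : ℝ := ∏ j, f j (proj j x)

/-- The tensor product of the one-dimensional kernels `hk`. -/
def tker {m : ℕ} (β : Idx m → ℕ) (s : Fin m → ℝ) (x : Idx m → ℝ) : ℝ :=
  ∏ κ, hk (β κ) (s (base κ)) (x κ)

/-- Superposition of the kernels `tker` along the range of `J`. -/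
def gker {m : ℕ} (J : Matrix (Idx m) (Fin m) ℝ) (β : Idx m → ℕ) (s : Fin m → ℝ)
    (x : Idx m → ℝ) : ℝ := ∫ p : Fin m → ℝ, tker β s (x - J *ᵥ p)

/-- The form with kernel `gker`. -/
def Frm {m : ℕ} (J : Matrix (Idx m) (Fin m) ℝ) (f : Corner m → (Fin m → ℝ) → ℝ)
    (β : Idx m → ℕ) (s : Fin m → ℝ) : ℝ := ∫ x, pr f x * gker J β s x

/-- Bounded measurable functions with bounded support. -/
structure Nice {m : ℕ} (f : Corner m → (Fin m → ℝ) → ℝ) : Prop where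
  meas : ∀ j, Measurable (f j)
  bdd : ∃ B : ℝ, ∀ j y, |f j y| ≤ B
  supp : ∃ R : ℝ, ∀ j y, f j y ≠ 0 → ∀ i, |y i| ≤ R

theorem exists_sel {m : ℕ} (κ : Idx m) : ∃ j : Corner m, sel j (base κ) = κ := by
  rcases κ with i | i
  · exact ⟨fun _ => 0, sel_zero rfl⟩
  · exact ⟨fun _ => 1, sel_one rfl⟩

theorem Nice.pr_measurable {m : ℕ} {f : Corner m → (Fin m → ℝ) → ℝ} (hf : Nice f) :
    Measurable (pr f) :=
  Finset.measurable_prod _ fun j _ => (hf.meas j).comp (proj_measurable j)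

theorem Nice.pr_bdd {m : ℕ} {f : Corner m → (Fin m → ℝ) → ℝ} (hf : Nice f) :
    ∃ B : ℝ, ∀ x, |pr f x| ≤ B := by
  obtain ⟨B, hB⟩ := hf.bdd
  refine ⟨∏ _j : Corner m, B, fun x => ?_⟩
  rw [pr, Finset.abs_prod]
  exact Finset.prod_le_prod (fun _ _ => abs_nonneg _) fun j _ => hB j _

theorem Nice.pr_supp {m : ℕ} {f : Corner m → (Fin m → ℝ) → ℝ} (hf : Nice f) :
    ∃ R : ℝ, ∀ x, pr f x ≠ 0 → ∀ κ, |x κ| ≤ R := by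
  obtain ⟨R, hR⟩ := hf.supp
  refine ⟨R, fun x hx κ => ?_⟩
  obtain ⟨j, hj⟩ := exists_sel κ
  have := hR j (proj j x) (Finset.prod_ne_zero_iff.1 hx j (Finset.mem_univ j)) (base κ)
  rwa [proj_apply, hj] at this

theorem Nice.pr_integrable {m : ℕ} {f : Corner m → (Fin m → ℝ) → ℝ} (hf : Nice f) :
    Integrable (pr f) := by
  obtain ⟨B, hB⟩ := hf.pr_bdd
  obtain ⟨R, hR⟩ := hf.pr_supp
  have hs : Function.support (pr f) ⊆ Set.Icc (fun _ : Idx m => -R) (fun _ => R) := by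
    intro x hx
    exact ⟨fun κ => (abs_le.1 (hR x hx κ)).1, fun κ => (abs_le.1 (hR x hx κ)).2⟩
  rw [← integrableOn_iff_integrable_of_support_subset hs]
  exact Measure.integrableOn_of_bounded (M := B) (isCompact_Icc.measure_lt_top).ne
    hf.pr_measurable.aestronglyMeasurable (Filter.Eventually.of_forall fun x => hB x)

theorem tker_continuous {m : ℕ} (β : Idx m → ℕ) (s : Fin m → ℝ) : Continuous (tker β s) :=
  continuous_finsetProd _ fun κ _ => (hk_continuous _ _).comp (continuous_apply κ)

theorem tker_zero_enorm {m : ℕ} {s : Fin m → ℝ} (hs : ∀ h, 0 < s h) (x : Idx m → ℝ) :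
    ‖tker 0 s x‖ₑ = ∏ κ, ENNReal.ofReal (hk 0 (s (base κ)) (x κ)) := by
  have h : tker 0 s x = ∏ κ, hk 0 (s (base κ)) (x κ) := rfl
  rw [h, ← ENNReal.ofReal_prod_of_nonneg fun κ _ => hk_zero_nonneg (hs _) _,
    Real.enorm_of_nonneg (Finset.prod_nonneg fun κ _ => hk_zero_nonneg (hs _) _)]

theorem tker_enorm_le {m : ℕ} (β : Idx m → ℕ) : ∃ C : ℝ, ∀ s : Fin m → ℝ, (∀ h, 0 < s h) →
    ∀ x, ‖tker β s x‖ₑ ≤ ENNReal.ofReal C *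
      ∏ κ, ENNReal.ofReal (hk 0 (Real.sqrt 2 * s (base κ)) (x κ)) := by
  choose C hC h using hk_le_hk_zero
  refine ⟨∏ κ, C (β κ), fun s hs x => ?_⟩
  have h2 : ∀ κ : Idx m, 0 < Real.sqrt 2 * s (base κ) := fun κ => mul_pos (by positivity) (hs _)
  rw [← ENNReal.ofReal_prod_of_nonneg fun κ _ => hk_zero_nonneg (h2 κ) _,
    ← ENNReal.ofReal_mul (Finset.prod_nonneg fun κ _ => (hC _).le), ← Finset.prod_mul_distrib,
    Real.enorm_eq_ofReal_abs, tker, Finset.abs_prod]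
  exact ENNReal.ofReal_le_ofReal
    (Finset.prod_le_prod (fun _ _ => abs_nonneg _) fun κ _ => h _ _ (hs _) _)

theorem lintegral_tker_finite {m : ℕ} {Δ : ℝ} {J : Matrix (Idx m) (Fin m) ℝ} (hJ : Reg Δ J)
    (β : Idx m → ℕ) {s : Fin m → ℝ} (hs : ∀ h, 0 < s h) :
    ∃ C : ℝ≥0, ∀ x, ∫⁻ p : Fin m → ℝ, ‖tker β s (x - J *ᵥ p)‖ₑ ≤ C := by
  obtain ⟨C, hC⟩ := tker_enorm_le β
  obtain ⟨C', hC'⟩ := gaussMass_finite hJ (s := fun h => Real.sqrt 2 * s h)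
    (fun h => mul_pos (by positivity) (hs h))
  refine ⟨(C.toNNReal) * C'.toNNReal, fun x => ?_⟩
  refine (lintegral_mono fun p => hC s hs _).trans ?_
  rw [lintegral_const_mul' _ _ ENNReal.ofReal_ne_top, ENNReal.coe_mul]
  exact mul_le_mul_right (hC' x) _

theorem tker_shift_measurable {m : ℕ} (J : Matrix (Idx m) (Fin m) ℝ) (β : Idx m → ℕ)
    (s : Fin m → ℝ) :
    Continuous fun z : (Idx m → ℝ) × (Fin m → ℝ) => tker β s (z.1 - J *ᵥ z.2) :=
  (tker_continuous β s).comp (by fun_prop)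

theorem Nice.integrable_prod {m : ℕ} {Δ : ℝ} {J : Matrix (Idx m) (Fin m) ℝ} (hJ : Reg Δ J)
    {f : Corner m → (Fin m → ℝ) → ℝ} (hf : Nice f) (β : Idx m → ℕ) {s : Fin m → ℝ}
    (hs : ∀ h, 0 < s h) : Integrable (fun z : (Idx m → ℝ) × (Fin m → ℝ) =>
      pr f z.1 * tker β s (z.1 - J *ᵥ z.2)) (volume.prod volume) := by
  have hm : Measurable (fun z : (Idx m → ℝ) × (Fin m → ℝ) =>
      pr f z.1 * tker β s (z.1 - J *ᵥ z.2)) :=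
    (hf.pr_measurable.comp measurable_fst).mul (tker_shift_measurable J β s).measurable
  refine ⟨hm.aestronglyMeasurable, ?_⟩
  obtain ⟨C, hC⟩ := lintegral_tker_finite hJ β hs
  rw [HasFiniteIntegral, lintegral_prod _ hm.enorm.aemeasurable]
  simp_rw [enorm_mul]
  calc ∫⁻ x, ∫⁻ p, ‖pr f x‖ₑ * ‖tker β s (x - J *ᵥ p)‖ₑ
      ≤ ∫⁻ x, ‖pr f x‖ₑ * C := by
        refine lintegral_mono fun x => ?_
        rw [lintegral_const_mul' _ _ enorm_ne_top]
        exact mul_le_mul_right (hC x) _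
    _ < ∞ := by
        rw [lintegral_mul_const' _ _ ENNReal.coe_ne_top]
        exact ENNReal.mul_lt_top hf.pr_integrable.2 ENNReal.coe_lt_top

theorem Frm_eq_integral_prod {m : ℕ} {Δ : ℝ} {J : Matrix (Idx m) (Fin m) ℝ} (hJ : Reg Δ J)
    {f : Corner m → (Fin m → ℝ) → ℝ} (hf : Nice f) (β : Idx m → ℕ) {s : Fin m → ℝ}
    (hs : ∀ h, 0 < s h) :
    Frm J f β s = ∫ p : Fin m → ℝ, ∫ x, pr f x * tker β s (x - J *ᵥ p) := by
  rw [← integral_integral_swap (hf.integrable_prod hJ β hs)]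
  simp_rw [integral_const_mul]
  rfl

theorem Nice.integrable_gker {m : ℕ} {Δ : ℝ} {J : Matrix (Idx m) (Fin m) ℝ} (hJ : Reg Δ J)
    {f : Corner m → (Fin m → ℝ) → ℝ} (hf : Nice f) (β : Idx m → ℕ) {s : Fin m → ℝ}
    (hs : ∀ h, 0 < s h) : Integrable fun x => pr f x * gker J β s x := by
  have := (hf.integrable_prod hJ β hs).integral_prod_left
  simp_rw [integral_const_mul] at this
  exact this

theorem gker_zero_enorm_le {m : ℕ} (J : Matrix (Idx m) (Fin m) ℝ) {s : Fin m → ℝ}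
    (hs : ∀ h, 0 < s h) (x : Idx m → ℝ) : ‖gker J 0 s x‖ₑ ≤ gaussMass J s x := by
  refine (enorm_integral_le_lintegral_enorm _).trans (le_of_eq ?_)
  exact lintegral_congr fun p => tker_zero_enorm hs _

theorem Frm_zero_enorm_le {m : ℕ} (J : Matrix (Idx m) (Fin m) ℝ) (f : Corner m → (Fin m → ℝ) → ℝ)
    {s : Fin m → ℝ} (hs : ∀ h, 0 < s h) :
    ‖Frm J f 0 s‖ₑ ≤ ∫⁻ x, ‖pr f x‖ₑ * gaussMass J s x := by
  refine (enorm_integral_le_lintegral_enorm _).trans (lintegral_mono fun x => ?_)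
  rw [enorm_mul]
  exact mul_le_mul_right (gker_zero_enorm_le J hs x) _

theorem Frm_zero_sub_enorm_le {m : ℕ} {Δ : ℝ} {J : Matrix (Idx m) (Fin m) ℝ} (hJ : Reg Δ J)
    {f f' : Corner m → (Fin m → ℝ) → ℝ} (hf : Nice f) (hf' : Nice f')
    {s : Fin m → ℝ} (hs : ∀ h, 0 < s h) :
    ‖Frm J f 0 s - Frm J f' 0 s‖ₑ ≤ ∫⁻ x, ‖pr f x - pr f' x‖ₑ * gaussMass J s x := by
  rw [Frm, Frm, ← integral_sub (hf.integrable_gker hJ 0 hs) (hf'.integrable_gker hJ 0 hs)]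
  refine (enorm_integral_le_lintegral_enorm _).trans (lintegral_mono fun x => ?_)
  rw [← sub_mul, enorm_mul]
  exact mul_le_mul_right (gker_zero_enorm_le J hs x) _

theorem dC_disjoint {m : ℕ} {k : ℤ} {n n' : Fin m → ℤ} {x : Fin m → ℝ} (h : x ∈ dC (k, n))
    (h' : x ∈ dC (k, n')) : n = n' := by
  have h2 : (0 : ℝ) < (2 : ℝ) ^ k := by positivity
  funext i
  have a := h i
  have b := h' i
  simp only at a b
  have c1 : (n i : ℝ) < n' i + 1 := lt_of_mul_lt_mul_left (a.1.trans_lt b.2) h2.le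
  have c2 : (n' i : ℝ) < n i + 1 := lt_of_mul_lt_mul_left (b.1.trans_lt a.2) h2.le
  have d1 : n i < n' i + 1 := by exact_mod_cast c1
  have d2 : n' i < n i + 1 := by exact_mod_cast c2
  omega

theorem exists_mem_dC {m : ℕ} (k : ℤ) (x : Fin m → ℝ) : ∃ n, x ∈ dC (k, n) := by
  have h2 : (0 : ℝ) < (2 : ℝ) ^ k := by positivity
  refine ⟨fun i => ⌊x i / (2 : ℝ) ^ k⌋, fun i => ⟨?_, ?_⟩⟩
  · have := Int.floor_le (x i / (2 : ℝ) ^ k)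
    rw [le_div_iff₀ h2] at this
    simpa [mul_comm] using this
  · have := Int.lt_floor_add_one (x i / (2 : ℝ) ^ k)
    rw [div_lt_iff₀ h2] at this
    simpa [mul_comm] using this

theorem dC_nonempty {m : ℕ} (Q : ℤ × (Fin m → ℤ)) : (dC Q).Nonempty :=
  ⟨fun i => (2 : ℝ) ^ Q.1 * Q.2 i, fun i => ⟨le_rfl, by
    have : (0 : ℝ) < (2 : ℝ) ^ Q.1 := by positivity
    nlinarith⟩⟩

theorem dC_subset_parent {m : ℕ} (k : ℤ) (n : Fin m → ℤ) :
    dC (k, n) ⊆ dC (k + 1, fun i => n i / 2) := by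
  intro x hx i
  have h2 : (0 : ℝ) < (2 : ℝ) ^ k := by positivity
  have a := hx i
  simp only at a ⊢
  rw [zpow_add₀ (by norm_num), zpow_one]
  have b1 : 2 * (n i / 2) ≤ n i := by omega
  have b2 : n i ≤ 2 * (n i / 2) + 1 := by omega
  have c1 : 2 * ((n i / 2 : ℤ) : ℝ) ≤ n i := by exact_mod_cast b1
  have c2 : (n i : ℝ) ≤ 2 * ((n i / 2 : ℤ) : ℝ) + 1 := by exact_mod_cast b2
  constructor <;> nlinarith

theorem exists_ancestor {m : ℕ} (k : ℤ) (n : Fin m → ℤ) (r : ℕ) :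
    ∃ n', dC (k, n) ⊆ dC (k + r, n') := by
  induction r with
  | zero => exact ⟨n, by simp⟩
  | succ r ih =>
    obtain ⟨n', h⟩ := ih
    refine ⟨fun i => n' i / 2, ?_⟩
    have h' := h.trans (dC_subset_parent _ _)
    rw [add_assoc] at h'
    exact_mod_cast h'

theorem dC_nested {m : ℕ} {k k' : ℤ} (hk : k ≤ k') {n n' : Fin m → ℤ} {x : Fin m → ℝ}
    (h : x ∈ dC (k, n)) (h' : x ∈ dC (k', n')) : dC (k, n) ⊆ dC (k', n') := by
  obtain ⟨r, rfl⟩ := Int.le.dest hk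
  obtain ⟨n'', hn⟩ := exists_ancestor k n r
  rwa [dC_disjoint h' (hn h)]

theorem ConvexTree.level_le {m : ℕ} (hm : 0 < m) {T : Set (ℤ × (Fin m → ℤ))}
    {Qt : ℤ × (Fin m → ℤ)} (hT : ConvexTree T Qt) {Q : ℤ × (Fin m → ℤ)} (hQ : Q ∈ T) :
    Q.1 ≤ Qt.1 := by
  have h := measure_mono (μ := volume) (hT.2.1 Q hQ)
  rw [volume_dC, volume_dC, ENNReal.ofReal_le_ofReal_iff (by positivity),
    pow_le_pow_iff_left₀ (by positivity) (by positivity) hm.ne'] at h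
  exact (zpow_le_zpow_iff_right₀ (by norm_num)).1 h

theorem ConvexTree.parent_mem {m : ℕ} {T : Set (ℤ × (Fin m → ℤ))}
    {Qt : ℤ × (Fin m → ℤ)} (hT : ConvexTree T Qt) {k : ℤ} {n : Fin m → ℤ} (hQ : (k, n) ∈ T)
    (hk : k < Qt.1) : (k + 1, fun i => n i / 2) ∈ T := by
  obtain ⟨x, hx⟩ := dC_nonempty (k, n)
  exact hT.2.2 _ hQ _ (dC_subset_parent k n)
    (dC_nested (by omega) (dC_subset_parent k n hx) (hT.2.1 _ hQ hx))

/-- The union of the dyadic cubes of side length `2^k` with index in `S`. -/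
def cubes {m : ℕ} (k : ℤ) (S : Set (Fin m → ℤ)) : Set (Fin m → ℝ) := ⋃ n : S, dC (k, n.1)

theorem cubes_measurableSet {m : ℕ} (k : ℤ) (S : Set (Fin m → ℤ)) :
    MeasurableSet (cubes k S) := MeasurableSet.iUnion fun _ => dC_measurableSet _

theorem volume_cubes {m : ℕ} (k : ℤ) (S : Set (Fin m → ℤ)) :
    volume (cubes k S) = ∑' n : S, volume (dC (k, n.1)) :=
  measure_iUnion (fun _ _ hn => Set.disjoint_left.2 fun _ hx hx' =>
    hn (Subtype.ext (dC_disjoint hx hx'))) fun _ => dC_measurableSet _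

theorem Tkset_eq_cubes {m : ℕ} (T : Set (ℤ × (Fin m → ℤ))) (k : ℤ) :
    Tkset T k = cubes k {n | (k, n) ∈ T} := by
  ext x
  simp only [Tkset, cubes, Set.mem_iUnion]
  constructor
  · rintro ⟨⟨k', n⟩, ⟨hQ, rfl⟩, hx⟩
    exact ⟨⟨n, hQ⟩, hx⟩
  · rintro ⟨⟨n, hn⟩, hx⟩
    exact ⟨(k, n), ⟨hn, rfl⟩, hx⟩

theorem Tkset_measurableSet {m : ℕ} (T : Set (ℤ × (Fin m → ℤ))) (k : ℤ) :
    MeasurableSet (Tkset T k) := Tkset_eq_cubes T k ▸ cubes_measurableSet _ _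

/-- The children at level `k` of cubes of the tree which do not belong to the tree. -/
def leaves {m : ℕ} (T : Set (ℤ × (Fin m → ℤ))) (k : ℤ) : Set (Fin m → ℤ) :=
  {n | (k, n) ∉ T ∧ (k + 1, fun i => n i / 2) ∈ T}

theorem Tkset_subset_succ {m : ℕ} {T : Set (ℤ × (Fin m → ℤ))} {Qt : ℤ × (Fin m → ℤ)}
    (hT : ConvexTree T Qt) {k : ℤ} (hk : k < Qt.1) : Tkset T k ⊆ Tkset T (k + 1) := by
  rw [Tkset_eq_cubes, Tkset_eq_cubes]
  rintro x hx
  obtain ⟨⟨n, hn⟩, hx⟩ := Set.mem_iUnion.1 hx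
  exact Set.mem_iUnion.2 ⟨⟨_, hT.parent_mem hn hk⟩, dC_subset_parent k n hx⟩

theorem Tkset_diff_subset {m : ℕ} (T : Set (ℤ × (Fin m → ℤ))) (k : ℤ) :
    Tkset T (k + 1) \ Tkset T k ⊆ cubes k (leaves T k) := by
  rw [Tkset_eq_cubes, Tkset_eq_cubes]
  rintro x ⟨hx, hx'⟩
  obtain ⟨⟨n, hn⟩, hx⟩ := Set.mem_iUnion.1 hx
  obtain ⟨n', hn'⟩ := exists_mem_dC k x
  refine Set.mem_iUnion.2 ⟨⟨n', fun h => hx' (Set.mem_iUnion.2 ⟨⟨n', h⟩, hn'⟩), ?_⟩, hn'⟩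
  rw [← dC_disjoint hx (dC_subset_parent k n' hn')]
  exact hn

theorem volume_leaves_add {m : ℕ} {T : Set (ℤ × (Fin m → ℤ))} {Qt : ℤ × (Fin m → ℤ)}
    (hT : ConvexTree T Qt) {k : ℤ} (hk : k < Qt.1) :
    volume (cubes k (leaves T k)) + volume (Tkset T k) ≤ volume (Tkset T (k + 1)) := by
  rw [← measure_union _ (Tkset_measurableSet T k)]
  · refine measure_mono (Set.union_subset ?_ (Tkset_subset_succ hT hk))
    rw [Tkset_eq_cubes]
    rintro x hx
    obtain ⟨⟨n, hn⟩, hx⟩ := Set.mem_iUnion.1 hx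
    exact Set.mem_iUnion.2 ⟨⟨_, hn.2⟩, dC_subset_parent k n hx⟩
  · rw [Tkset_eq_cubes]
    refine Set.disjoint_left.2 fun x hx hx' => ?_
    obtain ⟨⟨n, hn⟩, hx⟩ := Set.mem_iUnion.1 hx
    obtain ⟨⟨n', hn'⟩, hx'⟩ := Set.mem_iUnion.1 hx'
    obtain rfl := dC_disjoint hx hx'
    exact hn.1 hn'

theorem sum_volume_leaves {m : ℕ} {T : Set (ℤ × (Fin m → ℤ))} {Qt : ℤ × (Fin m → ℤ)}
    (hT : ConvexTree T Qt) (N : ℕ) :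
    ∑ n ∈ Finset.range N, volume (cubes (Qt.1 - n - 1) (leaves T (Qt.1 - n - 1))) +
      volume (Tkset T (Qt.1 - N)) ≤ volume (dC Qt) := by
  induction N with
  | zero =>
    simp only [Finset.range_zero, Finset.sum_empty, zero_add]
    exact measure_mono (Set.iUnion₂_subset fun Q hQ => hT.2.1 Q hQ.1)
  | succ N ih =>
    refine le_trans ?_ ih
    rw [Finset.sum_range_succ, add_assoc]
    gcongr
    have h := volume_leaves_add hT (k := Qt.1 - N - 1) (by omega)
    rw [sub_add_cancel] at h
    push_cast
    rwa [← sub_sub]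

/-- The functions `F_j` localized at the scale `2^k` of the tree. -/
def floc {m : ℕ} (J : Matrix (Idx m) (Fin m) ℝ) (T : Set (ℤ × (Fin m → ℤ)))
    (F : Corner m → (Fin m → ℝ) → ℝ) (k : ℤ) (j : Corner m) : (Fin m → ℝ) → ℝ :=
  ((Amat J j).mulVec '' Tkset T k).indicator (F j)

section

variable {m : ℕ} {Δ α : ℝ} {L : Finset (Fin m)} {J : Matrix (Idx m) (Fin m) ℝ}
  {T : Set (ℤ × (Fin m → ℤ))} {Qt : ℤ × (Fin m → ℤ)} {d : Fin m → ℝ}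
  {F : Corner m → (Fin m → ℝ) → ℝ} {M : Corner m → ℝ}

theorem Reg.measurableSet_image (hJ : Reg Δ J) (j : Corner m) {S : Set (Fin m → ℝ)}
    (hS : MeasurableSet S) : MeasurableSet ((Amat J j).mulVec '' S) :=
  (mulVec_measurableEmbedding (hJ j).2.1).measurableSet_image.2 hS

theorem Adm.nice (H : Adm Δ α L J T Qt d F M) (k : ℤ) : Nice (floc J T F k) := by
  refine ⟨fun j => (H.cont j).measurable.indicator
    (H.reg.measurableSet_image j (Tkset_measurableSet T k)), ?_, ?_⟩
  · have h1 : ∀ j, ∃ B, ∀ y, |F j y| ≤ B := fun j =>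
      (H.supp j).exists_bound_of_continuous (H.cont j)
    choose B hB using h1
    refine ⟨∑ j, |B j|, fun j y => ?_⟩
    have h2 : |floc J T F k j y| ≤ |F j y| := by
      rw [floc, Set.indicator]
      split_ifs
      · exact le_rfl
      · simp
    exact h2.trans ((hB j y).trans ((le_abs_self _).trans
      (Finset.single_le_sum (f := fun j => |B j|) (fun _ _ => abs_nonneg _) (Finset.mem_univ j))))
  · have h1 : ∀ j, ∃ R, ∀ y, F j y ≠ 0 → ‖y‖ ≤ R := fun j => by
      obtain ⟨R, hR⟩ := (H.supp j).isCompact.isBounded.exists_norm_le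
      exact ⟨R, fun y hy => hR y (subset_tsupport _ hy)⟩
    choose R hR using h1
    refine ⟨∑ j, |R j|, fun j y hy i => ?_⟩
    have h2 : F j y ≠ 0 := fun h => hy (by simp [floc, Set.indicator, h])
    exact (norm_le_pi_norm y i).trans ((hR j y h2).trans ((le_abs_self _).trans
      (Finset.single_le_sum (f := fun j => |R j|) (fun _ _ => abs_nonneg _) (Finset.mem_univ j))))

theorem indicator_image_cubes_le (J : Matrix (Idx m) (Fin m) ℝ) (j : Corner m) (k : ℤ)
    (S : Set (Fin m → ℤ)) (y : Fin m → ℝ) :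
    ((Amat J j).mulVec '' cubes k S).indicator (1 : (Fin m → ℝ) → ℝ≥0∞) y ≤
      ∑' n : S, ((Amat J j).mulVec '' dC (k, n.1)).indicator 1 y := by
  by_cases hy : y ∈ (Amat J j).mulVec '' cubes k S
  · obtain ⟨p, hp, rfl⟩ := hy
    obtain ⟨n, hn⟩ := Set.mem_iUnion.1 hp
    refine le_trans ?_ (ENNReal.le_tsum n)
    rw [Set.indicator_of_mem (Set.mem_image_of_mem _ hp),
      Set.indicator_of_mem (Set.mem_image_of_mem _ hn)]
  · simp [Set.indicator_of_notMem hy]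

theorem cubes_bound (m : ℕ) (hm : 0 < m) (Δ α : ℝ) (hΔ : 1 ≤ Δ) (hα : 0 ≤ α) (hα1 : α ≤ 1) :
    ∃ C : ℝ, 0 < C ∧ ∀ L J T Qt d F M, Adm (m := m) Δ α L J T Qt d F M →
      ∀ (k : ℤ) (S : Set (Fin m → ℤ)), (∀ n ∈ S, ∃ Q ∈ T, dC (k, n) ⊆ dC Q ∧ k ≤ Q.1 ∧
        Q.1 ≤ k + 1) → ∀ j₀ : Corner m,
        ∫⁻ x : Idx m → ℝ, ((Amat J j₀).mulVec '' cubes k S).indicator 1 (proj j₀ x) *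
          (∏ j, ‖F j (proj j x)‖ₑ) * gaussMass J (fun h => (2 : ℝ) ^ k * d h) x ≤
        ENNReal.ofReal (C * cost α d * ∏ j, M j) * volume (cubes k S) := by
  obtain ⟨C, hC, hb⟩ := size_bound m hm Δ α hΔ hα hα1
  refine ⟨C * 2 ^ m, by positivity, fun L J T Qt d F M H k S hS j₀ => ?_⟩
  have hcost : 0 ≤ C * cost α d * ∏ j, M j :=
    mul_nonneg (mul_nonneg hC.le (Finset.prod_nonneg fun h _ =>
      (Real.rpow_nonneg (H.dpos h).le _).trans (le_max_left _ _)))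
      (Finset.prod_nonneg fun j _ => H.nonneg j)
  have hmeas : ∀ n : S, Measurable fun x : Idx m → ℝ =>
      ((Amat J j₀).mulVec '' dC (k, n.1)).indicator (1 : (Fin m → ℝ) → ℝ≥0∞) (proj j₀ x) *
        (∏ j, ‖F j (proj j x)‖ₑ) * gaussMass J (fun h => (2 : ℝ) ^ k * d h) x := fun n =>
    ((((measurable_one.indicator (H.reg.measurableSet_image j₀ (dC_measurableSet _))).comp
      (proj_measurable j₀)).mul (Finset.measurable_prod _ fun j _ =>
        ((H.cont j).measurable.comp (proj_measurable j)).enorm))).mul (gaussMass_measurable _ _)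
  calc _ ≤ ∫⁻ x : Idx m → ℝ, ∑' n : S,
        ((Amat J j₀).mulVec '' dC (k, n.1)).indicator (1 : (Fin m → ℝ) → ℝ≥0∞) (proj j₀ x) *
        (∏ j, ‖F j (proj j x)‖ₑ) * gaussMass J (fun h => (2 : ℝ) ^ k * d h) x := by
        refine lintegral_mono fun x => ?_
        simp only [ENNReal.tsum_mul_right]
        gcongr
        exact indicator_image_cubes_le J j₀ k S _
    _ = ∑' n : S, ∫⁻ x : Idx m → ℝ,
        ((Amat J j₀).mulVec '' dC (k, n.1)).indicator (1 : (Fin m → ℝ) → ℝ≥0∞) (proj j₀ x) *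
        (∏ j, ‖F j (proj j x)‖ₑ) * gaussMass J (fun h => (2 : ℝ) ^ k * d h) x :=
        lintegral_tsum fun n => (hmeas n).aemeasurable
    _ ≤ ∑' n : S, ENNReal.ofReal (C * 2 ^ m * cost α d * ∏ j, M j) * volume (dC (k, n.1)) := by
        refine ENNReal.tsum_le_tsum fun n => ?_
        obtain ⟨Q, hQ, hsub, hk1, hk2⟩ := hS n.1 n.2
        have h2k : (0 : ℝ) < (2 : ℝ) ^ k := by positivity
        have e1 : (2 : ℝ) ^ k ≤ (2 : ℝ) ^ Q.1 := zpow_le_zpow_right₀ (by norm_num) hk1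
        have e2 : (2 : ℝ) ^ Q.1 ≤ 2 * (2 : ℝ) ^ k := by
          refine (zpow_le_zpow_right₀ (by norm_num) hk2).trans (le_of_eq ?_)
          rw [zpow_add₀ (by norm_num), zpow_one, mul_comm]
        refine le_trans (lintegral_mono fun x => ?_) ((hb L J T Qt d F M H Q hQ ((2 : ℝ) ^ k)
          (by linarith) e1 j₀).trans ?_)
        · gcongr
        · rw [volume_dC, volume_dC, ← ENNReal.ofReal_mul hcost, ← ENNReal.ofReal_mul (by
            have := mul_nonneg hcost (by positivity : (0 : ℝ) ≤ 2 ^ m)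
            calc (0 : ℝ) ≤ _ := this
              _ = _ := by ring)]
          refine ENNReal.ofReal_le_ofReal ?_
          have := pow_le_pow_left₀ (by positivity) e2 m
          rw [mul_pow] at this
          calc _ ≤ C * cost α d * (∏ j, M j) * (2 ^ m * (2 ^ k) ^ m) :=
                mul_le_mul_of_nonneg_left this hcost
            _ = _ := by simp only; ring
    _ = _ := by rw [ENNReal.tsum_mul_left, volume_cubes]

theorem pr_floc_enorm_le (J : Matrix (Idx m) (Fin m) ℝ) (T : Set (ℤ × (Fin m → ℤ)))
    (F : Corner m → (Fin m → ℝ) → ℝ) (k : ℤ) (j₀ : Corner m) (x : Idx m → ℝ) :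
    ‖pr (floc J T F k) x‖ₑ ≤
      ((Amat J j₀).mulVec '' Tkset T k).indicator 1 (proj j₀ x) * ∏ j, ‖F j (proj j x)‖ₑ := by
  by_cases h : proj j₀ x ∈ (Amat J j₀).mulVec '' Tkset T k
  · rw [Set.indicator_of_mem h, Pi.one_apply, one_mul, pr, Real.enorm_eq_ofReal_abs,
      Finset.abs_prod, ENNReal.ofReal_prod_of_nonneg fun _ _ => abs_nonneg _]
    simp only [← Real.enorm_eq_ofReal_abs]
    refine Finset.prod_le_prod' fun j _ => ?_
    rw [floc, Set.indicator]
    split_ifs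
    · exact le_rfl
    · simp
  · rw [pr, Finset.prod_eq_zero (Finset.mem_univ j₀) (by simp [floc, h])]
    simp

theorem pr_floc_sub_enorm_le (hT : ConvexTree T Qt) (J : Matrix (Idx m) (Fin m) ℝ)
    (F : Corner m → (Fin m → ℝ) → ℝ) {k : ℤ} (hk : k < Qt.1) (x : Idx m → ℝ) :
    ‖pr (floc J T F (k + 1)) x - pr (floc J T F k) x‖ₑ ≤ ∑ j₀ : Corner m,
      ((Amat J j₀).mulVec '' cubes k (leaves T k)).indicator 1 (proj j₀ x) *
        ∏ j, ‖F j (proj j x)‖ₑ := by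
  by_cases h : ∀ j, proj j x ∈ (Amat J j).mulVec '' Tkset T k
  · have h' : ∀ j, proj j x ∈ (Amat J j).mulVec '' Tkset T (k + 1) := fun j =>
      Set.image_mono (Tkset_subset_succ hT hk) (h j)
    have : pr (floc J T F (k + 1)) x - pr (floc J T F k) x = 0 := by
      simp [pr, floc, h, h']
    simp [this]
  · push Not at h
    obtain ⟨j₀, hj⟩ := h
    have h0 : pr (floc J T F k) x = 0 := by
      rw [pr, Finset.prod_eq_zero (Finset.mem_univ j₀) (by simp [floc, hj])]
    rw [h0, sub_zero]
    by_cases h1 : proj j₀ x ∈ (Amat J j₀).mulVec '' Tkset T (k + 1)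
    · refine le_trans ?_ (Finset.single_le_sum (f := fun j₀ : Corner m =>
        ((Amat J j₀).mulVec '' cubes k (leaves T k)).indicator (1 : (Fin m → ℝ) → ℝ≥0∞)
          (proj j₀ x) * ∏ j, ‖F j (proj j x)‖ₑ) (fun _ _ => zero_le) (Finset.mem_univ j₀))
      have h2 : proj j₀ x ∈ (Amat J j₀).mulVec '' cubes k (leaves T k) := by
        obtain ⟨p, hp, hpx⟩ := h1
        exact ⟨p, Tkset_diff_subset T k ⟨hp, fun h => hj ⟨p, h, hpx⟩⟩, hpx⟩
      refine (pr_floc_enorm_le J T F (k + 1) j₀ x).trans ?_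
      simp [h1, h2]
    · rw [pr, Finset.prod_eq_zero (Finset.mem_univ j₀) (by simp [floc, h1])]
      simp

end

/-- The telescoping estimate for the Gaussian forms. -/
theorem telescoping_bound (m : ℕ) (hm : 0 < m) (Δ α : ℝ) (hΔ : 1 ≤ Δ) (hα : 0 ≤ α) (hα1 : α ≤ 1) :
    ∃ C : ℝ, 0 < C ∧ ∀ L J T Qt d F M, Adm (m := m) Δ α L J T Qt d F M → ∀ N : ℕ,
      ‖∑ n ∈ Finset.range N,
        (Frm J (floc J T F (Qt.1 - n)) 0 (fun h => (2 : ℝ) ^ (Qt.1 - n - 1) * d h) -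
          Frm J (floc J T F (Qt.1 - n)) 0 (fun h => (2 : ℝ) ^ (Qt.1 - n) * d h))‖ₑ ≤
        ENNReal.ofReal (C * cost α d * ∏ j, M j) * volume (dC Qt) := by
  obtain ⟨C, hC, hb⟩ := cubes_bound m hm Δ α hΔ hα hα1
  refine ⟨(2 ^ m + 2) * C, by positivity, fun L J T Qt d F M H N => ?_⟩
  have hspos : ∀ (k : ℤ) (h : Fin m), 0 < (2 : ℝ) ^ k * d h := fun k h =>
    mul_pos (by positivity) (H.dpos h)
  have hcost : 0 ≤ C * cost α d * ∏ j, M j :=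
    mul_nonneg (mul_nonneg hC.le (Finset.prod_nonneg fun h _ =>
      (Real.rpow_nonneg (H.dpos h).le _).trans (le_max_left _ _)))
      (Finset.prod_nonneg fun j _ => H.nonneg j)
  set K := ENNReal.ofReal (C * cost α d * ∏ j, M j) with hK
  set a : ℕ → ℝ := fun n => Frm J (floc J T F (Qt.1 - n)) 0 (fun h => (2 : ℝ) ^ (Qt.1 - n) * d h)
    with ha
  have ha_bound : ∀ n, ‖a n‖ₑ ≤ K * volume (Tkset T (Qt.1 - n)) := fun n => by
    refine (Frm_zero_enorm_le J _ (hspos _)).trans ?_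
    refine le_trans (lintegral_mono fun x => mul_le_mul_left
      (pr_floc_enorm_le J T F (Qt.1 - n) (fun _ => 0) x) _) ?_
    rw [Tkset_eq_cubes]
    exact hb L J T Qt d F M H _ _ (fun n' hn' => ⟨_, hn', subset_rfl, le_rfl, by simp⟩) _
  have hdiff : ∀ n : ℕ, ‖Frm J (floc J T F (Qt.1 - n)) 0
      (fun h => (2 : ℝ) ^ (Qt.1 - n - 1) * d h) - a (n + 1)‖ₑ ≤
      2 ^ m * K * volume (cubes (Qt.1 - n - 1) (leaves T (Qt.1 - n - 1))) := fun n => by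
    have e : Qt.1 - ((n + 1 : ℕ) : ℤ) = Qt.1 - n - 1 := by push_cast; ring
    simp only [ha, e]
    have e2 : (Qt.1 - n : ℤ) = Qt.1 - n - 1 + 1 := by ring
    conv_lhs => rw [e2]
    simp only [add_sub_cancel_right]
    set k : ℤ := Qt.1 - n - 1
    refine (Frm_zero_sub_enorm_le H.reg (H.nice _) (H.nice _) (hspos k)).trans ?_
    refine le_trans (lintegral_mono fun x => mul_le_mul_left
      (pr_floc_sub_enorm_le H.tree J F (k := k) (by omega) x) _) ?_
    simp only [Finset.sum_mul]
    rw [lintegral_finsetSum]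
    · refine (Finset.sum_le_sum fun j₀ _ => hb L J T Qt d F M H k (leaves T k)
        (fun n' hn' => ⟨_, hn'.2, dC_subset_parent k n', by simp, by simp⟩) j₀).trans ?_
      rw [Finset.sum_const, Finset.card_univ, nsmul_eq_mul, ← mul_assoc]
      simp [hK]
    · intro j₀ _
      exact (((measurable_one.indicator (H.reg.measurableSet_image j₀
        (cubes_measurableSet _ _))).comp (proj_measurable j₀)).mul
          (Finset.measurable_prod _ fun j _ =>
            ((H.cont j).measurable.comp (proj_measurable j)).enorm)).mul (gaussMass_measurable _ _)
  have hsplit : ∑ n ∈ Finset.range N,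
        (Frm J (floc J T F (Qt.1 - n)) 0 (fun h => (2 : ℝ) ^ (Qt.1 - n - 1) * d h) - a n) =
      ∑ n ∈ Finset.range N,
        (Frm J (floc J T F (Qt.1 - n)) 0 (fun h => (2 : ℝ) ^ (Qt.1 - n - 1) * d h) - a (n + 1)) +
        (a N - a 0) := by
    rw [← Finset.sum_range_sub, ← Finset.sum_add_distrib]
    exact Finset.sum_congr rfl fun n _ => by ring
  have hvol := sum_volume_leaves H.tree
  change ‖∑ n ∈ Finset.range N,
    (Frm J (floc J T F (Qt.1 - n)) 0 (fun h => (2 : ℝ) ^ (Qt.1 - n - 1) * d h) - a n)‖ₑ ≤ _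
  rw [hsplit]
  calc _ ≤ ∑ n ∈ Finset.range N,
        2 ^ m * K * volume (cubes (Qt.1 - n - 1) (leaves T (Qt.1 - n - 1))) +
        (K * volume (Tkset T (Qt.1 - N)) + K * volume (Tkset T (Qt.1 - (0 : ℕ)))) := by
        refine (enorm_add_le _ _).trans (add_le_add ((enorm_sum_le _ _).trans
          (Finset.sum_le_sum fun n _ => hdiff n)) (enorm_sub_le.trans
          (add_le_add (ha_bound N) (ha_bound 0))))
    _ ≤ 2 ^ m * K * volume (dC Qt) + (K * volume (dC Qt) + K * volume (dC Qt)) := by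
        rw [← Finset.mul_sum]
        have h0 := (le_add_self.trans (hvol 0))
        have h1 := (le_add_self.trans (hvol N))
        have h2 := (le_self_add.trans (hvol N))
        gcongr
    _ = _ := by
        rw [mul_assoc ((2 : ℝ) ^ m + 2), mul_assoc ((2 : ℝ) ^ m + 2), ENNReal.ofReal_mul
          (by positivity), ← hK, ENNReal.ofReal_add (by positivity) (by norm_num),
          ENNReal.ofReal_pow (by norm_num)]
        simp only [ENNReal.ofReal_ofNat]
        ring

/-- The character `e^{2πi ξ·Πx}`. -/
def ech {m : ℕ} (J : Matrix (Idx m) (Fin m) ℝ) (x : Idx m → ℝ) (ξ : Fin m → ℝ) : ℂ :=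
  Complex.exp (2 * Real.pi * Complex.I * ((∑ κ, eta J ξ κ * x κ : ℝ) : ℂ))

/-- The Fourier multiplier of the kernel `gker`. -/
def mgp {m : ℕ} (J : Matrix (Idx m) (Fin m) ℝ) (β : Idx m → ℕ) (s : Fin m → ℝ)
    (ξ : Fin m → ℝ) : ℂ := ∏ κ, mg (β κ) (s (base κ)) (eta J ξ κ)

/-- The Fourier transform of `pr f` on the range of `Π^T`. -/
def fhat {m : ℕ} (J : Matrix (Idx m) (Fin m) ℝ) (f : Corner m → (Fin m → ℝ) → ℝ)
    (ξ : Fin m → ℝ) : ℂ := ∫ x, (pr f x : ℂ) * ech J x ξ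

theorem norm_exp_two_pi_I (r : ℝ) : ‖Complex.exp (2 * Real.pi * Complex.I * (r : ℂ))‖ = 1 := by
  have : 2 * Real.pi * Complex.I * (r : ℂ) = ((2 * Real.pi * r : ℝ) : ℂ) * Complex.I := by
    push_cast; ring
  rw [this, Complex.norm_exp_ofReal_mul_I]

theorem ech_norm {m : ℕ} (J : Matrix (Idx m) (Fin m) ℝ) (x : Idx m → ℝ) (ξ : Fin m → ℝ) :
    ‖ech J x ξ‖ = 1 := norm_exp_two_pi_I _

theorem eta_continuous {m : ℕ} (J : Matrix (Idx m) (Fin m) ℝ) : Continuous (eta J) :=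
  Continuous.matrix_mulVec continuous_const continuous_id

theorem continuous_ech_comp {m : ℕ} (J : Matrix (Idx m) (Fin m) ℝ) {X : Type*} [TopologicalSpace X]
    {x : X → Idx m → ℝ} {ξ : X → Fin m → ℝ} (hx : Continuous x) (hξ : Continuous ξ) :
    Continuous fun z => ech J (x z) (ξ z) := by
  have h : ∀ κ, Continuous fun z => eta J (ξ z) κ := fun κ =>
    (continuous_apply κ).comp ((eta_continuous J).comp hξ)
  unfold ech
  refine Complex.continuous_exp.comp (continuous_const.mul (Complex.continuous_ofReal.comp ?_))
  exact continuous_finsetSum _ fun κ _ => (h κ).mul ((continuous_apply κ).comp hx)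

theorem ech_continuous {m : ℕ} (J : Matrix (Idx m) (Fin m) ℝ) :
    Continuous fun z : (Idx m → ℝ) × (Fin m → ℝ) => ech J z.1 z.2 :=
  continuous_ech_comp J continuous_fst continuous_snd

theorem ech_continuous_left {m : ℕ} (J : Matrix (Idx m) (Fin m) ℝ) (ξ : Fin m → ℝ) :
    Continuous fun x : Idx m → ℝ => ech J x ξ :=
  continuous_ech_comp J continuous_id continuous_const

theorem ech_continuous_right {m : ℕ} (J : Matrix (Idx m) (Fin m) ℝ) (x : Idx m → ℝ) :
    Continuous (ech J x) :=
  continuous_ech_comp J continuous_const continuous_id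

theorem mg_continuous_uncurry (r : ℕ) : Continuous fun z : ℝ × ℝ => mg r z.1 z.2 := by
  unfold mg
  fun_prop

theorem mgp_continuous {m : ℕ} (J : Matrix (Idx m) (Fin m) ℝ) (β : Idx m → ℕ) :
    Continuous fun z : (Fin m → ℝ) × (Fin m → ℝ) => mgp J β z.1 z.2 := by
  unfold mgp
  refine continuous_finsetProd _ fun κ _ => ?_
  have h1 : Continuous fun z : (Fin m → ℝ) × (Fin m → ℝ) => z.1 (base κ) := by fun_prop
  have h2 : Continuous fun z : (Fin m → ℝ) × (Fin m → ℝ) => eta J z.2 κ :=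
    (continuous_apply κ).comp ((eta_continuous J).comp continuous_snd)
  exact (mg_continuous_uncurry (β κ)).comp (h1.prodMk h2)

theorem mgp_bound {m : ℕ} (β : Idx m → ℕ) : ∃ C : ℝ, 0 < C ∧
    ∀ (J : Matrix (Idx m) (Fin m) ℝ) (s ξ : Fin m → ℝ), ‖mgp J β s ξ‖ ≤
      C * ∏ h, Real.exp (-(Real.pi / 2) * (s h * ξ h) ^ 2) := by
  choose C hC hb using mg_bound
  refine ⟨∏ κ, C (β κ), Finset.prod_pos fun κ _ => hC _, fun J s ξ => ?_⟩
  rw [mgp, norm_prod]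
  refine (Finset.prod_le_prod (fun _ _ => norm_nonneg _) fun κ _ => hb (β κ) _ _).trans ?_
  rw [Finset.prod_mul_distrib]
  refine mul_le_mul_of_nonneg_left ?_ (Finset.prod_nonneg fun κ _ => (hC _).le)
  rw [Fintype.prod_sum_type]
  simp only [base_inl, eta_inl, base_inr]
  refine mul_le_of_le_one_right (Finset.prod_nonneg fun _ _ => (Real.exp_pos _).le) ?_
  refine Finset.prod_le_one (fun _ _ => (Real.exp_pos _).le) fun h _ => Real.exp_le_one_iff.2 ?_
  have := mul_nonneg (by positivity : 0 ≤ Real.pi / 2) (sq_nonneg (s h * eta J ξ (Sum.inr h)))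
  linarith

theorem gaussian_prod_integrable {m : ℕ} {a : Fin m → ℝ} (ha : ∀ h, 0 < a h) :
    Integrable fun ξ : Fin m → ℝ => ∏ h, Real.exp (-(Real.pi / 2) * (a h * ξ h) ^ 2) := by
  refine Integrable.fintype_prod (f := fun h y => Real.exp (-(Real.pi / 2) * (a h * y) ^ 2))
    fun h => ?_
  have := integrable_exp_neg_sq_div (b := Real.pi / 2) (by positivity) (inv_pos.2 (ha h))
  simpa [div_inv_eq_mul, mul_comm] using this

/-- Pairing with multipliers, integrated over parameters. -/
theorem integrable_mgp {m : ℕ} (J : Matrix (Idx m) (Fin m) ℝ) (β : Idx m → ℕ) {Ω : Type*}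
    [MeasurableSpace Ω] {ν : Measure Ω} [SFinite ν] {w : Ω → ℂ} (hw : Integrable w ν)
    {σ : Ω → Fin m → ℝ} (hσ : Measurable σ) {a : Fin m → ℝ} (ha : ∀ h, 0 < a h)
    (hσa : ∀ᵐ ω ∂ν, ∀ h, a h ≤ σ ω h) :
    Integrable (fun z : Ω × (Fin m → ℝ) => w z.1 * mgp J β (σ z.1) z.2) (ν.prod volume) := by
  obtain ⟨C, hC, hb⟩ := mgp_bound β
  refine Integrable.mono' (hw.norm.mul_prod ((gaussian_prod_integrable ha).const_mul C)) ?_ ?_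
  · refine AEStronglyMeasurable.mul hw.aestronglyMeasurable.comp_fst ?_
    exact ((mgp_continuous J β).measurable.comp
      ((hσ.comp measurable_fst).prodMk measurable_snd)).aestronglyMeasurable
  · filter_upwards [Measure.quasiMeasurePreserving_fst.ae hσa] with z hz
    rw [norm_mul]
    refine mul_le_mul_of_nonneg_left ((hb J _ _).trans (mul_le_mul_of_nonneg_left ?_ hC.le))
      (norm_nonneg _)
    refine Finset.prod_le_prod (fun _ _ => (Real.exp_pos _).le) fun h _ => Real.exp_le_exp.2 ?_
    have h1 : (a h * z.2 h) ^ 2 ≤ (σ z.1 h * z.2 h) ^ 2 := by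
      rw [mul_pow, mul_pow]
      exact mul_le_mul_of_nonneg_right (pow_le_pow_left₀ (ha h).le (hz h) 2) (sq_nonneg _)
    have := mul_le_mul_of_nonneg_left h1 (by positivity : 0 ≤ Real.pi / 2)
    linarith

theorem mgp_integrable {m : ℕ} (J : Matrix (Idx m) (Fin m) ℝ) (β : Idx m → ℕ) {s : Fin m → ℝ}
    (hs : ∀ h, 0 < s h) : Integrable (mgp J β s) := by
  obtain ⟨C, hC, hb⟩ := mgp_bound β
  exact Integrable.mono' ((gaussian_prod_integrable hs).const_mul C)
    ((mgp_continuous J β).comp (continuous_const.prodMk continuous_id)).aestronglyMeasurable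
    (Filter.Eventually.of_forall fun ξ => hb J s ξ)

section

variable {m : ℕ} {Δ : ℝ} {J : Matrix (Idx m) (Fin m) ℝ} {f : Corner m → (Fin m → ℝ) → ℝ}

theorem Nice.fhat_continuous (hf : Nice f) (J : Matrix (Idx m) (Fin m) ℝ) :
    Continuous (fhat J f) := by
  refine continuous_of_dominated (bound := fun x => ‖pr f x‖) (fun ξ => ?_) (fun ξ => ?_)
    hf.pr_integrable.norm ?_
  · exact (hf.pr_measurable.complex_ofReal.mul
      (ech_continuous_left J ξ).measurable).aestronglyMeasurable
  · exact Filter.Eventually.of_forall fun x => by simp [ech_norm]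
  · exact Filter.Eventually.of_forall fun x =>
      continuous_const.mul (ech_continuous_right J x)

theorem fhat_norm_le (J : Matrix (Idx m) (Fin m) ℝ) (f : Corner m → (Fin m → ℝ) → ℝ)
    (ξ : Fin m → ℝ) : ‖fhat J f ξ‖ ≤ ∫ x, ‖pr f x‖ := by
  refine (norm_integral_le_integral_norm _).trans (le_of_eq ?_)
  simp [ech_norm]

theorem Nice.integrable_mul_fhat (hf : Nice f) (J : Matrix (Idx m) (Fin m) ℝ) {Ω : Type*}
    [MeasurableSpace Ω] {ν : Measure Ω} [SFinite ν] {μ : Ω × (Fin m → ℝ) → ℂ}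
    (hμ : Integrable μ (ν.prod volume)) :
    Integrable (fun z => μ z * fhat J f z.2) (ν.prod volume) :=
  hμ.mul_bdd (c := ∫ x, ‖pr f x‖)
    ((hf.fhat_continuous J).measurable.comp measurable_snd).aestronglyMeasurable
    (Filter.Eventually.of_forall fun z => fhat_norm_le J f z.2)

theorem Nice.integral_ech_swap (hf : Nice f) (J : Matrix (Idx m) (Fin m) ℝ) {Ω : Type*}
    [MeasurableSpace Ω] {ν : Measure Ω} [SFinite ν] {μ : Ω × (Fin m → ℝ) → ℂ}
    (hμ : Integrable μ (ν.prod volume)) :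
    ∫ x, (pr f x : ℂ) * ∫ ω, (∫ ξ, μ (ω, ξ) * ech J x ξ) ∂ν =
      ∫ ω, (∫ ξ, μ (ω, ξ) * fhat J f ξ) ∂ν := by
  have hx : ∀ x, Integrable (fun z : Ω × (Fin m → ℝ) => μ z * ech J x z.2) (ν.prod volume) :=
    fun x => hμ.mul_bdd (c := 1) ((ech_continuous_right J x).measurable.comp
      measurable_snd).aestronglyMeasurable
      (Filter.Eventually.of_forall fun z => (ech_norm J x z.2).le)
  have hall : Integrable (fun y : (Idx m → ℝ) × (Ω × (Fin m → ℝ)) =>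
      (pr f y.1 : ℂ) * μ y.2 * ech J y.1 y.2.2) (volume.prod (ν.prod volume)) :=
    (hf.pr_integrable.ofReal.mul_prod hμ).mul_bdd (c := 1)
      ((ech_continuous J).measurable.comp (measurable_fst.prodMk
        (measurable_snd.comp measurable_snd))).aestronglyMeasurable
      (Filter.Eventually.of_forall fun y => (ech_norm J _ _).le)
  calc _ = ∫ x, (∫ z, (pr f x : ℂ) * μ z * ech J x z.2 ∂(ν.prod volume)) := by
        refine integral_congr_ae (Filter.Eventually.of_forall fun x => ?_)
        simp only
        rw [← integral_prod _ (hx x), ← integral_const_mul]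
        simp only [mul_assoc]
    _ = ∫ z, (∫ x, (pr f x : ℂ) * μ z * ech J x z.2) ∂(ν.prod volume) :=
        integral_integral_swap hall
    _ = ∫ z, μ z * fhat J f z.2 ∂(ν.prod volume) := by
        refine integral_congr_ae (Filter.Eventually.of_forall fun z => ?_)
        simp only [fhat]
        rw [← integral_const_mul]
        exact integral_congr_ae (Filter.Eventually.of_forall fun x => by simp only; ring)
    _ = _ := integral_prod _ (hf.integrable_mul_fhat J hμ)

theorem sum_eta_mul (ξ : Fin m → ℝ) (x : Idx m → ℝ) (q : Fin m → ℝ) :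
    ∑ κ, eta J ξ κ * x κ - ∑ i, q i * eta J ξ (Sum.inr i) = ∑ k, ξ k * (x (Sum.inl k) -
      (Nm J (fun _ => 1) *ᵥ fun i => x (Sum.inr i) - q i) k) := by
  rw [Fintype.sum_sum_type]
  simp only [eta_inl, eta_inr, mulVec, dotProduct, mul_sub, Finset.sum_sub_distrib]
  have h1 : ∀ y : Fin m → ℝ, ∑ i, (-∑ k, Nm J (fun _ => 1) k i * ξ k) * y i =
      -∑ k, ξ k * ∑ i, Nm J (fun _ => 1) k i * y i := fun y => by
    simp only [neg_mul, Finset.sum_neg_distrib, Finset.sum_mul, Finset.mul_sum]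
    rw [Finset.sum_comm]
    exact congrArg _ (Finset.sum_congr rfl fun _ _ => Finset.sum_congr rfl fun _ _ => by ring)
  have h2 := h1 fun i => x (Sum.inr i)
  have h3 := h1 q
  simp only [mul_comm (q _)]
  rw [h2, h3]
  ring

/-- The Fourier representation of the kernel `gker`. -/
theorem integral_mgp_mul_ech (hJ : Reg Δ J) (β : Idx m → ℕ) {s : Fin m → ℝ}
    (hs : ∀ h, 0 < s h) (x : Idx m → ℝ) :
    ∫ ξ, mgp J β s ξ * ech J x ξ = ((|(Jb1 J).det| * gker J β s x : ℝ) : ℂ) := by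
  have hdet : (Jb1 J).det ≠ 0 := by rw [Jb1_eq]; exact (hJ _).2.1
  set Ψ : (Fin m → ℝ) → ℝ := fun q => (∏ i, hk (β (Sum.inr i)) (s i) (q i)) *
    ∏ k, hk (β (Sum.inl k)) (s k) (x (Sum.inl k) -
      (Nm J (fun _ => 1) *ᵥ fun i => x (Sum.inr i) - q i) k) with hΨ
  have hInt : Integrable (fun z : (Fin m → ℝ) × (Fin m → ℝ) =>
      (∏ k, mg (β (Sum.inl k)) (s k) (z.1 k)) * (∏ i, (hk (β (Sum.inr i)) (s i) (z.2 i) : ℂ)) *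
        Complex.exp (2 * Real.pi * Complex.I * ((∑ k, z.1 k * (x (Sum.inl k) -
      (Nm J (fun _ => 1) *ᵥ fun i => x (Sum.inr i) - z.2 i) k) : ℝ) : ℂ)))
      (volume.prod volume) := by
    refine ((Integrable.fintype_prod (f := fun k y => mg (β (Sum.inl k)) (s k) y)
      fun k => mg_integrable _ (hs k)).mul_prod (Integrable.fintype_prod
        (f := fun i y => (hk (β (Sum.inr i)) (s i) y : ℂ))
        fun i => (hk_integrable _ (hs i)).ofReal)).mul_bdd (c := 1) ?_
        (Filter.Eventually.of_forall fun z => (norm_exp_two_pi_I _).le)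
    refine Continuous.aestronglyMeasurable (Complex.continuous_exp.comp
      (continuous_const.mul (Complex.continuous_ofReal.comp
        (continuous_finsetSum _ fun k _ => ?_))))
    simp only [mulVec, dotProduct]
    fun_prop
  have hstep : ∀ ξ, mgp J β s ξ * ech J x ξ = ∫ q : Fin m → ℝ,
      (∏ k, mg (β (Sum.inl k)) (s k) (ξ k)) * (∏ i, (hk (β (Sum.inr i)) (s i) (q i) : ℂ)) *
        Complex.exp (2 * Real.pi * Complex.I * ((∑ k, ξ k * (x (Sum.inl k) -
      (Nm J (fun _ => 1) *ᵥ fun i => x (Sum.inr i) - q i) k) : ℝ) : ℂ)) := fun ξ => by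
    rw [mgp, Fintype.prod_sum_type]
    simp only [base_inl, base_inr, eta_inl]
    rw [Finset.prod_congr rfl fun i _ => (hk_fourier (β (Sum.inr i)) (hs i)
      (eta J ξ (Sum.inr i))).symm, ← integral_fintype_prod_volume_eq_prod (f := fun i y =>
      (hk (β (Sum.inr i)) (s i) y : ℂ) *
        Complex.exp (-(2 * Real.pi * Complex.I * ((y * eta J ξ (Sum.inr i) : ℝ) : ℂ)))),
      ← integral_const_mul, ← integral_mul_const]
    refine integral_congr_ae (Filter.Eventually.of_forall fun q => ?_)
    simp only [Finset.prod_mul_distrib]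
    rw [← Complex.exp_sum, ← sum_eta_mul, ech, Finset.sum_neg_distrib, ← Finset.mul_sum,
      mul_assoc (∏ k, mg (β (Sum.inl k)) (s k) (ξ k)),
      mul_assoc (∏ i, (hk (β (Sum.inr i)) (s i) (q i) : ℂ)), ← Complex.exp_add,
      ← mul_assoc (∏ k, mg (β (Sum.inl k)) (s k) (ξ k))]
    congr 2
    push_cast
    ring
  calc _ = ∫ ξ : Fin m → ℝ, ∫ q : Fin m → ℝ, (∏ k, mg (β (Sum.inl k)) (s k) (ξ k)) *
        (∏ i, (hk (β (Sum.inr i)) (s i) (q i) : ℂ)) *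
        Complex.exp (2 * Real.pi * Complex.I * ((∑ k, ξ k * (x (Sum.inl k) -
          (Nm J (fun _ => 1) *ᵥ fun i => x (Sum.inr i) - q i) k) : ℝ) : ℂ)) := by
        simp only [hstep]
    _ = ∫ q : Fin m → ℝ, ∫ ξ : Fin m → ℝ, (∏ k, mg (β (Sum.inl k)) (s k) (ξ k)) *
        (∏ i, (hk (β (Sum.inr i)) (s i) (q i) : ℂ)) *
        Complex.exp (2 * Real.pi * Complex.I * ((∑ k, ξ k * (x (Sum.inl k) -
          (Nm J (fun _ => 1) *ᵥ fun i => x (Sum.inr i) - q i) k) : ℝ) : ℂ)) :=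
        integral_integral_swap hInt
    _ = ∫ q : Fin m → ℝ, ((Ψ q : ℝ) : ℂ) := by
        refine integral_congr_ae (Filter.Eventually.of_forall fun q => ?_)
        simp only [hΨ]
        push_cast
        simp only [← hk_inv _ (hs _)]
        rw [← integral_fintype_prod_volume_eq_prod (f := fun k y =>
          mg (β (Sum.inl k)) (s k) y * Complex.exp (2 * Real.pi * Complex.I * ((y *
            (x (Sum.inl k) - (Nm J (fun _ => 1) *ᵥ fun i => x (Sum.inr i) - q i) k) : ℝ) : ℂ))),
          ← integral_const_mul]
        refine integral_congr_ae (Filter.Eventually.of_forall fun ξ => ?_)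
        simp only [Finset.prod_mul_distrib]
        rw [← Complex.exp_sum, ← Finset.mul_sum]
        push_cast
        ring
    _ = ∫ q : Fin m → ℝ, ((Ψ ((fun i => x (Sum.inr i)) - q) : ℝ) : ℂ) :=
        (integral_sub_left_eq_self (fun q => ((Ψ q : ℝ) : ℂ)) volume _).symm
    _ = ((|(Jb1 J).det| : ℝ) : ℂ) * ∫ p : Fin m → ℝ,
        ((Ψ ((fun i => x (Sum.inr i)) - Jb1 J *ᵥ p) : ℝ) : ℂ) := by
        have h0 : ((|(Jb1 J).det| : ℝ) : ℂ) ≠ 0 := by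
          exact_mod_cast abs_ne_zero.2 hdet
        rw [integral_comp_mulVec hdet (fun q => ((Ψ ((fun i => x (Sum.inr i)) - q) : ℝ) : ℂ)),
          Complex.ofReal_inv, mul_inv_cancel_left₀ h0]
    _ = _ := by
        rw [integral_complex_ofReal, Complex.ofReal_mul, gker]
        congr 3
        funext p
        simp only [hΨ, tker]
        rw [Fintype.prod_sum_type, mul_comm]
        have h1 : ∀ k, (Nm J (fun _ => 1) *ᵥ fun i => x (Sum.inr i) -
            ((fun i => x (Sum.inr i)) - Jb1 J *ᵥ p) i) k = (J *ᵥ p) (Sum.inl k) := fun k => by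
          have h2 : (fun i => x (Sum.inr i) - ((fun i => x (Sum.inr i)) - Jb1 J *ᵥ p) i) =
              Amat J (fun _ => 1) *ᵥ p := by
            funext i; simp [Jb1_eq]
          rw [h2, Matrix.mulVec_mulVec, Nm, Matrix.nonsing_inv_mul_cancel_right _ _ (hJ.isUnit _)]
          rfl
        simp only [h1, base_inl, base_inr]
        rfl

/-- The forms on the frequency side. -/
theorem Nice.integral_mgp_mul_fhat (hJ : Reg Δ J) (hf : Nice f) (β : Idx m → ℕ) {s : Fin m → ℝ}
    (hs : ∀ h, 0 < s h) :
    ∫ ξ, mgp J β s ξ * fhat J f ξ = ((|(Jb1 J).det| * Frm J f β s : ℝ) : ℂ) := by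
  have hInt : Integrable (fun z : Unit × (Fin m → ℝ) => mgp J β s z.2)
      ((Measure.dirac ()).prod volume) := (mgp_integrable J β hs).comp_snd _
  have h := hf.integral_ech_swap J hInt
  simp only [integral_dirac] at h
  rw [← h, Frm, ← integral_const_mul, ← integral_complex_ofReal]
  refine integral_congr_ae (Filter.Eventually.of_forall fun x => ?_)
  simp only [integral_mgp_mul_ech hJ β hs x]
  push_cast
  ring

theorem Nice.integrable_Frm (hJ : Reg Δ J) (hf : Nice f) (β : Idx m → ℕ) {Ω : Type*}
    [MeasurableSpace Ω] {ν : Measure Ω} [SFinite ν] {w : Ω → ℝ} (hw : Integrable w ν)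
    {σ : Ω → Fin m → ℝ} (hσ : Measurable σ) {a : Fin m → ℝ} (ha : ∀ h, 0 < a h)
    (hσa : ∀ᵐ ω ∂ν, ∀ h, a h ≤ σ ω h) : Integrable (fun ω => w ω * Frm J f β (σ ω)) ν := by
  have hdet : |(Jb1 J).det| ≠ 0 := by rw [Jb1_eq]; exact abs_ne_zero.2 (hJ _).2.1
  have hw' : Integrable (fun ω => (w ω : ℂ)) ν := hw.ofReal
  have h := (hf.integrable_mul_fhat J
    (integrable_mgp J β hw' hσ ha hσa)).integral_prod_left.re.const_mul |(Jb1 J).det|⁻¹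
  refine h.congr ?_
  filter_upwards [hσa] with ω hω
  simp only [mul_assoc]
  rw [integral_const_mul, hf.integral_mgp_mul_fhat hJ β fun h => (ha h).trans_le (hω h),
    ← Complex.ofReal_mul, RCLike.re_eq_complex_re, Complex.ofReal_re]
  field_simp

theorem Nice.integral_integral_mgp (hJ : Reg Δ J) (hf : Nice f) (β : Idx m → ℕ) {Ω : Type*}
    [MeasurableSpace Ω] {ν : Measure Ω} [SFinite ν] {w : Ω → ℝ} (hw : Integrable w ν)
    {σ : Ω → Fin m → ℝ} (hσ : Measurable σ) {a : Fin m → ℝ} (ha : ∀ h, 0 < a h)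
    (hσa : ∀ᵐ ω ∂ν, ∀ h, a h ≤ σ ω h) :
    ∫ ξ, (∫ ω, (w ω : ℂ) * mgp J β (σ ω) ξ ∂ν) * fhat J f ξ =
      ((|(Jb1 J).det| * ∫ ω, w ω * Frm J f β (σ ω) ∂ν : ℝ) : ℂ) := by
  have h := hf.integrable_mul_fhat J (integrable_mgp J β hw.ofReal hσ ha hσa)
  simp only [← integral_mul_const]
  have e := integral_integral_swap (f := fun (ω : Ω) (ξ : Fin m → ℝ) =>
    (w ω : ℂ) * mgp J β (σ ω) ξ * fhat J f ξ) h
  refine e.symm.trans ?_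
  rw [← integral_const_mul, ← integral_complex_ofReal]
  refine integral_congr_ae ?_
  filter_upwards [hσa] with ω hω
  simp only [mul_assoc]
  rw [integral_const_mul, hf.integral_mgp_mul_fhat hJ β fun h => (ha h).trans_le (hω h)]
  push_cast
  ring

theorem Nice.Frm_measurable (hf : Nice f) (β : Idx m → ℕ) {Ω : Type*}
    [MeasurableSpace Ω] {σ : Ω → Fin m → ℝ} (hσ : Measurable σ) :
    Measurable fun ω => |(Jb1 J).det|⁻¹ * (∫ ξ, mgp J β (σ ω) ξ * fhat J f ξ).re := by
  refine measurable_const.mul (Complex.measurable_re.comp ?_)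
  refine (StronglyMeasurable.integral_prod_right' (ν := volume)
    (f := fun z : Ω × (Fin m → ℝ) => mgp J β (σ z.1) z.2 * fhat J f z.2) ?_).measurable
  exact (((mgp_continuous J β).measurable.comp ((hσ.comp measurable_fst).prodMk
    measurable_snd)).mul ((hf.fhat_continuous J).measurable.comp measurable_snd)).stronglyMeasurable

end

section

variable {m : ℕ} {Δ : ℝ} {J : Matrix (Idx m) (Fin m) ℝ} {f : Corner m → (Fin m → ℝ) → ℝ}

/-- The multi-index of the mixed second derivative in the two coordinates at `h`. -/
def pairIdx (h : Fin m) : Idx m → ℕ := Pi.single (Sum.inl h) 1 + Pi.single (Sum.inr h) 1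

/-- The symbol `|DΠ^TΘξ|² g(DΠ^Tξ)` in the coordinates `Π^T ξ`. -/
def symb (L : Finset (Fin m)) (J : Matrix (Idx m) (Fin m) ℝ) (s : Fin m → ℝ) (ξ : Fin m → ℝ) : ℝ :=
  (∑ κ ∈ offIdx L, (s (base κ) * eta J ξ κ) ^ 2 +
    ∑ h ∈ L, (s h * (eta J ξ (Sum.inl h) + eta J ξ (Sum.inr h))) ^ 2) *
    Real.exp (-Real.pi * ∑ κ, (s (base κ) * eta J ξ κ) ^ 2)

/-- A multiple of the form with multiplier `symb`. -/
def Bform (L : Finset (Fin m)) (J : Matrix (Idx m) (Fin m) ℝ) (f : Corner m → (Fin m → ℝ) → ℝ)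
    (s : Fin m → ℝ) : ℝ :=
  ∑ κ, Frm J f (Pi.single κ 2) s + 2 * ∑ h ∈ L, Frm J f (pairIdx h) s

theorem mgp_eq (J : Matrix (Idx m) (Fin m) ℝ) (β : Idx m → ℕ) (s ξ : Fin m → ℝ) :
    mgp J β s ξ = (∏ κ, (2 * Real.pi * Complex.I * ((s (base κ) * eta J ξ κ : ℝ) : ℂ)) ^ β κ) *
      ((Real.exp (-Real.pi * ∑ κ, (s (base κ) * eta J ξ κ) ^ 2) : ℝ) : ℂ) := by
  simp only [mgp, mg, Finset.prod_mul_distrib, Finset.mul_sum, Real.exp_sum, Complex.ofReal_prod]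

theorem continuous_mgp_smul (J : Matrix (Idx m) (Fin m) ℝ) (β : Idx m → ℕ) (d ξ : Fin m → ℝ) :
    Continuous fun t : ℝ => mgp J β (fun h => t * d h) ξ := by
  unfold mgp mg
  fun_prop

theorem prod_pow_single {ι M : Type*} [Fintype ι] [DecidableEq ι] [CommMonoid M] (x : ι → M)
    (i : ι) (n : ℕ) : ∏ k, x k ^ (Pi.single i n : ι → ℕ) k = x i ^ n := by
  rw [Finset.prod_eq_single i (fun k _ hk => by simp [Pi.single_eq_of_ne hk]) (by simp)]
  simp

theorem sum_sq_offIdx (L : Finset (Fin m)) (x : Idx m → ℝ) :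
    ∑ κ, x κ ^ 2 + 2 * ∑ h ∈ L, x (Sum.inl h) * x (Sum.inr h) =
      ∑ κ ∈ offIdx L, x κ ^ 2 + ∑ h ∈ L, (x (Sum.inl h) + x (Sum.inr h)) ^ 2 := by
  have h1 : ∑ κ, x κ ^ 2 = ∑ κ ∈ offIdx L, x κ ^ 2 +
      ∑ h ∈ L, (x (Sum.inl h) ^ 2 + x (Sum.inr h) ^ 2) := by
    have hL : ∀ g : Fin m → ℝ, ∑ h ∈ L, g h = ∑ h, if h ∈ L then g h else 0 := fun g => by simp
    rw [offIdx, Finset.sum_filter, Fintype.sum_sum_type, Fintype.sum_sum_type, hL,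
      ← Finset.sum_add_distrib, ← Finset.sum_add_distrib, ← Finset.sum_add_distrib]
    refine Finset.sum_congr rfl fun h _ => ?_
    by_cases hh : h ∈ L <;> simp [hh]
  rw [h1, Finset.mul_sum, add_assoc, ← Finset.sum_add_distrib]
  congr 1
  exact Finset.sum_congr rfl fun h _ => by ring

theorem symb_eq_mgp (L : Finset (Fin m)) (J : Matrix (Idx m) (Fin m) ℝ) (s ξ : Fin m → ℝ) :
    (-(4 * Real.pi ^ 2) * symb L J s ξ : ℂ) =
      ∑ κ, mgp J (Pi.single κ 2) s ξ + 2 * ∑ h ∈ L, mgp J (pairIdx h) s ξ := by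
  have h1 : ∀ κ, mgp J (Pi.single κ 2) s ξ = -(4 * Real.pi ^ 2) *
      (((s (base κ) * eta J ξ κ) ^ 2 : ℝ) : ℂ) *
      ((Real.exp (-Real.pi * ∑ κ, (s (base κ) * eta J ξ κ) ^ 2) : ℝ) : ℂ) := by
    intro κ
    rw [mgp_eq, prod_pow_single]
    congr 1
    push_cast
    linear_combination (4 * Real.pi ^ 2 * (s (base κ) : ℂ) ^ 2 * (eta J ξ κ : ℂ) ^ 2) *
      Complex.I_sq
  have h2 : ∀ h, mgp J (pairIdx h) s ξ = -(4 * Real.pi ^ 2) *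
      (((s h * eta J ξ (Sum.inl h)) * (s h * eta J ξ (Sum.inr h)) : ℝ) : ℂ) *
      ((Real.exp (-Real.pi * ∑ κ, (s (base κ) * eta J ξ κ) ^ 2) : ℝ) : ℂ) := by
    intro h
    rw [mgp_eq]
    simp only [pairIdx, Pi.add_apply, pow_add, Finset.prod_mul_distrib, prod_pow_single, pow_one]
    congr 1
    push_cast
    simp only [base_inl, base_inr]
    linear_combination (4 * Real.pi ^ 2 * (s h : ℂ) ^ 2 * (eta J ξ (Sum.inl h) : ℂ) *
      (eta J ξ (Sum.inr h) : ℂ)) * Complex.I_sq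
  simp only [h1, h2, ← Finset.sum_mul, ← Finset.mul_sum]
  have h3 := sum_sq_offIdx L fun κ => s (base κ) * eta J ξ κ
  simp only [base_inl, base_inr, ← mul_add] at h3
  rw [symb, ← h3]
  push_cast
  ring

/-- The form with multiplier `symb`. -/
theorem Nice.integral_symb_mul_fhat (hJ : Reg Δ J) (hf : Nice f) (L : Finset (Fin m))
    {s : Fin m → ℝ} (hs : ∀ h, 0 < s h) :
    -(4 * Real.pi ^ 2) * ∫ ξ, (symb L J s ξ : ℂ) * fhat J f ξ =
      ((|(Jb1 J).det| * Bform L J f s : ℝ) : ℂ) := by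
  have hi : ∀ β, Integrable fun ξ => mgp J β s ξ * fhat J f ξ := fun β => by
    refine (mgp_integrable J β hs).mul_bdd (c := ∫ x, ‖pr f x‖)
      (hf.fhat_continuous J).aestronglyMeasurable ?_
    exact Filter.Eventually.of_forall fun ξ => fhat_norm_le J f ξ
  rw [← integral_const_mul]
  simp only [← mul_assoc, symb_eq_mgp, add_mul, Finset.sum_mul]
  simp only [mul_assoc, Finset.sum_mul]
  rw [integral_add (integrable_finsetSum _ fun κ _ => hi _)
    ((integrable_finsetSum _ fun κ _ => hi _).const_mul _),
    integral_const_mul, integral_finsetSum _ fun κ _ => hi _, integral_finsetSum _ fun κ _ => hi _]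
  simp only [hf.integral_mgp_mul_fhat hJ _ hs]
  rw [Bform]
  push_cast
  simp only [mul_add, Finset.mul_sum]
  congr 1
  exact Finset.sum_congr rfl fun h _ => by ring

theorem hasDerivAt_mgp_zero (J : Matrix (Idx m) (Fin m) ℝ) (d ξ : Fin m → ℝ) (t : ℝ) :
    HasDerivAt (fun t : ℝ => (2 * Real.pi : ℂ) * mgp J 0 (fun h => t * d h) ξ)
      (∑ κ, ((t⁻¹ : ℝ) : ℂ) * mgp J (Pi.single κ 2) (fun h => t * d h) ξ) t := by
  have h := symb_eq_mgp ∅ J (fun h => t * d h) ξ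
  simp only [Finset.sum_empty, mul_zero, add_zero] at h
  rw [← Finset.mul_sum, ← h]
  simp only [mgp_eq, Pi.zero_apply, pow_zero, Finset.prod_const_one, one_mul]
  have h1 : HasDerivAt (fun t : ℝ => 2 * Real.pi *
      Real.exp (-Real.pi * ∑ κ, (t * d (base κ) * eta J ξ κ) ^ 2))
      (-(4 * Real.pi ^ 2) * t⁻¹ * symb ∅ J (fun h => t * d h) ξ) t := by
    have h2 : ∀ t : ℝ, -Real.pi * ∑ κ, (t * d (base κ) * eta J ξ κ) ^ 2 =
        t ^ 2 * (-Real.pi * ∑ κ, (d (base κ) * eta J ξ κ) ^ 2) := by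
      intro t
      rw [mul_left_comm, Finset.mul_sum (a := t ^ 2)]
      congr 1
      exact Finset.sum_congr rfl fun κ _ => by ring
    simp only [symb, offIdx, Finset.notMem_empty, not_false_eq_true, Finset.filter_true,
      Finset.sum_empty, add_zero, h2]
    refine ((((hasDerivAt_pow 2 t).mul_const _).exp).const_mul _).congr_deriv ?_
    have h4 : ∑ κ, (t * d (base κ) * eta J ξ κ) ^ 2 =
        t ^ 2 * ∑ κ, (d (base κ) * eta J ξ κ) ^ 2 := by
      rw [Finset.mul_sum]
      exact Finset.sum_congr rfl fun κ _ => by ring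
    rw [h4]
    field_simp
    ring
  have h5 := h1.ofReal_comp
  push_cast at h5 ⊢
  convert h5 using 1
  ring

theorem integrableOn_inv {a b : ℝ} (ha : 0 < a) :
    Integrable (fun t : ℝ => t⁻¹) (volume.restrict (Set.Ioc a b)) := by
  have h : IntegrableOn (fun t : ℝ => t⁻¹) (Set.Icc a b) :=
    (continuousOn_id.inv₀ fun t ht => (ha.trans_le ht.1).ne').integrableOn_Icc
  exact h.mono_set Set.Ioc_subset_Icc_self

theorem ae_le_smul {d : Fin m → ℝ} (hd : ∀ h, 0 < d h) {a b : ℝ} :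
    ∀ᵐ t ∂(volume.restrict (Set.Ioc a b)), ∀ h, a * d h ≤ t * d h := by
  filter_upwards [ae_restrict_mem measurableSet_Ioc] with t ht h
  exact mul_le_mul_of_nonneg_right ht.1.le (hd h).le

theorem measurable_smul_const (d : Fin m → ℝ) : Measurable fun (t : ℝ) (h : Fin m) => t * d h :=
  measurable_pi_lambda _ fun _ => measurable_id.mul_const _

theorem Nice.integrable_inv_mul_Frm (hJ : Reg Δ J) (hf : Nice f) (β : Idx m → ℕ) {d : Fin m → ℝ}
    (hd : ∀ h, 0 < d h) {a b : ℝ} (ha : 0 < a) :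
    IntegrableOn (fun t => t⁻¹ * Frm J f β (fun h => t * d h)) (Set.Ioc a b) :=
  hf.integrable_Frm hJ β (integrableOn_inv ha) (measurable_smul_const d)
    (fun h => mul_pos ha (hd h)) (ae_le_smul hd)

/-- The heat equation, integrated in time. -/
theorem Nice.integral_heat (hJ : Reg Δ J) (hf : Nice f) {d : Fin m → ℝ} (hd : ∀ h, 0 < d h)
    {a b : ℝ} (ha : 0 < a) (hab : a ≤ b) :
    ∑ κ, ∫ t in Set.Ioc a b, t⁻¹ * Frm J f (Pi.single κ 2) (fun h => t * d h) =
      2 * Real.pi * (Frm J f 0 (fun h => b * d h) - Frm J f 0 (fun h => a * d h)) := by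
  have hdet : |(Jb1 J).det| ≠ 0 := by rw [Jb1_eq]; exact abs_ne_zero.2 (hJ _).2.1
  refine mul_left_cancel₀ hdet (Complex.ofReal_injective ?_)
  have hw : Integrable (fun t : ℝ => ((t⁻¹ : ℝ) : ℂ)) (volume.restrict (Set.Ioc a b)) :=
    (integrableOn_inv ha).ofReal
  have hInt := fun β => integrable_mgp J β hw (measurable_smul_const d)
    (fun h => mul_pos ha (hd h)) (ae_le_smul hd (a := a) (b := b))
  have hInt' := fun β => (hf.integrable_mul_fhat J (hInt β)).integral_prod_right
  have e : ∀ β, ∫ ξ, (∫ t in Set.Ioc a b, ((t⁻¹ : ℝ) : ℂ) * mgp J β (fun h => t * d h) ξ) *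
      fhat J f ξ = ((|(Jb1 J).det| *
        ∫ t in Set.Ioc a b, t⁻¹ * Frm J f β (fun h => t * d h) : ℝ) : ℂ) := fun β =>
    hf.integral_integral_mgp hJ β (integrableOn_inv ha) (measurable_smul_const d)
      (fun h => mul_pos ha (hd h)) (ae_le_smul hd)
  rw [Finset.mul_sum, Complex.ofReal_sum]
  simp only [← e]
  rw [← integral_finsetSum _ fun κ _ => by
    simpa only [integral_mul_const] using hInt' (Pi.single κ 2)]
  have hF := fun c (hc : 0 < c) =>
    hf.integral_mgp_mul_fhat hJ 0 (s := fun h => c * d h) fun h => mul_pos hc (hd h)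
  have hi : ∀ c, 0 < c → Integrable fun ξ => mgp J 0 (fun h => c * d h) ξ * fhat J f ξ :=
    fun c hc => by
      refine (mgp_integrable J 0 fun h => mul_pos hc (hd h)).mul_bdd (c := ∫ x, ‖pr f x‖)
        (hf.fhat_continuous J).aestronglyMeasurable ?_
      exact Filter.Eventually.of_forall fun ξ => fhat_norm_le J f ξ
  have hr : ((|(Jb1 J).det| * (2 * Real.pi * (Frm J f 0 (fun h => b * d h) -
      Frm J f 0 (fun h => a * d h))) : ℝ) : ℂ) = ∫ ξ, 2 * Real.pi *
        (mgp J 0 (fun h => b * d h) ξ - mgp J 0 (fun h => a * d h) ξ) * fhat J f ξ := by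
    simp only [mul_assoc, sub_mul]
    rw [integral_const_mul, integral_const_mul, integral_sub (hi b (ha.trans_le hab)) (hi a ha),
      hF a ha, hF b (ha.trans_le hab)]
    push_cast
    ring
  rw [hr]
  refine integral_congr_ae (Filter.Eventually.of_forall fun ξ => ?_)
  simp only [← Finset.sum_mul]
  congr 1
  have hc : ∀ β, ContinuousOn (fun t : ℝ => ((t⁻¹ : ℝ) : ℂ) * mgp J β (fun h => t * d h) ξ)
      (Set.Icc a b) := by
    intro β
    refine ContinuousOn.mul (Complex.continuous_ofReal.comp_continuousOn
      (continuousOn_id.inv₀ fun t ht => (ha.trans_le ht.1).ne')) ?_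
    exact (continuous_mgp_smul J β d ξ).continuousOn
  have hci : ∀ β, Integrable (fun t : ℝ => ((t⁻¹ : ℝ) : ℂ) * mgp J β (fun h => t * d h) ξ)
      (volume.restrict (Set.Ioc a b)) := fun β =>
    (ContinuousOn.integrableOn_Icc (hc β)).mono_set Set.Ioc_subset_Icc_self
  rw [← integral_finsetSum Finset.univ fun (κ : Idx m) _ => hci (Pi.single κ 2),
    ← intervalIntegral.integral_of_le hab, mul_sub]
  have hcs : ContinuousOn (fun t : ℝ => ∑ κ : Idx m, ((t⁻¹ : ℝ) : ℂ) *
      mgp J (Pi.single κ 2) (fun h => t * d h) ξ) (Set.uIcc a b) := by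
    rw [Set.uIcc_of_le hab]
    exact continuousOn_finsetSum _ fun κ _ => hc _
  exact intervalIntegral.integral_eq_sub_of_hasDerivAt
    (fun t _ => hasDerivAt_mgp_zero J d ξ t) hcs.intervalIntegrable

theorem Nice.integral_Bform (hJ : Reg Δ J) (hf : Nice f) (L : Finset (Fin m)) {d : Fin m → ℝ}
    (hd : ∀ h, 0 < d h) {a b : ℝ} (ha : 0 < a) (hab : a ≤ b) :
    ∫ t in Set.Ioc a b, t⁻¹ * Bform L J f (fun h => t * d h) =
      2 * Real.pi * (Frm J f 0 (fun h => b * d h) - Frm J f 0 (fun h => a * d h)) +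
        2 * ∑ h ∈ L, ∫ t in Set.Ioc a b, t⁻¹ * Frm J f (pairIdx h) (fun h => t * d h) := by
  have hi := fun β => hf.integrable_inv_mul_Frm hJ β hd ha (b := b)
  rw [← hf.integral_heat hJ hd ha hab]
  simp only [Bform, mul_add, Finset.mul_sum, mul_left_comm _ (2 : ℝ)]
  rw [integral_add (integrable_finsetSum _ fun κ _ => hi _)
    (integrable_finsetSum _ fun κ _ => (hi _).const_mul 2), integral_finsetSum _ fun κ _ => hi _,
    integral_finsetSum _ fun κ _ => (hi _).const_mul 2]
  simp only [integral_const_mul]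

theorem Nice.Bform_univ (hJ : Reg Δ J) (hsym : SymRows Finset.univ J) (hf : Nice f)
    {s : Fin m → ℝ} (hs : ∀ h, 0 < s h) : Bform Finset.univ J f s = 0 := by
  have hdet : |(Jb1 J).det| ≠ 0 := by rw [Jb1_eq]; exact abs_ne_zero.2 (hJ _).2.1
  have h := hf.integral_symb_mul_fhat hJ Finset.univ hs
  have h0 : ∀ ξ, symb Finset.univ J s ξ = 0 := fun ξ => by
    simp only [symb, offIdx, Finset.mem_univ, not_true_eq_false, Finset.filter_false,
      Finset.sum_empty, zero_add, eta_inl_add_inr hJ hsym ξ (Finset.mem_univ _),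
      Finset.compl_univ, neg_zero, mul_zero]
    simp
  simp only [h0, Complex.ofReal_zero, zero_mul, integral_zero, mul_zero] at h
  have h' := Complex.ofReal_eq_zero.1 h.symm
  exact (mul_eq_zero.1 h').resolve_left hdet

end

section

variable {m : ℕ} {Δ : ℝ} {J : Matrix (Idx m) (Fin m) ℝ} {f : Corner m → (Fin m → ℝ) → ℝ}

/-- The coordinate `x^e_i`. -/
abbrev coor (i : Fin m) (e : Fin 2) : Idx m := sel (fun _ => e) i

/-- The coordinates of `ℝ^{2m}` whose position is not `i`. -/
abbrev Off (i : Fin m) := {κ : Idx m // ¬ base κ = i}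

theorem coor_zero (i : Fin m) : coor i 0 = Sum.inl i := sel_zero rfl

theorem coor_one (i : Fin m) : coor i 1 = Sum.inr i := sel_one rfl

theorem sel_eq_coor (j : Corner m) (i : Fin m) : sel j i = coor i (j i) := sel_congr rfl

/-- The two coordinates at position `i`. -/
def coorEquiv (i : Fin m) : Fin 2 ≃ {κ : Idx m // base κ = i} where
  toFun e := ⟨coor i e, base_sel _ _⟩
  invFun κ := if κ.1 = Sum.inl i then 0 else 1
  left_inv e := by
    fin_cases e
    · simp [coor_zero]
    · simp [coor_one]
  right_inv := by
    rintro ⟨κ | κ, h⟩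
    · obtain rfl : κ = i := h
      simp [coor_zero]
    · obtain rfl : κ = i := h
      simp [coor_one]

/-- Splitting off the two coordinates at position `i`. -/
def glue (i : Fin m) : (ℝ × ℝ) × (Off i → ℝ) ≃ᵐ (Idx m → ℝ) :=
  (MeasurableEquiv.prodCongr (MeasurableEquiv.finTwoArrow.symm.trans
    (MeasurableEquiv.piCongrLeft (fun _ => ℝ) (coorEquiv i)))
      (MeasurableEquiv.refl (Off i → ℝ))).trans
    (MeasurableEquiv.piEquivPiSubtypeProd (fun _ => ℝ) fun κ : Idx m => base κ = i).symm

theorem glue_off (i : Fin m) (z : (ℝ × ℝ) × (Off i → ℝ)) (κ : Off i) : glue i z κ = z.2 κ := by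
  have h := κ.2
  simp [glue, MeasurableEquiv.piEquivPiSubtypeProd, Equiv.piEquivPiSubtypeProd, h]
  rfl

theorem glue_coor (i : Fin m) (z : (ℝ × ℝ) × (Off i → ℝ)) (e : Fin 2) :
    glue i z (coor i e) = ![z.1.1, z.1.2] e := by
  have h : base (coor i e) = i := base_sel _ _
  have h2 : (⟨coor i e, h⟩ : {κ : Idx m // base κ = i}) = coorEquiv i e := rfl
  simp [glue, MeasurableEquiv.piEquivPiSubtypeProd, Equiv.piEquivPiSubtypeProd, h]
  rw [h2]
  change (MeasurableEquiv.piCongrLeft (fun _ => ℝ) (coorEquiv i)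
    (MeasurableEquiv.finTwoArrow.symm z.1)) (coorEquiv i e) = _
  rw [MeasurableEquiv.piCongrLeft_apply_apply]
  fin_cases e <;> rfl

theorem glue_measurePreserving (i : Fin m) : MeasurePreserving (glue i) := by
  have h1 := (volume_preserving_piEquivPiSubtypeProd (fun _ => ℝ)
    fun κ : Idx m => base κ = i).symm
  have h2 := (volume_preserving_finTwoArrow ℝ).symm
  have h3 := volume_measurePreserving_piCongrLeft (fun _ => ℝ) (coorEquiv i)
  exact h1.comp ((h3.comp h2).prod (MeasurePreserving.id volume))

/-- The product of the functions of the corners with `j i = e`. -/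
def slab (f : Corner m → (Fin m → ℝ) → ℝ) (i : Fin m) (e : Fin 2) (u : ℝ) (y : Off i → ℝ) : ℝ :=
  ∏ j with j i = e, f j (proj j (glue i ((u, u), y)))

/-- One-dimensional convolution of `slab`. -/
def slice (f : Corner m → (Fin m → ℝ) → ℝ) (i : Fin m) (e : Fin 2) (r : ℕ) (σ : ℝ)
    (y : Off i → ℝ) (c : ℝ) : ℝ := ∫ u, slab f i e u y * hk r σ (u - c)

/-- The part of `tker` in the coordinates off position `i`. -/
def offKer (J : Matrix (Idx m) (Fin m) ℝ) (i : Fin m) (β : Idx m → ℕ) (s : Fin m → ℝ)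
    (y : Off i → ℝ) (p : Fin m → ℝ) : ℝ :=
  ∏ κ : Off i, hk (β κ) (s (base κ.1)) (y κ - (J *ᵥ p) κ)

theorem prod_glue {M : Type*} [CommMonoid M] (i : Fin m) (g : Idx m → M) :
    ∏ κ, g κ = g (Sum.inl i) * g (Sum.inr i) * ∏ κ : Off i, g κ := by
  rw [← Fintype.prod_subtype_mul_prod_subtype (fun κ : Idx m => base κ = i),
    ← (coorEquiv i).prod_comp, Fin.prod_univ_two]
  simp only [coorEquiv, Equiv.coe_fn_mk, coor_zero, coor_one]

theorem proj_glue (i : Fin m) (a b : ℝ) (y : Off i → ℝ) (j : Corner m) :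
    proj j (glue i ((a, b), y)) =
      proj j (glue i ((![a, b] (j i), ![a, b] (j i)), y)) := by
  funext h
  rw [proj_apply, proj_apply]
  by_cases hh : h = i
  · subst hh
    rw [sel_eq_coor, glue_coor, glue_coor]
    generalize j h = e
    fin_cases e <;> rfl
  · have h' : ¬ base (sel j h) = i := by rwa [base_sel]
    rw [glue_off i _ ⟨_, h'⟩, glue_off i _ ⟨_, h'⟩]

theorem pr_glue (f : Corner m → (Fin m → ℝ) → ℝ) (i : Fin m) (a b : ℝ) (y : Off i → ℝ) :
    pr f (glue i ((a, b), y)) = slab f i 0 a y * slab f i 1 b y := by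
  rw [pr, ← Finset.prod_filter_mul_prod_filter_not Finset.univ (fun j : Corner m => j i = 0),
    slab, slab]
  congr 1
  · refine Finset.prod_congr rfl fun j hj => ?_
    rw [proj_glue, (Finset.mem_filter.1 hj).2]
    rfl
  · have h : ∀ j : Corner m, ¬ j i = 0 ↔ j i = 1 := fun j => by omega
    simp only [h]
    refine Finset.prod_congr rfl fun j hj => ?_
    rw [proj_glue, (Finset.mem_filter.1 hj).2]
    rfl

theorem tker_glue (J : Matrix (Idx m) (Fin m) ℝ) (i : Fin m) (β : Idx m → ℕ) (s : Fin m → ℝ)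
    (a b : ℝ) (y : Off i → ℝ) (p : Fin m → ℝ) :
    tker β s (glue i ((a, b), y) - J *ᵥ p) =
      hk (β (Sum.inl i)) (s i) (a - (J *ᵥ p) (Sum.inl i)) *
        hk (β (Sum.inr i)) (s i) (b - (J *ᵥ p) (Sum.inr i)) * offKer J i β s y p := by
  have h0 := glue_coor i ((a, b), y) 0
  have h1 := glue_coor i ((a, b), y) 1
  rw [coor_zero] at h0
  rw [coor_one] at h1
  rw [tker, prod_glue i]
  simp only [Pi.sub_apply, glue_off, h0, h1, base_inl, base_inr, offKer]
  rfl

theorem Nice.slab_measurable {X : Type*} [MeasurableSpace X] (hf : Nice f) (i : Fin m) (e : Fin 2)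
    {u : X → ℝ} {y : X → Off i → ℝ} (hu : Measurable u) (hy : Measurable y) :
    Measurable fun x => slab f i e (u x) (y x) := by
  unfold slab
  refine Finset.measurable_prod _ fun j _ => (hf.meas j).comp ((proj_measurable j).comp ?_)
  exact (glue i).measurable.comp ((hu.prodMk hu).prodMk hy)

theorem Nice.slab_bdd (hf : Nice f) (i : Fin m) (e : Fin 2) : ∃ B : ℝ, ∀ u y,
    |slab f i e u y| ≤ B := by
  obtain ⟨B, hB⟩ := hf.bdd
  refine ⟨B ^ (Finset.univ.filter fun j : Corner m => j i = e).card, fun u y => ?_⟩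
  rw [slab, Finset.abs_prod]
  exact (Finset.prod_le_prod (fun _ _ => abs_nonneg _) fun j _ => hB j _).trans_eq
    (Finset.prod_const _)

theorem Nice.slab_supp (hf : Nice f) (i : Fin m) (e : Fin 2) : ∃ R : ℝ, ∀ u y,
    slab f i e u y ≠ 0 → |u| ≤ R := by
  obtain ⟨R, hR⟩ := hf.supp
  refine ⟨R, fun u y h => ?_⟩
  have h1 := Finset.prod_ne_zero_iff.1 h (fun _ => e) (by simp)
  have h2 := hR _ _ h1 i
  rw [proj_apply, glue_coor] at h2
  revert h2
  fin_cases e <;> simp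

theorem Nice.slab_integrable (hf : Nice f) (i : Fin m) (e : Fin 2) (y : Off i → ℝ) :
    Integrable fun u => slab f i e u y := by
  obtain ⟨B, hB⟩ := hf.slab_bdd i e
  obtain ⟨R, hR⟩ := hf.slab_supp i e
  have hm : Measurable fun u => slab f i e u y :=
    hf.slab_measurable i e measurable_id measurable_const
  have h : IntegrableOn (fun u => slab f i e u y) (Set.Icc (-R) R) :=
    IntegrableOn.of_bound (by simp) hm.aestronglyMeasurable B
      (Filter.Eventually.of_forall fun u => hB u y)
  refine (integrableOn_iff_integrable_of_support_subset fun u hu => ?_).1 h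
  exact abs_le.1 (hR u y hu)

theorem Nice.slice_measurable {X : Type*} [MeasurableSpace X] (hf : Nice f) (i : Fin m)
    (e : Fin 2) (r : ℕ) (σ : ℝ) {y : X → Off i → ℝ} {c : X → ℝ} (hy : Measurable y)
    (hc : Measurable c) : Measurable fun x => slice f i e r σ (y x) (c x) := by
  unfold slice
  refine (StronglyMeasurable.integral_prod_right' (ν := volume)
    (f := fun w : X × ℝ => slab f i e w.2 (y w.1) * hk r σ (w.2 - c w.1)) ?_).measurable
  refine Measurable.stronglyMeasurable (Measurable.mul ?_ ?_)
  · exact hf.slab_measurable i e measurable_snd (hy.comp measurable_fst)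
  · exact (hk_continuous r σ).measurable.comp (measurable_snd.sub (hc.comp measurable_fst))

theorem continuous_offKer (J : Matrix (Idx m) (Fin m) ℝ) (i : Fin m) (β : Idx m → ℕ)
    (s : Fin m → ℝ) :
    Continuous fun z : (Off i → ℝ) × (Fin m → ℝ) => offKer J i β s z.1 z.2 := by
  unfold offKer
  refine continuous_finsetProd _ fun κ _ => (hk_continuous _ _).comp ?_
  have h1 : Continuous fun z : (Off i → ℝ) × (Fin m → ℝ) => z.1 κ := by fun_prop
  have h2 : Continuous fun z : (Off i → ℝ) × (Fin m → ℝ) => (J *ᵥ z.2) κ :=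
    (continuous_apply κ.1).comp (Continuous.matrix_mulVec continuous_const continuous_snd)
  exact h1.sub h2

theorem tker_bdd (β : Idx m → ℕ) {s : Fin m → ℝ} (hs : ∀ h, 0 < s h) :
    ∃ B : ℝ, ∀ x, |tker β s x| ≤ B := by
  choose C hC using fun κ : Idx m => hk_bounded (β κ) (hs (base κ))
  refine ⟨∏ κ, C κ, fun x => ?_⟩
  rw [tker, Finset.abs_prod]
  exact Finset.prod_le_prod (fun _ _ => abs_nonneg _) fun κ _ => hC κ _

theorem Nice.integrable_glue (hf : Nice f) (J : Matrix (Idx m) (Fin m) ℝ) (i : Fin m)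
    (β : Idx m → ℕ) {s : Fin m → ℝ} (hs : ∀ h, 0 < s h) (p : Fin m → ℝ) :
    Integrable (fun z : (ℝ × ℝ) × (Off i → ℝ) =>
      (slab f i 0 z.1.1 z.2 * hk (β (Sum.inl i)) (s i) (z.1.1 - (J *ᵥ p) (Sum.inl i))) *
      (slab f i 1 z.1.2 z.2 * hk (β (Sum.inr i)) (s i) (z.1.2 - (J *ᵥ p) (Sum.inr i))) *
        offKer J i β s z.2 p) (volume.prod volume) := by
  obtain ⟨B, hB⟩ := tker_bdd β hs
  have hc : Continuous fun x => tker β s (x - J *ᵥ p) :=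
    (tker_continuous β s).comp (continuous_id.sub continuous_const)
  have h1 : Integrable fun x => pr f x * tker β s (x - J *ᵥ p) :=
    hf.pr_integrable.mul_bdd (c := B) hc.aestronglyMeasurable
      (Filter.Eventually.of_forall fun x => hB _)
  have h2 := (glue_measurePreserving i).integrable_comp_of_integrable h1
  refine h2.congr (Filter.Eventually.of_forall ?_)
  rintro ⟨⟨a, b⟩, y⟩
  simp only [Function.comp_apply, pr_glue, tker_glue]
  ring

theorem Nice.integral_glue (hf : Nice f) (J : Matrix (Idx m) (Fin m) ℝ) (i : Fin m)
    (β : Idx m → ℕ) {s : Fin m → ℝ} (hs : ∀ h, 0 < s h) (p : Fin m → ℝ) :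
    ∫ x, pr f x * tker β s (x - J *ᵥ p) = ∫ y, offKer J i β s y p *
      (slice f i 0 (β (Sum.inl i)) (s i) y ((J *ᵥ p) (Sum.inl i)) *
        slice f i 1 (β (Sum.inr i)) (s i) y ((J *ᵥ p) (Sum.inr i))) := by
  rw [← (glue_measurePreserving i).integral_comp (glue i).measurableEmbedding]
  have h := integral_prod_symm _ (hf.integrable_glue J i β hs p)
  refine Eq.trans (integral_congr_ae (Filter.Eventually.of_forall ?_)) (h.trans ?_)
  · rintro ⟨⟨a, b⟩, y⟩
    simp only [pr_glue, tker_glue]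
    ring
  · refine integral_congr_ae (Filter.Eventually.of_forall fun y => ?_)
    simp only
    rw [integral_mul_const, mul_comm]
    congr 1
    exact integral_prod_mul (μ := volume) (ν := volume)
      (fun a => slab f i 0 a y * hk (β (Sum.inl i)) (s i) (a - (J *ᵥ p) (Sum.inl i)))
      (fun b => slab f i 1 b y * hk (β (Sum.inr i)) (s i) (b - (J *ᵥ p) (Sum.inr i)))

theorem Nice.integrable_slice (hf : Nice f) (J : Matrix (Idx m) (Fin m) ℝ) (i : Fin m)
    (β : Idx m → ℕ) {s : Fin m → ℝ} (hs : ∀ h, 0 < s h) (p : Fin m → ℝ) :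
    Integrable fun y => offKer J i β s y p *
      (slice f i 0 (β (Sum.inl i)) (s i) y ((J *ᵥ p) (Sum.inl i)) *
        slice f i 1 (β (Sum.inr i)) (s i) y ((J *ᵥ p) (Sum.inr i))) := by
  refine (hf.integrable_glue J i β hs p).integral_prod_right.congr
    (Filter.Eventually.of_forall fun y => ?_)
  simp only
  rw [integral_mul_const, mul_comm]
  congr 1
  exact integral_prod_mul (μ := volume) (ν := volume)
    (fun a => slab f i 0 a y * hk (β (Sum.inl i)) (s i) (a - (J *ᵥ p) (Sum.inl i)))
    (fun b => slab f i 1 b y * hk (β (Sum.inr i)) (s i) (b - (J *ᵥ p) (Sum.inr i)))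

/-- Slicing the forms at position `i`. -/
theorem Nice.Frm_slice (hJ : Reg Δ J) (hf : Nice f) (i : Fin m) (β : Idx m → ℕ) {s : Fin m → ℝ}
    (hs : ∀ h, 0 < s h) : Frm J f β s = ∫ p, ∫ y, offKer J i β s y p *
      (slice f i 0 (β (Sum.inl i)) (s i) y ((J *ᵥ p) (Sum.inl i)) *
        slice f i 1 (β (Sum.inr i)) (s i) y ((J *ᵥ p) (Sum.inr i))) := by
  rw [Frm_eq_integral_prod hJ hf β hs]
  exact integral_congr_ae (Filter.Eventually.of_forall fun p => hf.integral_glue J i β hs p)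

/-- The rows at position `i` replaced by the row `J^e_i`. -/
def symJ (J : Matrix (Idx m) (Fin m) ℝ) (i : Fin m) (e : Fin 2) : Matrix (Idx m) (Fin m) ℝ :=
  Matrix.of fun κ k => J (if base κ = i then coor i e else κ) k

/-- The functions with corner value at `i` replaced by `e`. -/
def symf {α : Type*} (f : Corner m → α) (i : Fin m) (e : Fin 2) (j : Corner m) : α :=
  f (Function.update j i e)

/-- The square form obtained from the Cauchy–Schwarz inequality at position `i`. -/
def sqForm (J : Matrix (Idx m) (Fin m) ℝ) (f : Corner m → (Fin m → ℝ) → ℝ) (i : Fin m) (e : Fin 2)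
    (s : Fin m → ℝ) : ℝ≥0∞ :=
  ∫⁻ y, ∫⁻ p, ENNReal.ofReal (offKer J i 0 s y p) *
    ENNReal.ofReal (slice f i e 1 (s i) y ((J *ᵥ p) (coor i e)) ^ 2)

theorem symJ_mulVec_off (J : Matrix (Idx m) (Fin m) ℝ) (i : Fin m) (e : Fin 2) (p : Fin m → ℝ)
    {κ : Idx m} (h : ¬ base κ = i) : (symJ J i e *ᵥ p) κ = (J *ᵥ p) κ := by
  simp [symJ, Matrix.mulVec, dotProduct, h]

theorem symJ_mulVec_on (J : Matrix (Idx m) (Fin m) ℝ) (i : Fin m) (e : Fin 2) (p : Fin m → ℝ)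
    {κ : Idx m} (h : base κ = i) : (symJ J i e *ᵥ p) κ = (J *ᵥ p) (coor i e) := by
  simp [symJ, Matrix.mulVec, dotProduct, h]

theorem Amat_symJ (J : Matrix (Idx m) (Fin m) ℝ) (i : Fin m) (e : Fin 2) (j : Corner m) :
    Amat (symJ J i e) j = Amat J (Function.update j i e) := by
  ext h k
  simp only [Amat_apply, symJ, Matrix.of_apply, base_sel]
  by_cases hh : h = i
  · subst hh
    simp [sel_eq_coor]
  · rw [if_neg hh]
    congr 1
    exact sel_congr (by simp [hh])

theorem Reg.symJ (hJ : Reg Δ J) (i : Fin m) (e : Fin 2) : Reg Δ (symJ J i e) := fun j => by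
  rw [Amat_symJ]
  exact hJ _

theorem Nice.symf (hf : Nice f) (i : Fin m) (e : Fin 2) : Nice (symf f i e) := by
  obtain ⟨B, hB⟩ := hf.bdd
  obtain ⟨R, hR⟩ := hf.supp
  exact ⟨fun j => hf.meas _, ⟨B, fun j => hB _⟩, ⟨R, fun j => hR _⟩⟩

theorem slab_symf (f : Corner m → (Fin m → ℝ) → ℝ) (i : Fin m) (e e' : Fin 2) (u : ℝ)
    (y : Off i → ℝ) : slab (symf f i e) i e' u y = slab f i e u y := by
  refine Finset.prod_bij' (fun j _ => Function.update j i e) (fun j _ => Function.update j i e')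
    ?_ ?_ ?_ ?_ ?_
  · simp
  · simp
  · intro j hj
    simp [← (Finset.mem_filter.1 hj).2]
  · intro j hj
    simp [← (Finset.mem_filter.1 hj).2]
  · intro j _
    simp only [symf]
    congr 1
    funext h
    rw [proj_apply, proj_apply]
    by_cases hh : h = i
    · subst hh
      rw [sel_eq_coor, sel_eq_coor, glue_coor, glue_coor]
      have : ∀ e : Fin 2, ![u, u] e = u := fun e => by fin_cases e <;> rfl
      rw [this, this]
    · rw [sel_congr (show j h = Function.update j i e h by simp [hh])]

theorem offKer_symJ (J : Matrix (Idx m) (Fin m) ℝ) (i : Fin m) (e : Fin 2) (β : Idx m → ℕ)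
    (s : Fin m → ℝ) (y : Off i → ℝ) (p : Fin m → ℝ) :
    offKer (symJ J i e) i β s y p = offKer J i β s y p :=
  Finset.prod_congr rfl fun κ _ => by rw [symJ_mulVec_off J i e p κ.2]

theorem offKer_congr (J : Matrix (Idx m) (Fin m) ℝ) (i : Fin m) {β β' : Idx m → ℕ}
    (hβ : ∀ κ, ¬ base κ = i → β κ = β' κ) (s : Fin m → ℝ) (y : Off i → ℝ) (p : Fin m → ℝ) :
    offKer J i β s y p = offKer J i β' s y p :=
  Finset.prod_congr rfl fun κ _ => by rw [hβ κ κ.2]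

theorem pairIdx_off {i : Fin m} (κ : Idx m) (h : ¬ base κ = i) : pairIdx i κ = 0 := by
  have h1 : κ ≠ Sum.inl i := by rintro rfl; exact h rfl
  have h2 : κ ≠ Sum.inr i := by rintro rfl; exact h rfl
  simp [pairIdx, h1, h2]

theorem offKer_zero_nonneg (J : Matrix (Idx m) (Fin m) ℝ) (i : Fin m) {s : Fin m → ℝ}
    (hs : ∀ h, 0 < s h) (y : Off i → ℝ) (p : Fin m → ℝ) : 0 ≤ offKer J i 0 s y p :=
  Finset.prod_nonneg fun _ _ => hk_zero_nonneg (hs _) _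

theorem measurable_offKer_mul_slice (hf : Nice f) (J : Matrix (Idx m) (Fin m) ℝ) (i : Fin m)
    (e : Fin 2) (s : Fin m → ℝ) (r : ℕ) (σ : ℝ) :
    Measurable fun z : (Off i → ℝ) × (Fin m → ℝ) =>
      ENNReal.ofReal (offKer J i 0 s z.1 z.2) *
        ENNReal.ofReal (slice f i e r σ z.1 ((J *ᵥ z.2) (coor i e)) ^ 2) := by
  refine (continuous_offKer J i 0 s).measurable.ennreal_ofReal.mul
    (Measurable.ennreal_ofReal (Measurable.pow_const ?_ 2))
  have h2 : Continuous fun z : (Off i → ℝ) × (Fin m → ℝ) => (J *ᵥ z.2) (coor i e) :=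
    (continuous_apply (coor i e)).comp (Continuous.matrix_mulVec continuous_const continuous_snd)
  exact hf.slice_measurable i e r σ measurable_fst h2.measurable

theorem Nice.Frm_symf (hJ : Reg Δ J) (hf : Nice f) (i : Fin m) (e : Fin 2) {s : Fin m → ℝ}
    (hs : ∀ h, 0 < s h) : 0 ≤ Frm (symJ J i e) (SBL.symf f i e) (pairIdx i) s ∧
      ENNReal.ofReal (Frm (symJ J i e) (SBL.symf f i e) (pairIdx i) s) = sqForm J f i e s := by
  have hβ : pairIdx i (Sum.inl i) = 1 ∧ pairIdx i (Sum.inr i) = 1 := by simp [pairIdx]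
  have hInt : ∀ p y, offKer (symJ J i e) i (pairIdx i) s y p *
      (slice (SBL.symf f i e) i 0 (pairIdx i (Sum.inl i)) (s i) y
          ((symJ J i e *ᵥ p) (Sum.inl i)) *
        slice (SBL.symf f i e) i 1 (pairIdx i (Sum.inr i)) (s i) y
          ((symJ J i e *ᵥ p) (Sum.inr i))) =
      offKer J i 0 s y p * slice f i e 1 (s i) y ((J *ᵥ p) (coor i e)) ^ 2 := by
    intro p y
    rw [offKer_symJ, offKer_congr J i (β' := 0) pairIdx_off, hβ.1, hβ.2,
      symJ_mulVec_on J i e p rfl, symJ_mulVec_on J i e p rfl, sq]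
    simp only [slice, slab_symf]
  have hnn : ∀ p y, 0 ≤ offKer J i 0 s y p * slice f i e 1 (s i) y ((J *ᵥ p) (coor i e)) ^ 2 :=
    fun p y => mul_nonneg (offKer_zero_nonneg J i hs y p) (sq_nonneg _)
  have hy := fun p => (hf.symf i e).integrable_slice (symJ J i e) i (pairIdx i) hs p
  have hp := (Nice.integrable_prod (hJ.symJ i e) (hf.symf i e) (pairIdx i) hs).integral_prod_right
  simp only [(hf.symf i e).integral_glue (symJ J i e) i (pairIdx i) hs] at hp
  rw [(hf.symf i e).Frm_slice (hJ.symJ i e) i _ hs]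
  simp only [hInt] at hy hp ⊢
  refine ⟨integral_nonneg fun p => integral_nonneg fun y => hnn p y, ?_⟩
  rw [ofReal_integral_eq_lintegral_ofReal hp
    (Filter.Eventually.of_forall fun p => integral_nonneg fun y => hnn p y)]
  have h3 : ∀ p, ENNReal.ofReal (∫ y, offKer J i 0 s y p *
      slice f i e 1 (s i) y ((J *ᵥ p) (coor i e)) ^ 2) =
      ∫⁻ y, ENNReal.ofReal (offKer J i 0 s y p) *
        ENNReal.ofReal (slice f i e 1 (s i) y ((J *ᵥ p) (coor i e)) ^ 2) := fun p => by
    rw [ofReal_integral_eq_lintegral_ofReal (hy p)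
      (Filter.Eventually.of_forall fun y => hnn p y)]
    simp only [ENNReal.ofReal_mul (offKer_zero_nonneg J i hs _ _)]
  simp only [h3]
  rw [sqForm]
  exact lintegral_lintegral_swap (((measurable_offKer_mul_slice hf J i e s 1 (s i)).comp
    measurable_swap).aemeasurable)

end

theorem lintegral_hk_zero_le {s : ℝ} (hs : 0 < s) :
    ∫⁻ v, ENNReal.ofReal (hk 0 s v) ≤ ENNReal.ofReal (Real.sqrt 2) := by
  rw [← lintegral_gauss_half hs]
  refine lintegral_mono fun v => ENNReal.ofReal_le_ofReal ?_
  rw [hk_zero]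
  gcongr
  linarith [Real.pi_pos]

/-- The weighted Cauchy–Schwarz inequality. -/
theorem lintegral_mul_sq_le {X : Type*} [MeasurableSpace X] (μ : Measure X) {w g : X → ℝ≥0∞}
    (hw : Measurable w) (hg : Measurable g) :
    (∫⁻ x, w x * g x ∂μ) ^ 2 ≤ (∫⁻ x, w x ∂μ) * ∫⁻ x, w x * g x ^ 2 ∂μ := by
  have h := ENNReal.lintegral_mul_le_Lp_mul_Lq μ Real.HolderConjugate.two_two
    (f := fun x => w x ^ (1 / 2 : ℝ)) (g := fun x => w x ^ (1 / 2 : ℝ) * g x)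
    (hw.pow_const _).aemeasurable ((hw.pow_const _).mul hg).aemeasurable
  have hsq : ∀ a : ℝ≥0∞, (a ^ (1 / 2 : ℝ)) ^ (2 : ℝ) = a := fun a => by
    rw [← ENNReal.rpow_mul]; norm_num
  have hmul : ∀ a : ℝ≥0∞, a ^ (1 / 2 : ℝ) * a ^ (1 / 2 : ℝ) = a := fun a => by
    rw [← sq, ← ENNReal.rpow_natCast]; exact_mod_cast hsq a
  simp only [Pi.mul_apply, ← mul_assoc, hmul, hsq, ENNReal.mul_rpow_of_nonneg _ _ zero_le_two] at h
  have h2 := pow_le_pow_left' h 2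
  refine h2.trans_eq ?_
  rw [mul_pow, ← ENNReal.rpow_natCast, ← ENNReal.rpow_natCast]
  simp only [Nat.cast_ofNat, hsq]
  congr 1
  simp only [← ENNReal.rpow_natCast, Nat.cast_ofNat]

section

variable {m : ℕ} {Δ : ℝ} {J : Matrix (Idx m) (Fin m) ℝ} {f : Corner m → (Fin m → ℝ) → ℝ}

theorem Nice.slice_succ (hf : Nice f) (i : Fin m) (e : Fin 2) (r : ℕ) {σ : ℝ} (hσ : 0 < σ)
    (y : Off i → ℝ) (c : ℝ) : slice f i e (1 + r) σ y c = Real.sqrt 2 ^ (1 + r) *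
      ∫ v, hk r (σ / Real.sqrt 2) v * slice f i e 1 (σ / Real.sqrt 2) y (c + v) := by
  have hσ' : 0 < σ / Real.sqrt 2 := by positivity
  obtain ⟨B, hB⟩ := hk_bounded 1 hσ'
  have hInt : Integrable (fun z : ℝ × ℝ => slab f i e z.1 y * hk r (σ / Real.sqrt 2) z.2 *
      hk 1 (σ / Real.sqrt 2) (z.1 - (c + z.2))) (volume.prod volume) := by
    refine ((hf.slab_integrable i e y).mul_prod (hk_integrable r hσ')).mul_bdd (c := B) ?_
      (Filter.Eventually.of_forall fun z => hB _)
    exact Continuous.aestronglyMeasurable ((hk_continuous _ _).comp (by fun_prop))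
  have h := integral_integral_swap (f := fun u v => slab f i e u y * hk r (σ / Real.sqrt 2) v *
      hk 1 (σ / Real.sqrt 2) (u - (c + v))) hInt
  unfold slice
  calc ∫ u, slab f i e u y * hk (1 + r) σ (u - c)
      = ∫ u, Real.sqrt 2 ^ (1 + r) * ∫ v, slab f i e u y * hk r (σ / Real.sqrt 2) v *
          hk 1 (σ / Real.sqrt 2) (u - (c + v)) := by
        refine integral_congr_ae (Filter.Eventually.of_forall fun u => ?_)
        simp only
        rw [hk_conv 1 r hσ, mul_left_comm, ← integral_const_mul]
        simp only [sub_sub, mul_assoc]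
    _ = _ := by
        rw [integral_const_mul, h]
        congr 1
        refine integral_congr_ae (Filter.Eventually.of_forall fun v => ?_)
        simp only
        rw [← integral_const_mul]
        congr 1
        funext u
        ring

theorem slice_sq_le (r : ℕ) : ∃ C : ℝ, 0 < C ∧ ∀ {m : ℕ} {f : Corner m → (Fin m → ℝ) → ℝ},
    Nice f → ∀ (i : Fin m) (e : Fin 2) {σ : ℝ}, 0 < σ → ∀ (y : Off i → ℝ) (c : ℝ),
      ENNReal.ofReal (slice f i e (1 + r) σ y c ^ 2) ≤ ENNReal.ofReal C *
        ∫⁻ v, ENNReal.ofReal (hk 0 σ v) *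
          ENNReal.ofReal (slice f i e 1 (σ / Real.sqrt 2) y (c + v) ^ 2) := by
  obtain ⟨C, hC, h⟩ := hk_le_hk_zero r
  refine ⟨(Real.sqrt 2 ^ (1 + r) * C) ^ 2 * Real.sqrt 2, by positivity, ?_⟩
  intro m f hf i e σ hσ y c
  have hσ' : 0 < σ / Real.sqrt 2 := by positivity
  have hk' : ∀ v, |hk r (σ / Real.sqrt 2) v| ≤ C * hk 0 σ v := fun v => by
    have := h _ hσ' v
    rwa [mul_div_cancel₀ _ (by positivity)] at this
  have hsq : ∀ x : ℝ, ENNReal.ofReal (x ^ 2) = ‖x‖ₑ ^ 2 := fun x => by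
    rw [Real.enorm_eq_ofReal_abs, ← ENNReal.ofReal_pow (abs_nonneg _), sq_abs]
  have hmeas : Measurable fun v => ‖slice f i e 1 (σ / Real.sqrt 2) y (c + v)‖ₑ :=
    (hf.slice_measurable i e 1 _ measurable_const (measurable_id.const_add c)).enorm
  have hb : ‖slice f i e (1 + r) σ y c‖ₑ ≤ ENNReal.ofReal (Real.sqrt 2 ^ (1 + r) * C) *
      ∫⁻ v, ENNReal.ofReal (hk 0 σ v) * ‖slice f i e 1 (σ / Real.sqrt 2) y (c + v)‖ₑ := by
    rw [hf.slice_succ i e r hσ, enorm_mul, Real.enorm_of_nonneg (by positivity),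
      ENNReal.ofReal_mul (by positivity), mul_assoc]
    refine mul_le_mul_right ((enorm_integral_le_lintegral_enorm _).trans ?_) _
    rw [← lintegral_const_mul' _ _ ENNReal.ofReal_ne_top]
    refine lintegral_mono fun v => ?_
    rw [enorm_mul, ← mul_assoc, ← ENNReal.ofReal_mul hC.le, Real.enorm_eq_ofReal_abs (hk r _ v)]
    exact mul_le_mul_left (ENNReal.ofReal_le_ofReal (hk' v)) _
  rw [hsq]
  simp only [hsq]
  refine (pow_le_pow_left' hb 2).trans ?_
  rw [mul_pow, ← ENNReal.ofReal_pow (by positivity),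
    ENNReal.ofReal_mul (p := (Real.sqrt 2 ^ (1 + r) * C) ^ 2) (by positivity), mul_assoc]
  refine mul_le_mul_right ((lintegral_mul_sq_le volume
    (hk_continuous 0 σ).measurable.ennreal_ofReal hmeas).trans ?_) _
  exact mul_le_mul_left (lintegral_hk_zero_le hσ) _

theorem hk_zero_shift_le {θ B s Q : ℝ} (hθ : 0 < θ) (hθ1 : θ ≤ 1) (hs : 0 < s) (hQ : |Q| ≤ B)
    (x v : ℝ) : hk 0 (Real.sqrt 2 * s) (x + v * Q) ≤ 2 / Real.sqrt θ *
      (hk 0 (2 / Real.sqrt θ * s) x * Real.exp (Real.pi * θ * B ^ 2 / 2 * (v / s) ^ 2)) := by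
  have hθs : 0 < Real.sqrt θ := Real.sqrt_pos.2 hθ
  have h2 : (1 : ℝ) ≤ Real.sqrt 2 := by
    rw [Real.one_le_sqrt]; norm_num
  have hQ2 : Q ^ 2 ≤ B ^ 2 := sq_le_sq' (neg_le_of_abs_le hQ) (le_of_abs_le hQ)
  rw [hk_zero, hk_zero, mul_assoc _ (Real.exp _), ← Real.exp_add, ← mul_assoc]
  have h1 : (Real.sqrt 2 * s)⁻¹ ≤ 2 / Real.sqrt θ * (2 / Real.sqrt θ * s)⁻¹ := by
    have : 2 / Real.sqrt θ * (2 / Real.sqrt θ * s)⁻¹ = s⁻¹ := by field_simp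
    rw [this]
    gcongr
    nlinarith
  refine mul_le_mul h1 (Real.exp_le_exp.2 ?_) (Real.exp_pos _).le (by positivity)
  have e1 : ((x + v * Q) / (Real.sqrt 2 * s)) ^ 2 = (x + v * Q) ^ 2 / (2 * s ^ 2) := by
    rw [div_pow, mul_pow, Real.sq_sqrt (by norm_num)]
  have e2 : (x / (2 / Real.sqrt θ * s)) ^ 2 = θ * x ^ 2 / (4 * s ^ 2) := by
    rw [div_pow, mul_pow, div_pow, Real.sq_sqrt hθ.le]
    field_simp
    norm_num
  rw [e1, e2, div_pow]
  have h3 : θ * (x ^ 2 / 2 - v ^ 2 * B ^ 2) ≤ (x + v * Q) ^ 2 := by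
    have h4 : x ^ 2 / 2 - v ^ 2 * B ^ 2 ≤ (x + v * Q) ^ 2 := by
      nlinarith [sq_nonneg (x + 2 * v * Q), mul_le_mul_of_nonneg_left hQ2 (sq_nonneg v)]
    rcases le_total 0 (x ^ 2 / 2 - v ^ 2 * B ^ 2) with h0 | h0
    · nlinarith
    · exact (mul_nonpos_of_nonneg_of_nonpos hθ.le h0).trans (sq_nonneg _)
  have h5 : Real.pi / (2 * s ^ 2) * (θ * (x ^ 2 / 2 - v ^ 2 * B ^ 2)) ≤
      Real.pi / (2 * s ^ 2) * (x + v * Q) ^ 2 := mul_le_mul_of_nonneg_left h3 (by positivity)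
  have e3 : Real.pi / (2 * s ^ 2) * (θ * (x ^ 2 / 2 - v ^ 2 * B ^ 2)) =
      Real.pi * (θ * x ^ 2 / (4 * s ^ 2)) - Real.pi * θ * B ^ 2 / 2 * (v ^ 2 / s ^ 2) := by
    field_simp
    ring
  have e4 : Real.pi / (2 * s ^ 2) * (x + v * Q) ^ 2 =
      Real.pi * ((x + v * Q) ^ 2 / (2 * s ^ 2)) := by
    field_simp
  rw [e3, e4] at h5
  linarith

end

section

variable {m : ℕ} {Δ : ℝ} {J : Matrix (Idx m) (Fin m) ℝ} {f : Corner m → (Fin m → ℝ) → ℝ}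

/-- The scales enlarged by `√2` at the positions off `L`. -/
def wideScale (L : Finset (Fin m)) (s : Fin m → ℝ) (h : Fin m) : ℝ :=
  if h ∈ L then s h else Real.sqrt 2 * s h

/-- The scales after the Cauchy–Schwarz inequality at position `i`. -/
def csScale (M : ℝ) (L : Finset (Fin m)) (i : Fin m) (s : Fin m → ℝ) (h : Fin m) : ℝ :=
  if h ∈ L then s h else if h = i then s h / Real.sqrt 2 else M * s h

theorem wideScale_pos {L : Finset (Fin m)} {s : Fin m → ℝ} (hs : ∀ h, 0 < s h) (h : Fin m) :
    0 < wideScale L s h := by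
  have := hs h
  unfold wideScale
  split_ifs <;> positivity

theorem csScale_pos {M : ℝ} (hM : 0 < M) {L : Finset (Fin m)} {i : Fin m} {s : Fin m → ℝ}
    (hs : ∀ h, 0 < s h) (h : Fin m) : 0 < csScale M L i s h := by
  have := hs h
  unfold csScale
  split_ifs <;> positivity

/-- A direction in which only the selected coordinate at position `i` moves among those of one
corner, and no coordinate at a position in `L` moves. -/
theorem exists_shift (hJ : Reg Δ J) {L : Finset (Fin m)} (hsym : SymRows L J) {i : Fin m}
    (hi : i ∉ L) (e : Fin 2) {B : ℝ} (hB : 1 ≤ B) (hN : ∀ j i k, |Nm J j i k| ≤ B) :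
    ∃ q : Fin m → ℝ, (J *ᵥ q) (coor i e) = 1 ∧ (∀ κ, |(J *ᵥ q) κ| ≤ B) ∧
      ∀ κ, base κ ∈ L → (J *ᵥ q) κ = 0 := by
  set j : Corner m := fun _ => e
  set q : Fin m → ℝ := (Amat J j)⁻¹ *ᵥ Pi.single i 1 with hq
  have h1 : ∀ h, (J *ᵥ q) (sel j h) = if h = i then 1 else 0 := fun h => by
    rw [mulVec_sel, hq, Matrix.mulVec_mulVec, Matrix.mul_nonsing_inv _ (hJ.isUnit j),
      Matrix.one_mulVec, Pi.single_apply]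
  have h2 : ∀ h, (J *ᵥ q) (sel (opp j) h) = Nm J j h i := fun h => by
    rw [mulVec_sel, hq, Matrix.mulVec_mulVec, ← Nm, Matrix.mulVec_single_one]
    rfl
  refine ⟨q, by rw [show coor i e = sel j i from rfl, h1, if_pos rfl], fun κ => ?_, fun κ => ?_⟩
  · obtain ⟨h | h, rfl⟩ := (selEquiv j).surjective κ
    · change |(J *ᵥ q) (sel j h)| ≤ B
      rw [h1]
      split_ifs <;> simp <;> linarith
    · change |(J *ᵥ q) (sel (opp j) h)| ≤ B
      rw [h2]
      exact hN _ _ _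
  · obtain ⟨h | h, rfl⟩ := (selEquiv j).surjective κ
    · change base (sel j h) ∈ L → (J *ᵥ q) (sel j h) = 0
      rw [base_sel, h1]
      intro hh
      rw [if_neg (by rintro rfl; exact hi hh)]
    · change base (sel (opp j) h) ∈ L → (J *ᵥ q) (sel (opp j) h) = 0
      rw [base_sel, h2]
      intro hh
      rw [Nm_row_sym hJ hsym j hh, if_neg (by rintro rfl; exact hi hh)]

theorem card_off_le (i : Fin m) : (Fintype.card (Off i) : ℝ) ≤ 2 * m := by
  have h : Fintype.card (Off i) ≤ Fintype.card (Idx m) := Fintype.card_subtype_le _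
  have h2 : Fintype.card (Idx m) = 2 * m := by simp [Idx, two_mul]
  rw [h2] at h
  exact_mod_cast h

theorem offKer_shift_le {B θ : ℝ} (hθ : 0 < θ) (hθ1 : θ ≤ 1) (hB : 1 ≤ B)
    (hm : 2 * m * θ * B ^ 2 ≤ 1) {L : Finset (Fin m)}
    (i : Fin m) {s : Fin m → ℝ} {s₀ : ℝ} (hs : ∀ h, 0 < s h) (hs₀ : ∀ h ∉ L, s h = s₀)
    (hs₀' : 0 < s₀) {q : Fin m → ℝ} (hq : ∀ κ, |(J *ᵥ q) κ| ≤ B)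
    (hqL : ∀ κ, base κ ∈ L → (J *ᵥ q) κ = 0) (y : Off i → ℝ) (p : Fin m → ℝ) (v : ℝ) :
    offKer J i 0 (wideScale L s) y (p - v • q) ≤ (2 / Real.sqrt θ) ^ (2 * m) *
      (offKer J i 0 (csScale (2 / Real.sqrt θ) L i s) y p *
        Real.exp (Real.pi / 2 * (v / s₀) ^ 2)) := by
  have hθs : 0 < Real.sqrt θ := Real.sqrt_pos.2 hθ
  have hM : 1 ≤ 2 / Real.sqrt θ := by
    rw [le_div_iff₀ hθs]
    have : Real.sqrt θ ≤ 1 := Real.sqrt_le_one.2 hθ1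
    linarith
  set M := 2 / Real.sqrt θ
  set a := Real.pi * θ * B ^ 2 / 2 * (v / s₀) ^ 2 with ha
  have ha0 : 0 ≤ a := by positivity
  have hκ : ∀ κ : Off i, hk 0 (wideScale L s (base κ.1)) (y κ - (J *ᵥ (p - v • q)) κ) ≤
      M * (hk 0 (csScale M L i s (base κ.1)) (y κ - (J *ᵥ p) κ) * Real.exp a) := by
    intro κ
    have e1 : y κ - (J *ᵥ (p - v • q)) κ = (y κ - (J *ᵥ p) κ) + v * (J *ᵥ q) κ := by
      rw [Matrix.mulVec_sub, Matrix.mulVec_smul]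
      simp only [Pi.sub_apply, Pi.smul_apply, smul_eq_mul]
      ring
    rw [e1]
    by_cases hL : base κ.1 ∈ L
    · rw [hqL κ hL, mul_zero, add_zero, wideScale, csScale, if_pos hL, if_pos hL]
      have h0 := hk_zero_nonneg (hs (base κ.1)) (y κ - (J *ᵥ p) κ)
      have h1 : 1 ≤ Real.exp a := Real.one_le_exp ha0
      nlinarith [mul_le_mul_of_nonneg_left h1 h0, mul_nonneg h0 (Real.exp_pos a).le]
    · rw [wideScale, csScale, if_neg hL, if_neg hL, if_neg κ.2, hs₀ _ hL]
      exact hk_zero_shift_le hθ hθ1 hs₀' (hq κ) _ v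
  refine (Finset.prod_le_prod (fun κ _ => hk_zero_nonneg (wideScale_pos hs _) _)
    fun κ _ => hκ κ).trans ?_
  rw [Finset.prod_mul_distrib, Finset.prod_mul_distrib, Finset.prod_const, Finset.prod_const,
    ← Real.exp_nat_mul]
  have hcard := card_off_le i
  have hcard' : Fintype.card (Off i) ≤ 2 * m := by exact_mod_cast hcard
  rw [Finset.card_univ]
  have h0 := offKer_zero_nonneg J i (csScale_pos (M := M) (L := L) (i := i) (by positivity) hs) y p
  refine mul_le_mul (pow_le_pow_right₀ hM hcard') (mul_le_mul_of_nonneg_left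
    (Real.exp_le_exp.2 ?_) h0) (mul_nonneg h0 (Real.exp_pos _).le) (by positivity)
  calc (Fintype.card (Off i) : ℝ) * a ≤ 2 * m * a := by gcongr
    _ = 2 * m * θ * B ^ 2 * (Real.pi / 2 * (v / s₀) ^ 2) := by rw [ha]; ring
    _ ≤ 1 * (Real.pi / 2 * (v / s₀) ^ 2) := by gcongr
    _ = _ := one_mul _

theorem lintegral_offKer_shift_le {B θ : ℝ} (hθ : 0 < θ) (hθ1 : θ ≤ 1) (hB : 1 ≤ B)
    (hm : 2 * m * θ * B ^ 2 ≤ 1) {L : Finset (Fin m)}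
    (i : Fin m) {s : Fin m → ℝ} {s₀ : ℝ} (hs : ∀ h, 0 < s h) (hs₀ : ∀ h ∉ L, s h = s₀)
    (hs₀' : 0 < s₀) {q : Fin m → ℝ} (hq : ∀ κ, |(J *ᵥ q) κ| ≤ B)
    (hqL : ∀ κ, base κ ∈ L → (J *ᵥ q) κ = 0) (y : Off i → ℝ) (p : Fin m → ℝ) :
    ∫⁻ v, ENNReal.ofReal (hk 0 s₀ v) *
        ENNReal.ofReal (offKer J i 0 (wideScale L s) y (p - v • q)) ≤
      ENNReal.ofReal ((2 / Real.sqrt θ) ^ (2 * m) * Real.sqrt 2) *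
        ENNReal.ofReal (offKer J i 0 (csScale (2 / Real.sqrt θ) L i s) y p) := by
  set M := 2 / Real.sqrt θ
  have hθs : 0 < Real.sqrt θ := Real.sqrt_pos.2 hθ
  have hM : 0 < M := by positivity
  have h0 := offKer_zero_nonneg J i (csScale_pos (M := M) (L := L) (i := i) hM hs) y p
  have h1 : ∀ v, ENNReal.ofReal (hk 0 s₀ v) *
      ENNReal.ofReal (offKer J i 0 (wideScale L s) y (p - v • q)) ≤
      ENNReal.ofReal (M ^ (2 * m) * offKer J i 0 (csScale M L i s) y p) *
        ENNReal.ofReal (s₀⁻¹ * Real.exp (-(Real.pi / 2) * (v / s₀) ^ 2)) := by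
    intro v
    rw [← ENNReal.ofReal_mul (hk_zero_nonneg hs₀' v), ← ENNReal.ofReal_mul (by positivity)]
    refine ENNReal.ofReal_le_ofReal ((mul_le_mul_of_nonneg_left
      (offKer_shift_le hθ hθ1 hB hm i hs hs₀ hs₀' hq hqL y p v)
      (hk_zero_nonneg hs₀' v)).trans (le_of_eq ?_))
    rw [hk_zero]
    have : Real.exp (-(Real.pi / 2) * (v / s₀) ^ 2) = Real.exp (-Real.pi * (v / s₀) ^ 2) *
        Real.exp (Real.pi / 2 * (v / s₀) ^ 2) := by
      rw [← Real.exp_add]; ring_nf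
    rw [this]
    ring
  refine (lintegral_mono h1).trans (le_of_eq ?_)
  rw [lintegral_const_mul' _ _ ENNReal.ofReal_ne_top, lintegral_gauss_half hs₀',
    ← ENNReal.ofReal_mul (by positivity), ← ENNReal.ofReal_mul (by positivity)]
  ring_nf

end

theorem lintegral_shift_swap {ι : Type*} [Fintype ι] {W : (ι → ℝ) → ℝ≥0∞} {H k : ℝ → ℝ≥0∞}
    {l : (ι → ℝ) → ℝ} (hW : Measurable W) (hH : Measurable H) (hk : Measurable k)
    (hl : Measurable l) {q : ι → ℝ} (hq : ∀ p v, l (p - v • q) = l p - v) :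
    ∫⁻ p, W p * ∫⁻ v, k v * H (l p + v) = ∫⁻ p, (∫⁻ v, k v * W (p - v • q)) * H (l p) := by
  have m1 : Measurable fun z : (ι → ℝ) × ℝ => W z.1 * (k z.2 * H (l z.1 + z.2)) :=
    (hW.comp measurable_fst).mul ((hk.comp measurable_snd).mul
      (hH.comp ((hl.comp measurable_fst).add measurable_snd)))
  have m2 : Measurable fun z : ℝ × (ι → ℝ) => W (z.2 - z.1 • q) * (k z.1 * H (l z.2)) :=
    (hW.comp (measurable_snd.sub (measurable_fst.smul_const q))).mul
      ((hk.comp measurable_fst).mul (hH.comp (hl.comp measurable_snd)))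
  calc ∫⁻ p, W p * ∫⁻ v, k v * H (l p + v)
      = ∫⁻ p, ∫⁻ v, W p * (k v * H (l p + v)) := by
        refine lintegral_congr fun p => ?_
        rw [lintegral_const_mul]
        exact hk.mul (hH.comp (measurable_id.const_add _))
    _ = ∫⁻ v, ∫⁻ p, W p * (k v * H (l p + v)) := lintegral_lintegral_swap m1.aemeasurable
    _ = ∫⁻ v, ∫⁻ p, W (p - v • q) * (k v * H (l p)) := by
        refine lintegral_congr fun v => ?_
        rw [← lintegral_sub_right_eq_self _ (v • q)]
        simp only [hq, sub_add_cancel]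
    _ = ∫⁻ p, ∫⁻ v, W (p - v • q) * (k v * H (l p)) := lintegral_lintegral_swap m2.aemeasurable
    _ = _ := by
        refine lintegral_congr fun p => ?_
        rw [← lintegral_mul_const]
        · refine lintegral_congr fun v => ?_
          ring
        · exact hk.mul (hW.comp (measurable_const.sub (measurable_id.smul_const q)))

theorem offKer_abs_le {m : ℕ} (β : Idx m → ℕ) : ∃ C : ℝ, 0 < C ∧
    ∀ (J : Matrix (Idx m) (Fin m) ℝ) (L : Finset (Fin m)) (i : Fin m) (s : Fin m → ℝ),
      (∀ h, 0 < s h) → (∀ κ, base κ ∈ L → β κ = 0) → ∀ y p,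
        |offKer J i β s y p| ≤ C * offKer J i 0 (wideScale L s) y p := by
  choose C hC h using hk_le_hk_zero
  set C' : ℝ := 1 + ∑ κ, C (β κ)
  have hC1 : ∀ κ, C (β κ) ≤ C' := fun κ => by
    have := Finset.single_le_sum (f := fun κ => C (β κ)) (fun κ _ => (hC (β κ)).le)
      (Finset.mem_univ κ)
    simp only [C']
    linarith
  have hC2 : 1 ≤ C' := by
    have := Finset.sum_nonneg (s := Finset.univ) fun κ _ => (hC (β κ)).le
    simp only [C']
    linarith
  have hC0 : 0 < C' := by linarith
  refine ⟨C' ^ (2 * m), by positivity, fun J L i s hs hβ y p => ?_⟩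
  rw [offKer, Finset.abs_prod]
  have hκ : ∀ κ : Off i, |hk (β κ) (s (base κ.1)) (y κ - (J *ᵥ p) κ)| ≤
      C' * hk 0 (wideScale L s (base κ.1)) (y κ - (J *ᵥ p) κ) := by
    intro κ
    by_cases hL : base κ.1 ∈ L
    · have h0 := hk_zero_nonneg (hs (base κ.1)) (y κ - (J *ᵥ p) κ)
      rw [hβ _ hL, wideScale, if_pos hL, abs_of_nonneg h0]
      nlinarith
    · rw [wideScale, if_neg hL]
      have h0 := hk_zero_nonneg (mul_pos (Real.sqrt_pos.2 two_pos) (hs (base κ.1)))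
        (y κ - (J *ᵥ p) κ)
      exact (h _ _ (hs _) _).trans (mul_le_mul_of_nonneg_right (hC1 _) h0)
  refine (Finset.prod_le_prod (fun _ _ => abs_nonneg _) fun κ _ => hκ κ).trans ?_
  rw [Finset.prod_mul_distrib, Finset.prod_const, Finset.card_univ]
  have hcard : Fintype.card (Off i) ≤ 2 * m := by exact_mod_cast card_off_le i
  exact mul_le_mul_of_nonneg_right (pow_le_pow_right₀ hC2 hcard)
    (offKer_zero_nonneg J i (wideScale_pos hs) y p)

section

variable {m : ℕ} {Δ : ℝ} {J : Matrix (Idx m) (Fin m) ℝ} {f : Corner m → (Fin m → ℝ) → ℝ}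

theorem lintegral_offKer_slice_le (m : ℕ) (hm : 0 < m) {Δ : ℝ} (hΔ : 1 ≤ Δ) : ∃ M : ℝ, 1 ≤ M ∧
    ∀ r : ℕ, ∃ C : ℝ, 0 < C ∧ ∀ (L : Finset (Fin m)) (J : Matrix (Idx m) (Fin m) ℝ)
      (f : Corner m → (Fin m → ℝ) → ℝ), Reg Δ J → SymRows L J → Nice f → ∀ i ∉ L,
      ∀ (e : Fin 2) (s : Fin m → ℝ), (∀ h, 0 < s h) → (∀ h ∉ L, s h = s i) → ∀ y : Off i → ℝ,
        ∫⁻ p, ENNReal.ofReal (offKer J i 0 (wideScale L s) y p) *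
          ENNReal.ofReal (slice f i e (1 + r) (s i) y ((J *ᵥ p) (coor i e)) ^ 2) ≤
        ENNReal.ofReal C * ∫⁻ p, ENNReal.ofReal (offKer J i 0 (csScale M L i s) y p) *
          ENNReal.ofReal (slice f i e 1 (csScale M L i s i) y ((J *ᵥ p) (coor i e)) ^ 2) := by
  obtain ⟨B, hB, hN⟩ := Nm_bound m Δ hΔ
  have hm' : (1 : ℝ) ≤ m := by exact_mod_cast hm
  set θ : ℝ := 1 / (2 * m * B ^ 2) with hθd
  have hθ : 0 < θ := by positivity
  have hB2 : 1 ≤ B ^ 2 := one_le_pow₀ hB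
  have hθ1 : θ ≤ 1 := by
    rw [hθd, div_le_one (by positivity)]
    nlinarith
  have hmθ : 2 * m * θ * B ^ 2 ≤ 1 := by
    rw [hθd]
    apply le_of_eq
    field_simp
  have hθs : 0 < Real.sqrt θ := Real.sqrt_pos.2 hθ
  refine ⟨2 / Real.sqrt θ, ?_, fun r => ?_⟩
  · rw [le_div_iff₀ hθs]
    have : Real.sqrt θ ≤ 1 := Real.sqrt_le_one.2 hθ1
    linarith
  obtain ⟨C, hC, hsq⟩ := slice_sq_le r
  refine ⟨C * ((2 / Real.sqrt θ) ^ (2 * m) * Real.sqrt 2), by positivity, ?_⟩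
  intro L J f hJ hsym hf i hi e s hs hs₀ y
  obtain ⟨q, hq1, hqB, hqL⟩ := exists_shift hJ hsym hi e hB (hN J hJ)
  have hcs : csScale (2 / Real.sqrt θ) L i s i = s i / Real.sqrt 2 := by
    rw [csScale, if_neg hi, if_pos rfl]
  rw [hcs]
  set W : (Fin m → ℝ) → ℝ≥0∞ := fun p => ENNReal.ofReal (offKer J i 0 (wideScale L s) y p)
  set H : ℝ → ℝ≥0∞ := fun c => ENNReal.ofReal (slice f i e 1 (s i / Real.sqrt 2) y c ^ 2)
  set l : (Fin m → ℝ) → ℝ := fun p => (J *ᵥ p) (coor i e)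
  have hWm : Measurable W := by
    have h : Continuous fun p : Fin m → ℝ => (y, p) := by fun_prop
    exact ((continuous_offKer J i 0 (wideScale L s)).comp h).measurable.ennreal_ofReal
  have hHm : Measurable H :=
    ((hf.slice_measurable i e 1 _ measurable_const measurable_id).pow_const 2).ennreal_ofReal
  have hlm : Measurable l := by
    have h : Continuous l := (continuous_apply (coor i e)).comp
      (Continuous.matrix_mulVec continuous_const continuous_id)
    exact h.measurable
  have hl : ∀ p v, l (p - v • q) = l p - v := fun p v => by
    simp only [l]
    rw [Matrix.mulVec_sub, Matrix.mulVec_smul, Pi.sub_apply, Pi.smul_apply, hq1, smul_eq_mul,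
      mul_one]
  calc ∫⁻ p, W p * ENNReal.ofReal (slice f i e (1 + r) (s i) y (l p) ^ 2)
      ≤ ∫⁻ p, ENNReal.ofReal C * (W p * ∫⁻ v, ENNReal.ofReal (hk 0 (s i) v) * H (l p + v)) := by
        refine lintegral_mono fun p => ?_
        rw [mul_left_comm]
        exact mul_le_mul_right (hsq hf i e (hs i) y (l p)) _
    _ = ENNReal.ofReal C * ∫⁻ p, (∫⁻ v, ENNReal.ofReal (hk 0 (s i) v) * W (p - v • q)) *
          H (l p) := by
        rw [lintegral_const_mul' _ _ ENNReal.ofReal_ne_top, lintegral_shift_swap hWm hHm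
          (hk_continuous 0 (s i)).measurable.ennreal_ofReal hlm hl]
    _ ≤ ENNReal.ofReal C * ∫⁻ p, ENNReal.ofReal ((2 / Real.sqrt θ) ^ (2 * m) * Real.sqrt 2) *
          (ENNReal.ofReal (offKer J i 0 (csScale (2 / Real.sqrt θ) L i s) y p) * H (l p)) := by
        refine mul_le_mul_right (lintegral_mono fun p => ?_) _
        rw [← mul_assoc]
        exact mul_le_mul_left (lintegral_offKer_shift_le hθ hθ1 hB hmθ i hs hs₀ (hs i) hqB hqL y p)
          _
    _ = _ := by
        rw [lintegral_const_mul' _ _ ENNReal.ofReal_ne_top, ← mul_assoc,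
          ← ENNReal.ofReal_mul hC.le]

theorem enorm_mul_le_sq {a b c : ℝ} (hc : 0 < c) : ‖a * b‖ₑ ≤
    ENNReal.ofReal c * ENNReal.ofReal (a ^ 2) + ENNReal.ofReal c⁻¹ * ENNReal.ofReal (b ^ 2) := by
  rw [← ENNReal.ofReal_mul hc.le, ← ENNReal.ofReal_mul (by positivity),
    ← ENNReal.ofReal_add (by positivity) (by positivity), Real.enorm_eq_ofReal_abs]
  refine ENNReal.ofReal_le_ofReal ?_
  have h1 : |a * b| = (Real.sqrt c * |a|) * (Real.sqrt c⁻¹ * |b|) := by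
    rw [mul_mul_mul_comm, ← Real.sqrt_mul hc.le, mul_inv_cancel₀ hc.ne', Real.sqrt_one, one_mul,
      abs_mul]
  have h2 : c * a ^ 2 = (Real.sqrt c * |a|) ^ 2 := by
    rw [mul_pow, Real.sq_sqrt hc.le, sq_abs]
  have h3 : c⁻¹ * b ^ 2 = (Real.sqrt c⁻¹ * |b|) ^ 2 := by
    rw [mul_pow, Real.sq_sqrt (by positivity), sq_abs]
  rw [h1, h2, h3]
  nlinarith [sq_nonneg (Real.sqrt c * |a| - Real.sqrt c⁻¹ * |b|),
    sq_nonneg (Real.sqrt c * |a|), sq_nonneg (Real.sqrt c⁻¹ * |b|)]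

/-- The Cauchy–Schwarz inequality at a position off `L`. -/
theorem Frm_cauchySchwarz (m : ℕ) (hm : 0 < m) {Δ : ℝ} (hΔ : 1 ≤ Δ) : ∃ M : ℝ, 1 ≤ M ∧
    ∀ β : Idx m → ℕ, ∃ C : ℝ, 0 < C ∧ ∀ (L : Finset (Fin m)) (J : Matrix (Idx m) (Fin m) ℝ)
      (f : Corner m → (Fin m → ℝ) → ℝ), Reg Δ J → SymRows L J → Nice f →
      (∀ κ, base κ ∈ L → β κ = 0) → ∀ i ∉ L, β (Sum.inl i) ≠ 0 → β (Sum.inr i) ≠ 0 →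
      ∀ s : Fin m → ℝ, (∀ h, 0 < s h) → (∀ h ∉ L, s h = s i) → ∀ c : ℝ, 0 < c →
        ‖Frm J f β s‖ₑ ≤ ENNReal.ofReal C * (ENNReal.ofReal c * sqForm J f i 0 (csScale M L i s) +
          ENNReal.ofReal c⁻¹ * sqForm J f i 1 (csScale M L i s)) := by
  obtain ⟨M, hM, h⟩ := lintegral_offKer_slice_le m hm hΔ
  choose C hC h using h
  refine ⟨M, hM, fun β => ?_⟩
  obtain ⟨C', hC', h'⟩ := offKer_abs_le β
  set D : ℝ := 1 + ∑ κ, C (β κ - 1)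
  have hCD : ∀ κ, C (β κ - 1) ≤ D := fun κ => by
    have := Finset.single_le_sum (f := fun κ => C (β κ - 1)) (fun κ _ => (hC (β κ - 1)).le)
      (Finset.mem_univ κ)
    simp only [D]
    linarith
  have hD : 0 < D := by
    have := Finset.sum_nonneg (s := Finset.univ) fun κ _ => (hC (β κ - 1)).le
    simp only [D]
    linarith
  refine ⟨C' * D, by positivity, ?_⟩
  intro L J f hJ hsym hf hβ i hi h0 h1 s hs hs₀ c hc
  have hβ' : ∀ e : Fin 2, β (coor i e) = 1 + (β (coor i e) - 1) := fun e => by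
    fin_cases e
    · change β (coor i 0) = 1 + (β (coor i 0) - 1)
      rw [coor_zero]; omega
    · change β (coor i 1) = 1 + (β (coor i 1) - 1)
      rw [coor_one]; omega
  set Z : Fin 2 → (Off i → ℝ) → (Fin m → ℝ) → ℝ≥0∞ := fun e y p =>
    ENNReal.ofReal (offKer J i 0 (wideScale L s) y p) *
      ENNReal.ofReal (slice f i e (β (coor i e)) (s i) y ((J *ᵥ p) (coor i e)) ^ 2) with hZ
  have hZm : ∀ e, Measurable fun z : (Off i → ℝ) × (Fin m → ℝ) => Z e z.1 z.2 := fun e =>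
    measurable_offKer_mul_slice hf J i e (wideScale L s) (β (coor i e)) (s i)
  have hZb : ∀ e y, ∫⁻ p, Z e y p ≤ ENNReal.ofReal D *
      ∫⁻ p, ENNReal.ofReal (offKer J i 0 (csScale M L i s) y p) *
        ENNReal.ofReal (slice f i e 1 (csScale M L i s i) y ((J *ᵥ p) (coor i e)) ^ 2) := by
    intro e y
    simp only [hZ]
    rw [hβ' e]
    refine (h _ L J f hJ hsym hf i hi e s hs hs₀ y).trans ?_
    exact mul_le_mul_left (ENNReal.ofReal_le_ofReal (hCD _)) _
  have hpt : ∀ p y, ‖offKer J i β s y p *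
      (slice f i 0 (β (Sum.inl i)) (s i) y ((J *ᵥ p) (Sum.inl i)) *
        slice f i 1 (β (Sum.inr i)) (s i) y ((J *ᵥ p) (Sum.inr i)))‖ₑ ≤
      ENNReal.ofReal C' * (ENNReal.ofReal c * Z 0 y p + ENNReal.ofReal c⁻¹ * Z 1 y p) := by
    intro p y
    rw [enorm_mul]
    have e1 : ‖offKer J i β s y p‖ₑ ≤
        ENNReal.ofReal C' * ENNReal.ofReal (offKer J i 0 (wideScale L s) y p) := by
      rw [← ENNReal.ofReal_mul hC'.le, Real.enorm_eq_ofReal_abs]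
      exact ENNReal.ofReal_le_ofReal (h' J L i s hs hβ y p)
    refine (mul_le_mul' e1 (enorm_mul_le_sq hc)).trans (le_of_eq ?_)
    simp only [hZ, coor_zero, coor_one]
    ring
  rw [hf.Frm_slice hJ i β hs]
  calc _ ≤ ∫⁻ p, ∫⁻ y, ENNReal.ofReal C' *
        (ENNReal.ofReal c * Z 0 y p + ENNReal.ofReal c⁻¹ * Z 1 y p) :=
        (enorm_integral_le_lintegral_enorm _).trans (lintegral_mono fun p =>
          (enorm_integral_le_lintegral_enorm _).trans (lintegral_mono fun y => hpt p y))
    _ = ∫⁻ y, ∫⁻ p, ENNReal.ofReal C' *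
        (ENNReal.ofReal c * Z 0 y p + ENNReal.ofReal c⁻¹ * Z 1 y p) := by
        refine lintegral_lintegral_swap ?_
        have := ((((hZm 0).const_mul (ENNReal.ofReal c)).add
          ((hZm 1).const_mul (ENNReal.ofReal c⁻¹))).const_mul (ENNReal.ofReal C')).comp
          measurable_swap
        exact this.aemeasurable
    _ = ∫⁻ y, ENNReal.ofReal C' * (ENNReal.ofReal c * (∫⁻ p, Z 0 y p) +
          ENNReal.ofReal c⁻¹ * ∫⁻ p, Z 1 y p) := by
        refine lintegral_congr fun y => ?_
        rw [lintegral_const_mul' _ _ ENNReal.ofReal_ne_top, lintegral_add_left,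
          lintegral_const_mul' _ _ ENNReal.ofReal_ne_top,
          lintegral_const_mul' _ _ ENNReal.ofReal_ne_top]
        exact ((hZm 0).comp measurable_prodMk_left).const_mul _
    _ ≤ ∫⁻ y, ENNReal.ofReal (C' * D) * (ENNReal.ofReal c *
          (∫⁻ p, ENNReal.ofReal (offKer J i 0 (csScale M L i s) y p) *
            ENNReal.ofReal (slice f i 0 1 (csScale M L i s i) y ((J *ᵥ p) (coor i 0)) ^ 2)) +
          ENNReal.ofReal c⁻¹ *
          (∫⁻ p, ENNReal.ofReal (offKer J i 0 (csScale M L i s) y p) *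
            ENNReal.ofReal (slice f i 1 1 (csScale M L i s i) y
              ((J *ᵥ p) (coor i 1)) ^ 2))) := by
        refine lintegral_mono fun y => ?_
        rw [ENNReal.ofReal_mul hC'.le, mul_assoc]
        refine mul_le_mul_right ?_ _
        rw [mul_add, mul_left_comm, mul_left_comm (ENNReal.ofReal D)]
        exact add_le_add (mul_le_mul_right (hZb 0 y) _) (mul_le_mul_right (hZb 1 y) _)
    _ = _ := by
        rw [lintegral_const_mul' _ _ ENNReal.ofReal_ne_top, lintegral_add_left,
          lintegral_const_mul' _ _ ENNReal.ofReal_ne_top,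
          lintegral_const_mul' _ _ ENNReal.ofReal_ne_top]
        · rfl
        · exact (measurable_offKer_mul_slice hf J i 0 _ 1 _).lintegral_prod_right'.const_mul _

end

section

variable {m : ℕ} {Δ α : ℝ} {L : Finset (Fin m)} {J : Matrix (Idx m) (Fin m) ℝ}
  {T : Set (ℤ × (Fin m → ℤ))} {Qt : ℤ × (Fin m → ℤ)} {d : Fin m → ℝ}
  {F : Corner m → (Fin m → ℝ) → ℝ} {M : Corner m → ℝ}

/-- The scales of the cubes of side length `2 ^ k`. -/
def scales (k : ℤ) : Set ℝ := Set.Ioc ((2 : ℝ) ^ (k - 1)) ((2 : ℝ) ^ k)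

/-- The right-hand side of the induction bounds. -/
def majorant (C α : ℝ) (Qt : ℤ × (Fin m → ℤ)) (d : Fin m → ℝ) (M : Corner m → ℝ) : ℝ≥0∞ :=
  ENNReal.ofReal (C * cost α d * ∏ j, M j) * volume (dC Qt)

/-- The forms `Bform`, summed over the scales of a tree, are bounded. -/
def FormBound (Δ α : ℝ) (L : Finset (Fin m)) : Prop :=
  ∃ C : ℝ, 0 < C ∧ ∀ J T Qt d F M, Adm Δ α L J T Qt d F M → ∀ N : ℕ,
    ‖∑ n ∈ Finset.range N, ∫ t in scales (Qt.1 - n),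
      t⁻¹ * Bform L J (floc J T F (Qt.1 - n)) (fun h => t * d h)‖ₑ ≤ majorant C α Qt d M

/-- The square forms at the positions in `L`, summed over the scales of a tree, are bounded. -/
def SquareBound (Δ α : ℝ) (L : Finset (Fin m)) : Prop :=
  ∃ C : ℝ, 0 < C ∧ ∀ J T Qt d F M, Adm Δ α L J T Qt d F M → ∀ i ∈ L, ∀ N : ℕ,
    ∑ n ∈ Finset.range N, ∫⁻ t in scales (Qt.1 - n), ENNReal.ofReal t⁻¹ *
      ENNReal.ofReal (Frm J (floc J T F (Qt.1 - n)) (pairIdx i) (fun h => t * d h)) ≤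
        majorant C α Qt d M

theorem cost_pos (α : ℝ) (hd : ∀ h, 0 < d h) : 0 < cost α d :=
  Finset.prod_pos fun h _ => lt_max_of_lt_left (Real.rpow_pos_of_pos (hd h) _)

theorem Adm.prod_nonneg (H : Adm Δ α L J T Qt d F M) : 0 ≤ ∏ j, M j :=
  Finset.prod_nonneg fun j _ => H.nonneg j

theorem mul_majorant {a : ℝ} (ha : 0 ≤ a) (C : ℝ) :
    ENNReal.ofReal a * majorant C α Qt d M = majorant (a * C) α Qt d M := by
  rw [majorant, majorant, ← mul_assoc, ← ENNReal.ofReal_mul ha]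
  ring_nf

theorem Adm.add_majorant (H : Adm Δ α L J T Qt d F M) {C C' : ℝ} (hC : 0 ≤ C) (hC' : 0 ≤ C') :
    majorant C α Qt d M + majorant C' α Qt d M = majorant (C + C') α Qt d M := by
  have h := (cost_pos α H.dpos).le
  have h' := H.prod_nonneg
  rw [majorant, majorant, majorant, ← add_mul, ← ENNReal.ofReal_add (by positivity)
    (by positivity)]
  ring_nf

theorem floc_symf (J : Matrix (Idx m) (Fin m) ℝ) (T : Set (ℤ × (Fin m → ℤ)))
    (F : Corner m → (Fin m → ℝ) → ℝ) (k : ℤ) (i : Fin m) (e : Fin 2) :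
    floc (symJ J i e) T (symf F i e) k = symf (floc J T F k) i e := by
  funext j
  simp only [floc, symf, Amat_symJ]

theorem symJ_eq_self (hsym : SymRows L J) {i : Fin m} (hi : i ∈ L) (e : Fin 2) :
    symJ J i e = J := by
  ext κ k
  have h : ∀ κ : Idx m, base κ = i → J κ k = J (Sum.inl i) k := by
    rintro (κ | κ) hκ
    · rw [show κ = i from hκ]
    · rw [show κ = i from hκ, hsym i hi]
  simp only [symJ, Matrix.of_apply]
  split_ifs with hκ
  · rw [h κ hκ, h _ (base_sel _ _)]
  · rfl

theorem Adm.Frm_pair_nonneg (H : Adm Δ α L J T Qt d F M) {i : Fin m} (hi : i ∈ L) (k : ℤ)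
    {s : Fin m → ℝ} (hs : ∀ h, 0 < s h) : 0 ≤ Frm J (floc J T F k) (pairIdx i) s := by
  have h := ((H.nice k).Frm_symf H.reg i 0 hs).1
  have hF : symf F i 0 = F := funext fun j => H.symF j i hi 0
  rw [← floc_symf, hF, symJ_eq_self H.sym hi] at h
  exact h

theorem formBound_univ (m : ℕ) (Δ α : ℝ) : FormBound Δ α (Finset.univ : Finset (Fin m)) := by
  refine ⟨1, one_pos, fun J T Qt d F M H N => ?_⟩
  have h : ∀ n ∈ Finset.range N, ∫ t in scales (Qt.1 - n),
      t⁻¹ * Bform Finset.univ J (floc J T F (Qt.1 - n)) (fun h => t * d h) = 0 := by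
    intro n _
    refine integral_eq_zero_of_ae ?_
    filter_upwards [ae_restrict_mem measurableSet_Ioc] with t ht
    have ht0 : 0 < t := lt_trans (by positivity) ht.1
    rw [(H.nice _).Bform_univ H.reg H.sym fun h => mul_pos ht0 (H.dpos h), mul_zero]
    rfl
  rw [Finset.sum_eq_zero h, enorm_zero]
  exact zero_le

theorem FormBound.squareBound (hm : 0 < m) (hΔ : 1 ≤ Δ) (hα : 0 ≤ α) (hα1 : α ≤ 1)
    (hP : FormBound Δ α L) : SquareBound Δ α L := by
  obtain ⟨C, hC, hP⟩ := hP
  obtain ⟨C', hC', hT⟩ := telescoping_bound m hm Δ α hΔ hα hα1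
  refine ⟨1 / 2 * C + Real.pi * C', by positivity, fun J T Qt d F M H i hi N => ?_⟩
  have hab : ∀ n : ℕ, (2 : ℝ) ^ (Qt.1 - n - 1) ≤ (2 : ℝ) ^ (Qt.1 - n) := fun n =>
    zpow_le_zpow_right₀ one_le_two (by omega)
  have hpos : ∀ n : ℕ, (0 : ℝ) < (2 : ℝ) ^ (Qt.1 - n - 1) := fun n => by positivity
  set f : ℕ → Corner m → (Fin m → ℝ) → ℝ := fun n => floc J T F (Qt.1 - n)
  set S : Fin m → ℕ → ℝ := fun h n => ∫ t in scales (Qt.1 - n),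
    t⁻¹ * Frm J (f n) (pairIdx h) (fun h => t * d h) with hS
  have hnn : ∀ h ∈ L, ∀ n : ℕ, ∀ t ∈ scales (Qt.1 - n),
      0 ≤ t⁻¹ * Frm J (f n) (pairIdx h) (fun h => t * d h) := by
    intro h hh n t ht
    have ht0 : 0 < t := lt_trans (by positivity) ht.1
    exact mul_nonneg (by positivity) (H.Frm_pair_nonneg hh _ fun h => mul_pos ht0 (H.dpos h))
  have hS0 : ∀ h ∈ L, ∀ n, 0 ≤ S h n := fun h hh n =>
    setIntegral_nonneg measurableSet_Ioc (hnn h hh n)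
  have hlin : ∀ n : ℕ, ∫⁻ t in scales (Qt.1 - n), ENNReal.ofReal t⁻¹ *
      ENNReal.ofReal (Frm J (f n) (pairIdx i) (fun h => t * d h)) = ENNReal.ofReal (S i n) := by
    intro n
    have h := ofReal_integral_eq_lintegral_ofReal
      ((H.nice (Qt.1 - n)).integrable_inv_mul_Frm H.reg (pairIdx i) H.dpos (hpos n))
      ((ae_restrict_mem measurableSet_Ioc).mono (hnn i hi n))
    refine Eq.trans ?_ h.symm
    refine setLIntegral_congr_fun measurableSet_Ioc fun t ht => ?_
    have ht0 : 0 < t := lt_trans (by positivity) ht.1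
    rw [ENNReal.ofReal_mul (by positivity)]
  have hsum : ∑ h ∈ L, ∑ n ∈ Finset.range N, S h n =
      1 / 2 * (∑ n ∈ Finset.range N, ∫ t in scales (Qt.1 - n),
        t⁻¹ * Bform L J (f n) (fun h => t * d h)) + Real.pi * ∑ n ∈ Finset.range N,
        (Frm J (f n) 0 (fun h => (2 : ℝ) ^ (Qt.1 - n - 1) * d h) -
          Frm J (f n) 0 (fun h => (2 : ℝ) ^ (Qt.1 - n) * d h)) := by
    rw [Finset.sum_comm, Finset.mul_sum, Finset.mul_sum, ← Finset.sum_add_distrib]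
    refine Finset.sum_congr rfl fun n _ => ?_
    have h := (H.nice (Qt.1 - n)).integral_Bform H.reg L H.dpos (hpos n) (hab n)
    simp only [scales, hS, f] at h ⊢
    rw [h]
    ring
  have hle : ∑ n ∈ Finset.range N, S i n ≤ ∑ h ∈ L, ∑ n ∈ Finset.range N, S h n :=
    Finset.single_le_sum (f := fun h => ∑ n ∈ Finset.range N, S h n)
      (fun h hh => Finset.sum_nonneg fun n _ => hS0 h hh n) hi
  calc _ = ENNReal.ofReal (∑ n ∈ Finset.range N, S i n) := by
        rw [ENNReal.ofReal_sum_of_nonneg fun n _ => hS0 i hi n]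
        exact Finset.sum_congr rfl fun n _ => hlin n
    _ ≤ ENNReal.ofReal (∑ h ∈ L, ∑ n ∈ Finset.range N, S h n) := ENNReal.ofReal_le_ofReal hle
    _ ≤ ‖∑ h ∈ L, ∑ n ∈ Finset.range N, S h n‖ₑ := Real.ofReal_le_enorm _
    _ ≤ majorant (1 / 2 * C) α Qt d M + majorant (Real.pi * C') α Qt d M := by
        rw [hsum]
        refine (enorm_add_le _ _).trans (add_le_add ?_ ?_)
        · rw [enorm_mul, ← mul_majorant (by norm_num), Real.enorm_of_nonneg (by norm_num)]
          exact mul_le_mul_right (hP J T Qt d F M H N) _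
        · rw [enorm_mul, ← mul_majorant Real.pi_pos.le, Real.enorm_of_nonneg Real.pi_pos.le]
          exact mul_le_mul_right (hT L J T Qt d F M H N) _
    _ = _ := H.add_majorant (by positivity) (by positivity)

end

theorem integral_Ioi_one_pow_mul_exp (n : ℕ) {x : ℝ} (hx : 0 < x) :
    ∫ s in Set.Ioi (1 : ℝ), (s - 1) ^ n * Real.exp (-(s * x)) =
      n.factorial * Real.exp (-x) / x ^ (n + 1) := by
  have h := Real.integral_rpow_mul_exp_neg_mul_Ioi (a := n + 1) (r := x) (by positivity) hx
  have h1 := (measurePreserving_add_right volume (1 : ℝ)).setIntegral_preimage_emb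
    (measurableEmbedding_addRight 1) (fun s => (s - 1) ^ n * Real.exp (-(s * x))) (Set.Ioi 1)
  have h2 : (fun s : ℝ => s + 1) ⁻¹' Set.Ioi 1 = Set.Ioi 0 := by
    ext s; simp
  rw [h2] at h1
  rw [← h1]
  have h3 : ∀ s : ℝ, (s + 1 - 1) ^ n * Real.exp (-((s + 1) * x)) =
      Real.exp (-x) * (s ^ ((n : ℝ) + 1 - 1) * Real.exp (-(x * s))) := fun s => by
    rw [add_sub_cancel_right, add_sub_cancel_right, Real.rpow_natCast, mul_left_comm,
      ← Real.exp_add]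
    ring_nf
  simp only [h3]
  rw [integral_const_mul, h, Real.Gamma_nat_eq_factorial, one_div, Real.inv_rpow hx.le,
    ← Nat.cast_add_one, Real.rpow_natCast]
  field_simp

/-- The weight of the superposition of Gaussians. -/
def supWeight (n : ℕ) (s : ℝ) : ℝ := (s - 1) ^ n / s ^ (n + 2)

theorem supWeight_le (n : ℕ) {s : ℝ} (hs : 1 < s) :
    0 ≤ supWeight n s ∧ supWeight n s ≤ s ^ (-2 : ℝ) := by
  have h0 : 0 < s := by linarith
  have h1 : (s - 1) ^ n ≤ s ^ n := pow_le_pow_left₀ (by linarith) (by linarith) n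
  have h2 : 0 ≤ (s - 1) ^ n := pow_nonneg (by linarith) n
  refine ⟨by unfold supWeight; positivity, ?_⟩
  rw [supWeight, Real.rpow_neg h0.le, show (2 : ℝ) = ((2 : ℕ) : ℝ) by norm_num,
    Real.rpow_natCast, div_le_iff₀ (by positivity), pow_add, mul_comm (s ^ n), ← mul_assoc,
    inv_mul_cancel₀ (by positivity), one_mul]
  exact h1

theorem supWeight_measurable (n : ℕ) : Measurable (supWeight n) :=
  ((measurable_id.sub_const 1).pow_const n).div (measurable_id.pow_const (n + 2))

theorem supWeight_integrable (n : ℕ) :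
    Integrable (supWeight n) (volume.restrict (Set.Ioi 1)) := by
  have h : IntegrableOn (fun s : ℝ => s ^ (-2 : ℝ)) (Set.Ioi 1) :=
    integrableOn_Ioi_rpow_of_lt (by norm_num) one_pos
  refine Integrable.mono' h (supWeight_measurable n).aestronglyMeasurable ?_
  filter_upwards [ae_restrict_mem measurableSet_Ioi] with s hs
  rw [Real.norm_of_nonneg (supWeight_le n hs).1]
  exact (supWeight_le n hs).2

section

variable {m : ℕ} {Δ : ℝ} {L : Finset (Fin m)} {J : Matrix (Idx m) (Fin m) ℝ}
  {f : Corner m → (Fin m → ℝ) → ℝ}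

/-- Scales dilated by `√s` at the positions off `L`. -/
def dilScale (L : Finset (Fin m)) (s : ℝ) (σ : Fin m → ℝ) (h : Fin m) : ℝ :=
  if h ∈ L then σ h else Real.sqrt s * σ h

/-- The multiplicities of the letters of a word. -/
def letters {ι : Type*} [Fintype ι] (w : ι → Idx m) (κ : Idx m) : ℕ :=
  (Finset.univ.filter fun a => w a = κ).card

theorem prod_pow_letters {ι M : Type*} [Fintype ι] [CommMonoid M] (w : ι → Idx m)
    (x : Idx m → M) : ∏ κ, x κ ^ letters w κ = ∏ a, x (w a) := by
  classical
  rw [← Finset.prod_fiberwise (s := Finset.univ) (g := w) (f := fun a => x (w a))]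
  refine Finset.prod_congr rfl fun κ _ => ?_
  rw [Finset.prod_congr rfl fun a ha => by rw [(Finset.mem_filter.1 ha).2], Finset.prod_const,
    letters]

theorem sum_dilScale_sq (J : Matrix (Idx m) (Fin m) ℝ) {s : ℝ} (hs : 0 ≤ s) {σ : Fin m → ℝ} {σ₀ : ℝ}
    (hσ : ∀ h ∉ L, σ h = σ₀) (ξ : Fin m → ℝ) :
    ∑ κ, (dilScale L s σ (base κ) * eta J ξ κ) ^ 2 =
      ∑ κ with base κ ∈ L, (σ (base κ) * eta J ξ κ) ^ 2 +
        s * (σ₀ ^ 2 * ∑ κ ∈ offIdx L, eta J ξ κ ^ 2) := by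
  rw [← Finset.sum_filter_add_sum_filter_not Finset.univ (fun κ : Idx m => base κ ∈ L)]
  congr 1
  · refine Finset.sum_congr rfl fun κ hκ => ?_
    rw [dilScale, if_pos (Finset.mem_filter.1 hκ).2]
  · rw [Finset.mul_sum, Finset.mul_sum]
    refine Finset.sum_congr rfl fun κ hκ => ?_
    rw [dilScale, if_neg (Finset.mem_filter.1 hκ).2, hσ _ (Finset.mem_filter.1 hκ).2, mul_pow,
      mul_pow, Real.sq_sqrt hs]
    ring

theorem mgp_letters {n : ℕ} (J : Matrix (Idx m) (Fin m) ℝ) {s : ℝ} (hs : 0 ≤ s) {σ : Fin m → ℝ}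
    {σ₀ : ℝ} (hσ : ∀ h ∉ L, σ h = σ₀) {w : WordIdx (n + 1) → Idx m} (hw : ∀ a, base (w a) ∉ L)
    (ξ : Fin m → ℝ) : mgp J (letters w) (dilScale L s σ) ξ =
      (((-(4 * Real.pi ^ 2)) ^ (n + 2) * (s ^ (n + 2) * (σ₀ ^ (2 * (n + 2)) *
        (∏ a, eta J ξ (w a)) * Real.exp (-Real.pi *
          ∑ κ, (dilScale L s σ (base κ) * eta J ξ κ) ^ 2))) : ℝ) : ℂ) := by
  rw [mgp_eq, prod_pow_letters]
  have h1 : ∀ a, dilScale L s σ (base (w a)) = Real.sqrt s * σ₀ := fun a => by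
    rw [dilScale, if_neg (hw a), hσ _ (hw a)]
  simp only [h1]
  rw [Finset.prod_mul_distrib, Finset.prod_const, ← Complex.ofReal_prod, Finset.prod_mul_distrib,
    Finset.prod_const]
  have h2 : (Finset.univ : Finset (WordIdx (n + 1))).card = 2 * (n + 2) := by
    simp; ring
  have h3 : (2 * Real.pi * Complex.I : ℂ) ^ 2 = ((-(4 * Real.pi ^ 2) : ℝ) : ℂ) := by
    rw [mul_pow, Complex.I_sq]
    push_cast
    ring
  rw [h2, pow_mul (2 * Real.pi * Complex.I : ℂ), h3, mul_pow (Real.sqrt s), pow_mul (Real.sqrt s),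
    Real.sq_sqrt hs]
  push_cast
  ring

/-- The normalization of the superposition of Gaussians. -/
def supConst (n : ℕ) : ℝ :=
  Real.pi ^ (n + 1) / (n.factorial * (-(4 * Real.pi ^ 2)) ^ (n + 2))

theorem symb_superposition (hJ : Reg Δ J) (hsym : SymRows L J) {n : ℕ} {σ : Fin m → ℝ} {σ₀ : ℝ}
    (hσ₀ : 0 < σ₀) (hσ : ∀ h ∉ L, σ h = σ₀) {c : (WordIdx (n + 1) → Idx m) → ℝ}
    (hc : ∀ w, c w ≠ 0 → OffPair L w) (hexp : ∀ ξ, (∑ κ ∈ offIdx L, eta J ξ κ ^ 2 +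
        ∑ h ∈ L, (σ h / σ₀) ^ 2 * (eta J ξ (Sum.inl h) + eta J ξ (Sum.inr h)) ^ 2) *
        (∑ κ ∈ offIdx L, eta J ξ κ ^ 2) ^ (n + 1) = ∑ w, c w * ∏ a, eta J ξ (w a))
    (ξ : Fin m → ℝ) : (symb L J σ ξ : ℂ) = ∑ w, ((supConst n * c w : ℝ) : ℂ) *
      ∫ s in Set.Ioi (1 : ℝ), (supWeight n s : ℂ) * mgp J (letters w) (dilScale L s σ) ξ := by
  set S := ∑ κ ∈ offIdx L, eta J ξ κ ^ 2 with hS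
  set E := ∑ κ with base κ ∈ L, (σ (base κ) * eta J ξ κ) ^ 2 with hE
  set q := S + ∑ h ∈ L, (σ h / σ₀) ^ 2 * (eta J ξ (Sum.inl h) + eta J ξ (Sum.inr h)) ^ 2 with hq
  set I := ∫ s in Set.Ioi (1 : ℝ), (s - 1) ^ n * Real.exp (-Real.pi * (E + s * (σ₀ ^ 2 * S)))
    with hI
  have hw : ∀ w, c w ≠ 0 → ∫ s in Set.Ioi (1 : ℝ),
      (supWeight n s : ℂ) * mgp J (letters w) (dilScale L s σ) ξ =
      (((-(4 * Real.pi ^ 2)) ^ (n + 2) * (σ₀ ^ (2 * (n + 2)) * (∏ a, eta J ξ (w a))) * I : ℝ) :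
        ℂ) := by
    intro w hw
    rw [hI, ← integral_const_mul, ← integral_complex_ofReal]
    refine setIntegral_congr_fun measurableSet_Ioi fun s hs => ?_
    have hs0 : (0 : ℝ) < s := lt_trans one_pos hs
    rw [mgp_letters J hs0.le hσ (hc w hw).1, ← Complex.ofReal_mul, sum_dilScale_sq J hs0.le hσ,
      ← hS, ← hE]
    congr 1
    rw [supWeight]
    field_simp
  have hpi : (-(4 * Real.pi ^ 2)) ^ (n + 2) ≠ 0 :=
    pow_ne_zero _ (neg_ne_zero.2 (by positivity))
  have hsum : ∑ w, ((supConst n * c w : ℝ) : ℂ) *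
      ∫ s in Set.Ioi (1 : ℝ), (supWeight n s : ℂ) * mgp J (letters w) (dilScale L s σ) ξ =
      ((Real.pi ^ (n + 1) / n.factorial * σ₀ ^ (2 * (n + 2)) * I * (q * S ^ (n + 1)) : ℝ) : ℂ) := by
    rw [hexp ξ, Finset.mul_sum, Complex.ofReal_sum]
    refine Finset.sum_congr rfl fun w _ => ?_
    by_cases h0 : c w = 0
    · simp [h0]
    · rw [hw w h0, ← Complex.ofReal_mul, supConst]
      congr 1
      field_simp
  rw [hsum]
  congr 1
  have hsy : symb L J σ ξ = σ₀ ^ 2 * q * Real.exp (-Real.pi * (E + σ₀ ^ 2 * S)) := by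
    have h1 := sum_dilScale_sq J zero_le_one hσ ξ
    have h2 : dilScale L 1 σ = σ := by
      funext h
      simp [dilScale]
    rw [h2, one_mul] at h1
    rw [symb, h1]
    congr 1
    rw [hq, mul_add, hS, Finset.mul_sum, Finset.mul_sum]
    congr 1
    · refine Finset.sum_congr rfl fun κ hκ => ?_
      rw [hσ _ (Finset.mem_filter.1 hκ).2]
      ring
    · refine Finset.sum_congr rfl fun h _ => ?_
      field_simp
  rw [hsy]
  have hS0 : 0 ≤ S := Finset.sum_nonneg fun κ _ => sq_nonneg _
  rcases hS0.eq_or_lt with h0 | h0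
  · have hz : ∀ κ ∈ offIdx L, eta J ξ κ = 0 := fun κ hκ => by
      have := (Finset.sum_eq_zero_iff_of_nonneg fun κ _ => sq_nonneg _).1 (hS ▸ h0.symm) κ hκ
      exact pow_eq_zero_iff two_ne_zero |>.1 this
    have hq0 : q = 0 := by
      rw [hq, show S = 0 from h0.symm, zero_add]
      refine Finset.sum_eq_zero fun h hh => ?_
      rw [eta_inl_add_inr hJ hsym ξ hh, Finset.sum_eq_zero]
      · simp
      · intro k hk
        rw [hz _ (by simp [offIdx] at hk ⊢; exact hk), mul_zero]
    simp [hq0]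
  · have hx : 0 < Real.pi * (σ₀ ^ 2 * S) := by positivity
    have hI' : I = Real.exp (-Real.pi * E) *
        (n.factorial * Real.exp (-(Real.pi * (σ₀ ^ 2 * S))) /
          (Real.pi * (σ₀ ^ 2 * S)) ^ (n + 1)) := by
      rw [hI, ← integral_Ioi_one_pow_mul_exp n hx, ← integral_const_mul]
      refine setIntegral_congr_fun measurableSet_Ioi fun s _ => ?_
      rw [mul_left_comm (Real.exp _), ← Real.exp_add]
      ring_nf
    have hex : Real.exp (-Real.pi * (E + σ₀ ^ 2 * S)) =
        Real.exp (-Real.pi * E) * Real.exp (-(Real.pi * (σ₀ ^ 2 * S))) := by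
      rw [← Real.exp_add]
      ring_nf
    rw [hI', hex]
    have hn : (n.factorial : ℝ) ≠ 0 := by positivity
    rw [mul_pow, mul_pow]
    field_simp
    ring

end

section

variable {m : ℕ} {Δ : ℝ} {L : Finset (Fin m)} {J : Matrix (Idx m) (Fin m) ℝ}
  {f : Corner m → (Fin m → ℝ) → ℝ}

theorem measurable_dilScale {Ω : Type*} [MeasurableSpace Ω] {s : Ω → ℝ} (hs : Measurable s)
    {σ : Ω → Fin m → ℝ} (hσ : Measurable σ) (L : Finset (Fin m)) :
    Measurable fun ω => dilScale L (s ω) (σ ω) := by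
  refine measurable_pi_lambda _ fun h => ?_
  unfold dilScale
  have h1 : Measurable fun ω => σ ω h := (measurable_pi_apply h).comp hσ
  split_ifs
  · exact h1
  · exact (Real.continuous_sqrt.measurable.comp hs).mul h1

theorem le_dilScale {s : ℝ} (hs : 1 ≤ s) {σ : Fin m → ℝ} (hσ : ∀ h, 0 < σ h) (h : Fin m) :
    σ h ≤ dilScale L s σ h := by
  unfold dilScale
  split_ifs
  · exact le_rfl
  · exact le_mul_of_one_le_left (hσ h).le (Real.one_le_sqrt.2 hs)

theorem dilScale_smul (L : Finset (Fin m)) (s t : ℝ) (d : Fin m → ℝ) :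
    dilScale L s (fun h => t * d h) = fun h => t * dilScale L s d h := by
  funext h
  unfold dilScale
  split_ifs
  · rfl
  · ring

theorem Nice.Bform_superposition (hJ : Reg Δ J) (hsym : SymRows L J) (hf : Nice f) {n : ℕ}
    {σ : Fin m → ℝ} {σ₀ : ℝ} (hpos : ∀ h, 0 < σ h) (hσ₀ : 0 < σ₀) (hσ : ∀ h ∉ L, σ h = σ₀)
    {c : (WordIdx (n + 1) → Idx m) → ℝ} (hc : ∀ w, c w ≠ 0 → OffPair L w)
    (hexp : ∀ ξ, (∑ κ ∈ offIdx L, eta J ξ κ ^ 2 +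
        ∑ h ∈ L, (σ h / σ₀) ^ 2 * (eta J ξ (Sum.inl h) + eta J ξ (Sum.inr h)) ^ 2) *
        (∑ κ ∈ offIdx L, eta J ξ κ ^ 2) ^ (n + 1) = ∑ w, c w * ∏ a, eta J ξ (w a)) :
    Bform L J f σ = ∑ w, -(4 * Real.pi ^ 2) * (supConst n * c w) *
      ∫ s in Set.Ioi (1 : ℝ), supWeight n s * Frm J f (letters w) (dilScale L s σ) := by
  have hdet : |(Jb1 J).det| ≠ 0 := by rw [Jb1_eq]; exact abs_ne_zero.2 (hJ _).2.1
  have hmeas : Measurable fun s => dilScale L s σ :=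
    measurable_dilScale measurable_id measurable_const L
  have hle : ∀ᵐ s ∂(volume.restrict (Set.Ioi (1 : ℝ))), ∀ h, σ h ≤ dilScale L s σ h := by
    filter_upwards [ae_restrict_mem measurableSet_Ioi] with s hs h
    exact le_dilScale (le_of_lt hs) hpos h
  have key := hf.integral_symb_mul_fhat hJ L hpos
  simp only [symb_superposition hJ hsym hσ₀ hσ hc hexp, Finset.sum_mul, mul_assoc] at key
  have hInt : ∀ w : WordIdx (n + 1) → Idx m, Integrable fun ξ =>
      (∫ s in Set.Ioi (1 : ℝ), (supWeight n s : ℂ) * mgp J (letters w) (dilScale L s σ) ξ) *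
        fhat J f ξ := fun w => by
    have h := (hf.integrable_mul_fhat J (integrable_mgp J (letters w)
      (supWeight_integrable n).ofReal hmeas hpos hle)).integral_prod_right
    simp only [integral_mul_const] at h
    exact h
  rw [integral_finsetSum _ fun w _ => (hInt w).const_mul _] at key
  simp only [integral_const_mul,
    hf.integral_integral_mgp hJ _ (supWeight_integrable n) hmeas hpos hle] at key
  have key' : -(4 * (Real.pi ^ 2 * ∑ w, supConst n * c w * (|(Jb1 J).det| *
      ∫ s in Set.Ioi (1 : ℝ), supWeight n s * Frm J f (letters w) (dilScale L s σ)))) =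
      |(Jb1 J).det| * Bform L J f σ := by
    apply Complex.ofReal_injective
    rw [← key]
    push_cast
    ring
  refine mul_left_cancel₀ hdet (key'.symm.trans ?_)
  rw [Finset.mul_sum, Finset.mul_sum, Finset.mul_sum, ← Finset.sum_neg_distrib]
  exact Finset.sum_congr rfl fun w _ => by ring

theorem Nice.Frm_eq_re (hJ : Reg Δ J) (hf : Nice f) (β : Idx m → ℕ) {s : Fin m → ℝ}
    (hs : ∀ h, 0 < s h) :
    Frm J f β s = |(Jb1 J).det|⁻¹ * (∫ ξ, mgp J β s ξ * fhat J f ξ).re := by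
  have hdet : |(Jb1 J).det| ≠ 0 := by rw [Jb1_eq]; exact abs_ne_zero.2 (hJ _).2.1
  rw [hf.integral_mgp_mul_fhat hJ β hs, Complex.ofReal_re, inv_mul_cancel_left₀ hdet]

theorem Nice.enorm_integral_Bform_le (hJ : Reg Δ J) (hsym : SymRows L J) (hf : Nice f) {n : ℕ}
    {d : Fin m → ℝ} {d₀ : ℝ} (hd : ∀ h, 0 < d h) (hd₀ : 0 < d₀) (hdL : ∀ h ∉ L, d h = d₀)
    {c : (WordIdx (n + 1) → Idx m) → ℝ} (hc : ∀ w, c w ≠ 0 → OffPair L w)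
    (hexp : ∀ ξ, (∑ κ ∈ offIdx L, eta J ξ κ ^ 2 +
        ∑ h ∈ L, (d h / d₀) ^ 2 * (eta J ξ (Sum.inl h) + eta J ξ (Sum.inr h)) ^ 2) *
        (∑ κ ∈ offIdx L, eta J ξ κ ^ 2) ^ (n + 1) = ∑ w, c w * ∏ a, eta J ξ (w a)) (k : ℤ) :
    ‖∫ t in scales k, t⁻¹ * Bform L J f (fun h => t * d h)‖ₑ ≤
      ∑ w, ‖-(4 * Real.pi ^ 2) * (supConst n * c w)‖ₑ * ∫⁻ s in Set.Ioi (1 : ℝ),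
        ‖supWeight n s‖ₑ * ∫⁻ t in scales k, ‖t⁻¹‖ₑ *
          ‖Frm J f (letters w) (fun h => t * dilScale L s d h)‖ₑ := by
  have hpos : ∀ t ∈ scales k, 0 < t := fun t ht => lt_trans (by positivity) ht.1
  have hmeas : ∀ w : WordIdx (n + 1) → Idx m, AEMeasurable (fun z : ℝ × ℝ => ‖supWeight n z.2‖ₑ *
      (‖z.1⁻¹‖ₑ * ‖Frm J f (letters w) (fun h => z.1 * dilScale L z.2 d h)‖ₑ))
      ((volume.restrict (scales k)).prod (volume.restrict (Set.Ioi (1 : ℝ)))) := fun w => by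
    have hm := hf.Frm_measurable (J := J) (letters w) (measurable_pi_lambda
      (fun (z : ℝ × ℝ) h => z.1 * dilScale L z.2 d h) fun h => measurable_fst.mul
        ((measurable_pi_apply h).comp (measurable_dilScale measurable_snd measurable_const L)))
    refine ((((supWeight_measurable n).comp measurable_snd).enorm).mul
      ((measurable_fst.inv.enorm).mul hm.enorm)).aemeasurable.congr ?_
    rw [Measure.prod_restrict]
    filter_upwards [ae_restrict_mem (measurableSet_Ioc.prod measurableSet_Ioi)] with z hz
    have h0 : ∀ h, 0 < z.1 * dilScale L z.2 d h := fun h =>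
      mul_pos (hpos _ hz.1) ((hd h).trans_le (le_dilScale (le_of_lt hz.2) hd h))
    simp only [Pi.mul_apply, Pi.inv_apply, Function.comp_apply, hf.Frm_eq_re hJ (letters w) h0]
  calc _ ≤ ∫⁻ t in scales k, ‖t⁻¹ * Bform L J f (fun h => t * d h)‖ₑ :=
        enorm_integral_le_lintegral_enorm _
    _ ≤ ∫⁻ t in scales k, ∑ w, ‖-(4 * Real.pi ^ 2) * (supConst n * c w)‖ₑ *
        ∫⁻ s in Set.Ioi (1 : ℝ), ‖supWeight n s‖ₑ * (‖t⁻¹‖ₑ *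
          ‖Frm J f (letters w) (fun h => t * dilScale L s d h)‖ₑ) := by
        refine setLIntegral_mono' measurableSet_Ioc fun t ht => ?_
        have ht0 := hpos t ht
        have hq : ∀ h, t * d h / (t * d₀) = d h / d₀ := fun h =>
          mul_div_mul_left _ _ ht0.ne'
        rw [hf.Bform_superposition hJ hsym (σ₀ := t * d₀) (fun h => mul_pos ht0 (hd h))
          (mul_pos ht0 hd₀) (fun h hh => by rw [hdL h hh]) hc (by simpa only [hq] using hexp),
          Finset.mul_sum]
        refine (enorm_sum_le _ _).trans (Finset.sum_le_sum fun w _ => ?_)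
        rw [mul_left_comm, enorm_mul]
        refine mul_le_mul_right ?_ _
        rw [← integral_const_mul]
        refine (enorm_integral_le_lintegral_enorm _).trans (lintegral_mono fun s => le_of_eq ?_)
        rw [enorm_mul, enorm_mul, dilScale_smul, mul_left_comm]
    _ = ∑ w, ‖-(4 * Real.pi ^ 2) * (supConst n * c w)‖ₑ * ∫⁻ t in scales k,
        ∫⁻ s in Set.Ioi (1 : ℝ), ‖supWeight n s‖ₑ * (‖t⁻¹‖ₑ *
          ‖Frm J f (letters w) (fun h => t * dilScale L s d h)‖ₑ) := by
        rw [lintegral_finsetSum' _ fun w _ => ((hmeas w).lintegral_prod_right').const_mul _]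
        exact Finset.sum_congr rfl fun w _ =>
          lintegral_const_mul'' _ (hmeas w).lintegral_prod_right'
    _ ≤ _ := by
        refine Finset.sum_le_sum fun w _ => mul_le_mul_right ?_ _
        rw [lintegral_lintegral_swap (hmeas w)]
        exact lintegral_mono fun s => (lintegral_const_mul' _ _ enorm_ne_top).le

end

theorem le_of_forall_scale_le {x V : ℝ≥0∞} {p q r : ℝ} (hp : 0 ≤ p) (hq : 0 ≤ q) (hr : 0 ≤ r)
    (hpq : p * q = r ^ 2) (hV : V ≠ ⊤)
    (hx : ∀ c : ℝ, 0 < c → x ≤ ENNReal.ofReal (c * p + c⁻¹ * q) * V) :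
    x ≤ ENNReal.ofReal (2 * r) * V := by
  have hlim : Filter.Tendsto (fun ε : ℝ => ENNReal.ofReal (2 * Real.sqrt ((p + ε) * (q + ε))) * V)
      (nhdsWithin 0 (Set.Ioi 0)) (nhds (ENNReal.ofReal (2 * r) * V)) := by
    have hc : Continuous fun ε : ℝ => 2 * Real.sqrt ((p + ε) * (q + ε)) := by fun_prop
    have h0 := (hc.tendsto 0).mono_left (nhdsWithin_le_nhds (s := Set.Ioi 0))
    rw [add_zero, add_zero, hpq, Real.sqrt_sq hr] at h0
    exact ENNReal.Tendsto.mul_const (ENNReal.tendsto_ofReal h0) (Or.inr hV)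
  refine ge_of_tendsto hlim ?_
  filter_upwards [self_mem_nhdsWithin] with ε hε
  have hε : 0 < ε := hε
  have hp' : 0 < Real.sqrt (p + ε) := Real.sqrt_pos.2 (by linarith)
  have hq' : 0 < Real.sqrt (q + ε) := Real.sqrt_pos.2 (by linarith)
  refine (hx (Real.sqrt (q + ε) / Real.sqrt (p + ε)) (by positivity)).trans
    (mul_le_mul_left (ENNReal.ofReal_le_ofReal ?_) _)
  have hps : Real.sqrt (p + ε) ^ 2 = p + ε := Real.sq_sqrt (by linarith)
  have hqs : Real.sqrt (q + ε) ^ 2 = q + ε := Real.sq_sqrt (by linarith)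
  have h1 : Real.sqrt (q + ε) / Real.sqrt (p + ε) * p ≤
      Real.sqrt (q + ε) / Real.sqrt (p + ε) * Real.sqrt (p + ε) ^ 2 :=
    mul_le_mul_of_nonneg_left (by linarith) (by positivity)
  have h2 : (Real.sqrt (q + ε) / Real.sqrt (p + ε))⁻¹ * q ≤
      (Real.sqrt (q + ε) / Real.sqrt (p + ε))⁻¹ * Real.sqrt (q + ε) ^ 2 :=
    mul_le_mul_of_nonneg_left (by linarith) (by positivity)
  rw [Real.sqrt_mul (by linarith)]
  refine (add_le_add h1 h2).trans (le_of_eq ?_)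
  field_simp
  ring

theorem sum_lintegral_le {ι Ω : Type*} [MeasurableSpace Ω] (μ : Measure Ω) (s : Finset ι)
    (g : ι → Ω → ℝ≥0∞) : ∑ i ∈ s, ∫⁻ x, g i x ∂μ ≤ ∫⁻ x, ∑ i ∈ s, g i x ∂μ := by
  classical
  induction s using Finset.induction_on with
  | empty => simp
  | insert a s ha ih =>
    simp only [Finset.sum_insert ha]
    exact (add_le_add le_rfl ih).trans (le_lintegral_add _ _)

theorem prod_update_mul_prod_update {m : ℕ} {R : Type*} [CommMonoid R] (g : Corner m → R)
    (i : Fin m) : (∏ j, symf g i 0 j) * ∏ j, symf g i 1 j = (∏ j, g j) ^ 2 := by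
  have hinv : Function.Involutive fun z : Corner m × Fin 2 =>
      ((Function.update z.1 i z.2, z.1 i) : Corner m × Fin 2) := fun z => by
    ext1 <;> simp
  have h := Equiv.prod_comp hinv.toPerm fun z : Corner m × Fin 2 => g z.1
  simp only [Function.Involutive.coe_toPerm, Fintype.prod_prod_type_right, Fin.prod_univ_two] at h
  rw [sq, ← h]
  rfl

theorem max_rpow_mul_le {α d lam K : ℝ} (hd : 0 < d) (hlam : 0 < lam)
    (h1 : lam ^ (2 * α) ≤ K) (h2 : lam ^ (-2 : ℝ) ≤ K) :
    max ((lam * d) ^ (2 * α)) ((lam * d) ^ (-2 : ℝ)) ≤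
      K * max (d ^ (2 * α)) (d ^ (-2 : ℝ)) := by
  rw [Real.mul_rpow hlam.le hd.le, Real.mul_rpow hlam.le hd.le]
  have hK : 0 ≤ K := (Real.rpow_nonneg hlam.le _).trans h1
  exact max_le (mul_le_mul h1 (le_max_left _ _) (by positivity) hK)
    (mul_le_mul h2 (le_max_right _ _) (by positivity) hK)

section

variable {m : ℕ} {Δ α : ℝ} {L : Finset (Fin m)} {J : Matrix (Idx m) (Fin m) ℝ}
  {T : Set (ℤ × (Fin m → ℤ))} {Qt : ℤ × (Fin m → ℤ)} {d : Fin m → ℝ}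
  {F : Corner m → (Fin m → ℝ) → ℝ} {M : Corner m → ℝ}

theorem csScale_smul (A : ℝ) (L : Finset (Fin m)) (i : Fin m) (t : ℝ) (d : Fin m → ℝ) :
    csScale A L i (fun h => t * d h) = fun h => t * csScale A L i d h := by
  funext h
  unfold csScale
  split_ifs <;> ring

theorem exists_csScale_eq {A s : ℝ} (hA : 1 ≤ A) (hs : 1 ≤ s) (L : Finset (Fin m)) (i h : Fin m)
    (d : Fin m → ℝ) : ∃ lam : ℝ, (Real.sqrt 2)⁻¹ ≤ lam ∧ lam ≤ A * Real.sqrt s ∧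
      csScale A L i (dilScale L s d) h = lam * d h := by
  have h2 : (Real.sqrt 2)⁻¹ ≤ 1 := inv_le_one_of_one_le₀ (Real.one_le_sqrt.2 one_le_two)
  have hs' : 1 ≤ Real.sqrt s := Real.one_le_sqrt.2 hs
  have hAs : 1 * Real.sqrt s ≤ A * Real.sqrt s := mul_le_mul_of_nonneg_right hA (by positivity)
  unfold csScale dilScale
  split_ifs
  · exact ⟨1, h2, by linarith, by ring⟩
  · refine ⟨Real.sqrt s * (Real.sqrt 2)⁻¹, le_mul_of_one_le_left (by positivity) hs', ?_, by ring⟩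
    exact (mul_le_of_le_one_right (by positivity) h2).trans (by linarith)
  · exact ⟨A * Real.sqrt s, by linarith, le_rfl, by ring⟩

theorem cost_csScale_le {A s : ℝ} (hA : 1 ≤ A) (hs : 1 ≤ s) (hα : 0 ≤ α) (hα1 : α ≤ 1)
    (hd : ∀ h, 0 < d h) (L : Finset (Fin m)) (i : Fin m) :
    cost α (csScale A L i (dilScale L s d)) ≤ (2 * A ^ 2) ^ m * s ^ (α * m) * cost α d := by
  have hs0 : 0 < s := by linarith
  have hsa : 1 ≤ s ^ α := Real.one_le_rpow hs hα
  have hA2 : 1 ≤ A ^ 2 := one_le_pow₀ hA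
  have hfac : (2 * A ^ 2) ^ m * s ^ (α * m) = ∏ _h : Fin m, 2 * A ^ 2 * s ^ α := by
    rw [Finset.prod_const, Finset.card_univ, Fintype.card_fin, mul_pow _ (s ^ α),
      Real.rpow_mul_natCast hs0.le]
  rw [hfac, cost, cost, ← Finset.prod_mul_distrib]
  refine Finset.prod_le_prod (fun h _ => ?_) fun h _ => ?_
  · obtain ⟨lam, h1, -, he⟩ := exists_csScale_eq hA hs L i h d
    have := hd h
    have : 0 < lam := lt_of_lt_of_le (by positivity) h1
    rw [he]
    positivity
  · obtain ⟨lam, h1, h2, he⟩ := exists_csScale_eq hA hs L i h d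
    have hl : 0 < lam := lt_of_lt_of_le (by positivity) h1
    rw [he]
    refine max_rpow_mul_le (hd h) hl ?_ ?_
    · calc lam ^ (2 * α) ≤ (A * Real.sqrt s) ^ (2 * α) := Real.rpow_le_rpow hl.le h2 (by linarith)
        _ = A ^ (2 * α) * s ^ α := by
          rw [Real.mul_rpow (by linarith) (by positivity), Real.rpow_mul (Real.sqrt_nonneg s),
            Real.rpow_two, Real.sq_sqrt hs0.le]
        _ ≤ 2 * A ^ 2 * s ^ α := by
          refine mul_le_mul_of_nonneg_right ?_ (by positivity)
          refine (Real.rpow_le_rpow_of_exponent_le hA (show 2 * α ≤ 2 by linarith)).trans ?_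
          rw [Real.rpow_two]
          linarith
    · calc lam ^ (-2 : ℝ) ≤ (Real.sqrt 2)⁻¹ ^ (-2 : ℝ) :=
          Real.rpow_le_rpow_of_nonpos (by positivity) h1 (by norm_num)
        _ = 2 := by
          rw [Real.inv_rpow (by positivity), Real.rpow_neg (by positivity), inv_inv, Real.rpow_two,
            Real.sq_sqrt (by norm_num)]
        _ ≤ 2 * A ^ 2 * s ^ α := by nlinarith

theorem Adm.symmetrize (H : Adm Δ α L J T Qt d F M) {i : Fin m} (hi : i ∉ L) (e : Fin 2) {A s : ℝ}
    (hA : 1 ≤ A) (hs : 1 ≤ s) : Adm Δ α (insert i L) (symJ J i e) T Qt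
      (csScale A L i (dilScale L s d)) (symf F i e) (symf M i e) := by
  have hs' : 1 ≤ Real.sqrt s := Real.one_le_sqrt.2 hs
  have hoff : ∀ h ∉ insert i L, csScale A L i (dilScale L s d) h = A * (Real.sqrt s * d h) := by
    intro h hh
    rw [Finset.mem_insert, not_or] at hh
    rw [csScale, if_neg hh.2, if_neg hh.1, dilScale, if_neg hh.2]
  refine ⟨H.reg.symJ i e, ?_, H.tree, csScale_pos (by linarith) fun h => (H.dpos h).trans_le
    (le_dilScale hs H.dpos h), ?_, ?_, fun j => H.cont _, fun j => H.supp _, ?_,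
    fun j => H.nonneg _, ?_⟩
  · intro h hh k
    simp only [symJ, Matrix.of_apply]
    have hl : base (Sum.inl h : Idx m) = h := rfl
    have hr : base (Sum.inr h : Idx m) = h := rfl
    by_cases hhi : h = i
    · rw [if_pos (hl.trans hhi), if_pos (hr.trans hhi)]
    · rw [if_neg (hl ▸ hhi), if_neg (hr ▸ hhi)]
      exact H.sym h (Finset.mem_of_mem_insert_of_ne hh hhi) k
  · intro h hh k hk
    rw [hoff k hk]
    have hk' : k ∉ L := fun h' => hk (Finset.mem_insert_of_mem h')
    obtain ⟨lam, -, h2, he⟩ := exists_csScale_eq hA hs L i h d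
    have hdk : d h ≤ d k := by
      rcases Finset.mem_insert.1 hh with rfl | hh
      · exact (H.deq _ hi _ hk').le
      · exact H.dle h hh k hk'
    rw [he, ← mul_assoc]
    exact mul_le_mul h2 hdk (H.dpos h).le (by positivity)
  · intro k hk k' hk'
    rw [hoff k hk, hoff k' hk', H.deq k (fun h' => hk (Finset.mem_insert_of_mem h')) k'
      (fun h' => hk' (Finset.mem_insert_of_mem h'))]
  · intro j h hh e'
    by_cases hhi : h = i
    · subst hhi
      simp only [symf, Function.update_idem]
    · rw [symf, symf, Function.update_comm hhi]
      exact H.symF _ h (Finset.mem_of_mem_insert_of_ne hh hhi) e'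
  · intro j Q hQ a b hab hsub
    rw [Amat_symJ] at hsub
    exact H.bound _ Q hQ a b hab hsub

end

section

variable {m : ℕ} {Δ α : ℝ} {L : Finset (Fin m)} {J : Matrix (Idx m) (Fin m) ℝ}
  {T : Set (ℤ × (Fin m → ℤ))} {Qt : ℤ × (Fin m → ℤ)} {d : Fin m → ℝ}
  {F : Corner m → (Fin m → ℝ) → ℝ} {M : Corner m → ℝ}

theorem volume_dC_ne_top (Q : ℤ × (Fin m → ℤ)) : volume (dC Q) ≠ ⊤ := by
  rw [volume_dC]
  exact ENNReal.ofReal_ne_top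

theorem Adm.lintegral_sqForm (H : Adm Δ α L J T Qt d F M) (i : Fin m) (e : Fin 2) (k : ℤ)
    {σ : Fin m → ℝ} (hσ : ∀ h, 0 < σ h) :
    AEMeasurable (fun t => ENNReal.ofReal t⁻¹ * sqForm J (floc J T F k) i e (fun h => t * σ h))
        (volume.restrict (scales k)) ∧
      ∀ t ∈ scales k, ENNReal.ofReal t⁻¹ * sqForm J (floc J T F k) i e (fun h => t * σ h) =
        ENNReal.ofReal t⁻¹ * ENNReal.ofReal (Frm (symJ J i e)
          (floc (symJ J i e) T (symf F i e) k) (pairIdx i) (fun h => t * σ h)) := by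
  have hpos : ∀ t ∈ scales k, 0 < t := fun t ht => lt_trans (by positivity) ht.1
  have heq : ∀ t ∈ scales k, ENNReal.ofReal t⁻¹ *
      sqForm J (floc J T F k) i e (fun h => t * σ h) = ENNReal.ofReal t⁻¹ *
        ENNReal.ofReal (Frm (symJ J i e) (floc (symJ J i e) T (symf F i e) k) (pairIdx i)
          (fun h => t * σ h)) := fun t ht => by
    rw [floc_symf, ((H.nice k).Frm_symf H.reg i e fun h => mul_pos (hpos t ht) (hσ h)).2]
  refine ⟨?_, heq⟩
  have h := (((H.nice k).symf i e).integrable_inv_mul_Frm (H.reg.symJ i e) (pairIdx i) hσ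
    (a := (2 : ℝ) ^ (k - 1)) (b := (2 : ℝ) ^ k) (by positivity)).aestronglyMeasurable
  refine h.aemeasurable.ennreal_ofReal.congr ?_
  filter_upwards [ae_restrict_mem measurableSet_Ioc] with t ht
  have := hpos t ht
  rw [heq t ht, floc_symf, ENNReal.ofReal_mul (by positivity)]

theorem SquareBound.cross (hm : 0 < m) (hΔ : 1 ≤ Δ) (hα : 0 ≤ α) (hα1 : α ≤ 1) {i : Fin m}
    (hi : i ∉ L) (hS : SquareBound Δ α (insert i L)) {β : Idx m → ℕ}
    (hβL : ∀ κ, base κ ∈ L → β κ = 0) (hβ0 : β (Sum.inl i) ≠ 0) (hβ1 : β (Sum.inr i) ≠ 0) :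
    ∃ C : ℝ, 0 < C ∧ ∀ J T Qt d F M, Adm Δ α L J T Qt d F M → ∀ s : ℝ, 1 ≤ s → ∀ N : ℕ,
      ∑ n ∈ Finset.range N, ∫⁻ t in scales (Qt.1 - n), ‖t⁻¹‖ₑ *
        ‖Frm J (floc J T F (Qt.1 - n)) β (fun h => t * dilScale L s d h)‖ₑ ≤
          ENNReal.ofReal (s ^ (α * m)) * majorant C α Qt d M := by
  obtain ⟨A, hA, hcs⟩ := Frm_cauchySchwarz m hm hΔ
  obtain ⟨C, hC, hcs⟩ := hcs β
  obtain ⟨C', hC', hS⟩ := hS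
  refine ⟨C * (2 * (C' * (2 * A ^ 2) ^ m)), by positivity, fun J T Qt d F M H s hs N => ?_⟩
  set σ : Fin m → ℝ := csScale A L i (dilScale L s d) with hσdef
  have hdil : ∀ h, 0 < dilScale L s d h := fun h => (H.dpos h).trans_le (le_dilScale hs H.dpos h)
  have hσ : ∀ h, 0 < σ h := csScale_pos (by linarith) hdil
  have hs0 : 0 < s := by linarith
  set X : Fin 2 → ℝ≥0∞ := fun e => ∑ n ∈ Finset.range N, ∫⁻ t in scales (Qt.1 - n),
    ENNReal.ofReal t⁻¹ * sqForm J (floc J T F (Qt.1 - n)) i e (fun h => t * σ h) with hX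
  have hXe : ∀ e, X e ≤ majorant C' α Qt σ (symf M i e) := fun e => by
    refine le_trans (Finset.sum_le_sum fun n _ => le_of_eq ?_) (hS _ T Qt σ _ _
      (H.symmetrize hi e hA hs) i (Finset.mem_insert_self i L) N)
    exact setLIntegral_congr_fun measurableSet_Ioc (H.lintegral_sqForm i e _ hσ).2
  have hbd : ∀ c : ℝ, 0 < c → ∑ n ∈ Finset.range N, ∫⁻ t in scales (Qt.1 - n), ‖t⁻¹‖ₑ *
      ‖Frm J (floc J T F (Qt.1 - n)) β (fun h => t * dilScale L s d h)‖ₑ ≤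
      ENNReal.ofReal C * (ENNReal.ofReal c * X 0 + ENNReal.ofReal c⁻¹ * X 1) := fun c hc => by
    simp only [hX]
    rw [Finset.mul_sum, Finset.mul_sum, ← Finset.sum_add_distrib, Finset.mul_sum]
    refine Finset.sum_le_sum fun n _ => ?_
    have h0 := (H.lintegral_sqForm i 0 (Qt.1 - n) hσ).1
    have h1 := (H.lintegral_sqForm i 1 (Qt.1 - n) hσ).1
    rw [← lintegral_const_mul'' _ h0, ← lintegral_const_mul'' _ h1,
      ← lintegral_add_left' (h0.const_mul _),
      ← lintegral_const_mul' _ _ ENNReal.ofReal_ne_top]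
    refine setLIntegral_mono' measurableSet_Ioc fun t ht => ?_
    have ht0 : 0 < t := lt_trans (by positivity) ht.1
    have h := hcs L J _ H.reg H.sym (H.nice (Qt.1 - n)) hβL i hi hβ0 hβ1
      (fun h => t * dilScale L s d h) (fun h => mul_pos ht0 (hdil h))
      (fun h hh => by simp only [dilScale, if_neg hh, if_neg hi, H.deq h hh i hi]) c hc
    rw [csScale_smul] at h
    rw [Real.enorm_of_nonneg (by positivity)]
    refine (mul_le_mul_right h _).trans (le_of_eq ?_)
    simp only [hσdef]
    ring
  have hprod : ∀ e, 0 ≤ ∏ j, symf M i e j := fun e => Finset.prod_nonneg fun j _ => H.nonneg _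
  have hcost := (cost_pos α hσ).le
  have hopt := le_of_forall_scale_le (V := volume (dC Qt))
    (p := C * (C' * cost α σ * ∏ j, symf M i 0 j)) (q := C * (C' * cost α σ * ∏ j, symf M i 1 j))
    (r := C * (C' * cost α σ * ∏ j, M j)) (mul_nonneg hC.le (mul_nonneg (by positivity) (hprod 0)))
    (mul_nonneg hC.le (mul_nonneg (by positivity) (hprod 1)))
    (mul_nonneg hC.le (mul_nonneg (by positivity) H.prod_nonneg))
    (by linear_combination (C * (C' * cost α σ)) ^ 2 * prod_update_mul_prod_update M i)
    (volume_dC_ne_top Qt) fun c hc => (hbd c hc).trans ((mul_le_mul_right (add_le_add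
      (mul_le_mul_right (hXe 0) _) (mul_le_mul_right (hXe 1) _)) _).trans (le_of_eq ?_))
  · refine hopt.trans ?_
    rw [majorant, ← mul_assoc (ENNReal.ofReal (s ^ (α * m))), ← ENNReal.ofReal_mul (by positivity)]
    refine mul_le_mul_left (ENNReal.ofReal_le_ofReal ?_) _
    have h := cost_csScale_le hA hs hα hα1 H.dpos L i
    have h' := mul_le_mul_of_nonneg_left h (mul_nonneg (mul_nonneg (mul_nonneg zero_le_two hC.le)
      hC'.le) H.prod_nonneg)
    refine le_trans (le_of_eq ?_) (h'.trans (le_of_eq ?_)) <;> ring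
  · have h0 := hprod 0
    have h1 := hprod 1
    simp only [majorant]
    rw [← mul_assoc, ← mul_assoc, ← add_mul, ← mul_assoc, ← ENNReal.ofReal_mul hc.le,
      ← ENNReal.ofReal_mul (by positivity), ← ENNReal.ofReal_add (by positivity) (by positivity),
      ← ENNReal.ofReal_mul hC.le]
    congr 2
    ring

theorem letters_ne_zero {ι : Type*} [Fintype ι] {w : ι → Idx m} {a : ι} {κ : Idx m} (h : w a = κ) :
    letters w κ ≠ 0 :=
  Finset.card_ne_zero.2 ⟨a, Finset.mem_filter.2 ⟨Finset.mem_univ a, h⟩⟩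

theorem letters_eq_zero {ι : Type*} [Fintype ι] {w : ι → Idx m} {κ : Idx m} (h : ∀ a, w a ≠ κ) :
    letters w κ = 0 :=
  Finset.card_eq_zero.2 (Finset.filter_eq_empty_iff.2 fun a _ => h a)

theorem lintegral_supWeight_mul_lt_top (n : ℕ) {a : ℝ} (ha : a < 1) :
    ∫⁻ s in Set.Ioi (1 : ℝ), ‖supWeight n s‖ₑ * ENNReal.ofReal (s ^ a) < ⊤ := by
  have h : IntegrableOn (fun s : ℝ => s ^ (-2 + a)) (Set.Ioi 1) :=
    integrableOn_Ioi_rpow_of_lt (by linarith) one_pos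
  refine lt_of_le_of_lt (setLIntegral_mono' measurableSet_Ioi fun s hs => ?_) h.2
  have hs0 : (0 : ℝ) < s := lt_trans one_pos hs
  have hw := supWeight_le n hs
  have he : s ^ (-2 + a) = s ^ (-2 : ℝ) * s ^ a := Real.rpow_add hs0 _ _
  simp only [he]
  rw [Real.enorm_of_nonneg hw.1, Real.enorm_of_nonneg (by positivity),
    ENNReal.ofReal_mul (by positivity)]
  exact mul_le_mul_left (ENNReal.ofReal_le_ofReal hw.2) _

theorem formBound_of_squareBound (hm : 0 < m) (hΔ : 1 ≤ Δ) (hα : 0 ≤ α) (hαm : α * m < 1)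
    (hL : L ≠ Finset.univ) (hS : ∀ i ∉ L, SquareBound Δ α (insert i L)) : FormBound Δ α L := by
  have hα1 : α ≤ 1 := by
    have : (1 : ℝ) ≤ m := by exact_mod_cast hm
    nlinarith
  have hcard : Lᶜ.card < 2 * (m + 1) + 2 := by
    have := Finset.card_le_univ Lᶜ
    rw [Fintype.card_fin] at this
    omega
  obtain ⟨B, hB, hexp⟩ := symbol_expand L (m + 1) hcard Δ hΔ
  have hcross : ∀ w : WordIdx (m + 1) → Idx m, ∃ C : ℝ, 0 < C ∧ (OffPair L w →
      ∀ J T Qt d F M, Adm Δ α L J T Qt d F M → ∀ s : ℝ, 1 ≤ s → ∀ N : ℕ,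
      ∑ n ∈ Finset.range N, ∫⁻ t in scales (Qt.1 - n), ‖t⁻¹‖ₑ *
        ‖Frm J (floc J T F (Qt.1 - n)) (letters w) (fun h => t * dilScale L s d h)‖ₑ ≤
          ENNReal.ofReal (s ^ (α * m)) * majorant C α Qt d M) := fun w => by
    by_cases hw : OffPair L w
    · obtain ⟨i, a, b, ha, hb⟩ := hw.2
      have hi : i ∉ L := by
        have := hw.1 a
        rwa [ha] at this
      obtain ⟨C, hC, h⟩ := (hS i hi).cross hm hΔ hα hα1 hi (β := letters w)
        (fun κ hκ => letters_eq_zero fun a ha => hw.1 a (ha ▸ hκ)) (letters_ne_zero ha)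
        (letters_ne_zero hb)
      exact ⟨C, hC, fun _ => h⟩
    · exact ⟨1, one_pos, fun h => absurd h hw⟩
  choose C hC hcross using hcross
  set W := ∫⁻ s in Set.Ioi (1 : ℝ), ‖supWeight m s‖ₑ * ENNReal.ofReal (s ^ (α * m)) with hW
  have hWtop : W ≠ ⊤ := (lintegral_supWeight_mul_lt_top m hαm).ne
  set a : ℝ := ‖4 * Real.pi ^ 2‖ * (‖supConst m‖ * B) * W.toReal
  have ha : 0 ≤ a := by positivity
  refine ⟨1 + a * ∑ w, C w, by have := Finset.sum_nonneg fun w (_ : w ∈ Finset.univ) => (hC w).le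
                               positivity, fun J T Qt d F M H N => ?_⟩
  obtain ⟨i₀, hi₀⟩ : ∃ i, i ∉ L := by
    by_contra! h
    exact hL (Finset.eq_univ_iff_forall.2 h)
  have hρ : ∀ h, |if h ∈ L then (d h / d i₀) ^ 2 else 0| ≤ 1 := fun h => by
    split_ifs with hh
    · have h1 : 0 < d h / d i₀ := div_pos (H.dpos h) (H.dpos i₀)
      have h2 : d h / d i₀ ≤ 1 := (div_le_one (H.dpos i₀)).2 (H.dle h hh i₀ hi₀)
      rw [abs_of_nonneg (by positivity)]
      exact pow_le_one₀ h1.le h2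
    · simp
  obtain ⟨c, hcB, hc, hcexp⟩ := hexp J H.reg H.sym _ hρ
  have hcexp' : ∀ ξ, (∑ κ ∈ offIdx L, eta J ξ κ ^ 2 +
      ∑ h ∈ L, (d h / d i₀) ^ 2 * (eta J ξ (Sum.inl h) + eta J ξ (Sum.inr h)) ^ 2) *
      (∑ κ ∈ offIdx L, eta J ξ κ ^ 2) ^ (m + 1) = ∑ w, c w * ∏ a, eta J ξ (w a) := fun ξ => by
    rw [← hcexp ξ]
    congr 2
    exact Finset.sum_congr rfl fun h hh => by rw [if_pos hh]
  calc _ ≤ ∑ n ∈ Finset.range N, ‖∫ t in scales (Qt.1 - n),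
        t⁻¹ * Bform L J (floc J T F (Qt.1 - n)) (fun h => t * d h)‖ₑ := enorm_sum_le _ _
    _ ≤ ∑ n ∈ Finset.range N, ∑ w, ‖-(4 * Real.pi ^ 2) * (supConst m * c w)‖ₑ *
        ∫⁻ s in Set.Ioi (1 : ℝ), ‖supWeight m s‖ₑ * ∫⁻ t in scales (Qt.1 - n), ‖t⁻¹‖ₑ *
          ‖Frm J (floc J T F (Qt.1 - n)) (letters w) (fun h => t * dilScale L s d h)‖ₑ :=
        Finset.sum_le_sum fun n _ => (H.nice (Qt.1 - n)).enorm_integral_Bform_le H.reg H.sym H.dpos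
          (H.dpos i₀) (fun h hh => H.deq h hh i₀ hi₀) hc hcexp' _
    _ = ∑ w, ‖-(4 * Real.pi ^ 2) * (supConst m * c w)‖ₑ * ∑ n ∈ Finset.range N,
        ∫⁻ s in Set.Ioi (1 : ℝ), ‖supWeight m s‖ₑ * ∫⁻ t in scales (Qt.1 - n), ‖t⁻¹‖ₑ *
          ‖Frm J (floc J T F (Qt.1 - n)) (letters w) (fun h => t * dilScale L s d h)‖ₑ := by
        rw [Finset.sum_comm]
        exact Finset.sum_congr rfl fun w _ => (Finset.mul_sum _ _ _).symm
    _ ≤ ∑ w, majorant (a * C w) α Qt d M := by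
        refine Finset.sum_le_sum fun w _ => ?_
        by_cases hw : c w = 0
        · simp [hw]
        · have hs : ∑ n ∈ Finset.range N, ∫⁻ s in Set.Ioi (1 : ℝ), ‖supWeight m s‖ₑ *
              ∫⁻ t in scales (Qt.1 - n), ‖t⁻¹‖ₑ *
                ‖Frm J (floc J T F (Qt.1 - n)) (letters w) (fun h => t * dilScale L s d h)‖ₑ ≤
              W * majorant (C w) α Qt d M := by
            refine (sum_lintegral_le _ _ _).trans ?_
            rw [hW, ← lintegral_mul_const']
            · refine setLIntegral_mono' measurableSet_Ioi fun s hs => ?_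
              rw [← Finset.mul_sum, mul_assoc]
              exact mul_le_mul_right (hcross w (hc w hw) J T Qt d F M H s (le_of_lt hs) N) _
            · exact ENNReal.mul_ne_top ENNReal.ofReal_ne_top (volume_dC_ne_top Qt)
          rw [← mul_majorant ha]
          refine (mul_le_mul_right hs _).trans ?_
          rw [← mul_assoc]
          refine mul_le_mul_left ?_ _
          rw [ENNReal.ofReal_mul (by positivity), ENNReal.ofReal_toReal hWtop]
          refine mul_le_mul_left ?_ _
          rw [← ofReal_norm]
          refine ENNReal.ofReal_le_ofReal ?_
          rw [norm_mul, norm_neg, norm_mul (supConst m)]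
          exact mul_le_mul_of_nonneg_left (mul_le_mul_of_nonneg_left (hcB w) (norm_nonneg _))
            (norm_nonneg _)
    _ ≤ _ := by
        have hcst := cost_pos α H.dpos
        have hpr := H.prod_nonneg
        simp only [majorant]
        rw [← Finset.sum_mul, ← ENNReal.ofReal_sum_of_nonneg fun w _ =>
          mul_nonneg (mul_nonneg (mul_nonneg ha (hC w).le) hcst.le) hpr,
          ← Finset.sum_mul, ← Finset.sum_mul, ← Finset.mul_sum]
        refine mul_le_mul_left (ENNReal.ofReal_le_ofReal ?_) _
        refine mul_le_mul_of_nonneg_right (mul_le_mul_of_nonneg_right ?_ hcst.le) hpr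
        linarith

theorem formBound (hm : 0 < m) (hΔ : 1 ≤ Δ) (hα : 0 ≤ α) (hαm : α * m < 1) (L : Finset (Fin m)) :
    FormBound Δ α L := by
  have hα1 : α ≤ 1 := by
    have : (1 : ℝ) ≤ m := by exact_mod_cast hm
    nlinarith
  induction hk : Lᶜ.card generalizing L with
  | zero =>
    rw [Finset.card_eq_zero, Finset.compl_eq_empty_iff] at hk
    rw [hk]
    exact formBound_univ m Δ α
  | succ k ih =>
    refine formBound_of_squareBound hm hΔ hα hαm ?_ fun i hi =>
      (ih (insert i L) ?_).squareBound hm hΔ hα hα1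
    · rintro rfl
      simp at hk
    · rw [Finset.compl_insert, Finset.card_erase_of_mem (Finset.mem_compl.2 hi), hk]
      rfl

end

/-! ### The form as a sum of multiplier forms -/

section

variable {m : ℕ} {Δ α : ℝ} {L : Finset (Fin m)} {J : Matrix (Idx m) (Fin m) ℝ}
  {T : Set (ℤ × (Fin m → ℤ))} {Qt : ℤ × (Fin m → ℤ)} {d : Fin m → ℝ}
  {F : Corner m → (Fin m → ℝ) → ℝ} {M : Corner m → ℝ}

theorem smul_diagonal_mulVec (t : ℝ) (d : Fin m → ℝ) (x : Idx m → ℝ) (κ : Idx m) :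
    ((t • Matrix.diagonal (Sum.elim d d)).mulVec x) κ = t * d (base κ) * x κ := by
  rw [Matrix.smul_mulVec, Pi.smul_apply, Matrix.mulVec_diagonal, smul_eq_mul, mul_assoc]
  rcases κ with h | h <;> rfl

theorem gss_smul_diagonal (t : ℝ) (d : Fin m → ℝ) (x : Idx m → ℝ) :
    gss ((t • Matrix.diagonal (Sum.elim d d)).mulVec x) =
      Real.exp (-Real.pi * ∑ κ, (t * d (base κ) * x κ) ^ 2) := by
  simp only [gss, smul_diagonal_mulVec]

theorem en_sq_smul_diagonal (t : ℝ) (d : Fin m → ℝ) (x : Idx m → ℝ) :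
    en ((t • Matrix.diagonal (Sum.elim d d)).mulVec x) ^ 2 =
      ∑ κ, (t * d (base κ) * x κ) ^ 2 := by
  rw [en, Real.sq_sqrt (Finset.sum_nonneg fun _ _ => sq_nonneg _)]
  simp only [smul_diagonal_mulVec]

theorem Th_mulVec (l : ℕ) (ξ : Fin m → ℝ) (h : Fin m) :
    ((Th l).mulVec ξ) h = if (h : ℕ) < l then 0 else ξ h := by
  rw [Th, Matrix.mulVec_diagonal]
  split_ifs <;> simp

/-- The frequency vectors of the truncated frequencies. -/
theorem eta_inr_Th {l : ℕ} (hJ : Reg Δ J)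
    (hs : SymRows (Finset.univ.filter fun h : Fin m => (h : ℕ) < l) J) (ξ : Fin m → ℝ)
    (h : Fin m) : eta J ((Th l).mulVec ξ) (Sum.inr h) =
      if (h : ℕ) < l then eta J ξ (Sum.inl h) + eta J ξ (Sum.inr h) else eta J ξ (Sum.inr h) := by
  have hc : (Finset.univ.filter fun h : Fin m => (h : ℕ) < l)ᶜ =
      Finset.univ.filter fun h : Fin m => ¬ (h : ℕ) < l := by ext; simp
  have e : eta J ((Th l).mulVec ξ) (Sum.inr h) =
      -∑ k ∈ Finset.univ.filter (fun h : Fin m => ¬ (h : ℕ) < l), Nm J (fun _ => 1) k h * ξ k := by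
    rw [eta_inr, Finset.sum_filter]
    congr 1
    refine Finset.sum_congr rfl fun k _ => ?_
    rw [Th_mulVec]
    split_ifs <;> simp
  split_ifs with hh
  · rw [eta_inl_add_inr hJ hs ξ (by simpa using hh), hc, e]
    simp only [eta_inl]
  · rw [e, eta_inr, Finset.sum_filter]
    congr 1
    refine Finset.sum_congr rfl fun k _ => ?_
    split_ifs with hk
    · rw [Nm_row_sym hJ hs _ (by simpa using hk), if_neg (by rintro rfl; exact hh hk), zero_mul]
    · rfl

theorem kernel_eq_symb {l : ℕ} (hJ : Reg Δ J)
    (hs : SymRows (Finset.univ.filter fun h : Fin m => (h : ℕ) < l) J) (t : ℝ) (d ξ : Fin m → ℝ) :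
    en ((t • Matrix.diagonal (Sum.elim d d)).mulVec
        ((PiJ J).transpose.mulVec ((Th l).mulVec ξ))) ^ 2 *
      gss ((t • Matrix.diagonal (Sum.elim d d)).mulVec ((PiJ J).transpose.mulVec ξ)) =
      symb (Finset.univ.filter fun h : Fin m => (h : ℕ) < l) J (fun h => t * d h) ξ := by
  rw [en_sq_smul_diagonal, gss_smul_diagonal, symb]
  change (∑ κ, (t * d (base κ) * eta J ((Th l).mulVec ξ) κ) ^ 2) * _ = _
  congr 1
  rw [offIdx, Finset.sum_filter, Finset.sum_filter, Fintype.sum_sum_type, Fintype.sum_sum_type,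
    ← Finset.sum_add_distrib, ← Finset.sum_add_distrib, ← Finset.sum_add_distrib]
  refine Finset.sum_congr rfl fun h _ => ?_
  rw [eta_inr_Th hJ hs, eta_inl, Th_mulVec, eta_inl]
  by_cases hh : (h : ℕ) < l <;> simp [hh]

theorem exp_pairing_eq_ech (J : Matrix (Idx m) (Fin m) ℝ) (x : Idx m → ℝ) (ξ : Fin m → ℝ) :
    Complex.exp (2 * Real.pi * Complex.I * (∑ i' : Fin m, ξ i' * ((PiJ J).mulVec x) i')) =
      ech J x ξ := by
  have h : ∑ i', ξ i' * ((PiJ J).mulVec x) i' = ∑ κ, eta J ξ κ * x κ := by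
    change ξ ⬝ᵥ (PiJ J *ᵥ x) = (PiJ J)ᵀ *ᵥ ξ ⬝ᵥ x
    rw [Matrix.dotProduct_mulVec, Matrix.mulVec_transpose]
  rw [ech, ← h]

theorem integrable_inv_mul_symb (L : Finset (Fin m)) (J : Matrix (Idx m) (Fin m) ℝ)
    (hd : ∀ h, 0 < d h) {a b : ℝ} (ha : 0 < a) :
    Integrable (fun z : ℝ × (Fin m → ℝ) => ((z.1⁻¹ : ℝ) : ℂ) * symb L J (fun h => z.1 * d h) z.2)
      ((volume.restrict (Set.Ioc a b)).prod volume) := by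
  have hw : Integrable (fun t : ℝ => ((t⁻¹ : ℝ) : ℂ)) (volume.restrict (Set.Ioc a b)) :=
    (integrableOn_inv ha).ofReal
  have hInt := fun β => integrable_mgp J β hw (measurable_smul_const d)
    (fun h => mul_pos ha (hd h)) (ae_le_smul hd (a := a) (b := b))
  have h := (((integrable_finsetSum Finset.univ fun κ _ => hInt (Pi.single κ 2)).add
    ((integrable_finsetSum L fun h _ => hInt (pairIdx h)).const_mul 2)).const_mul
      (-(4 * Real.pi ^ 2 : ℂ))⁻¹)
  refine h.congr (Filter.Eventually.of_forall fun z => ?_)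
  have hs := symb_eq_mgp L J (fun h => z.1 * d h) z.2
  have hp : (-(4 * Real.pi ^ 2) : ℂ) ≠ 0 := by simp [Real.pi_ne_zero]
  simp only [Pi.add_apply, ← Finset.mul_sum]
  rw [inv_mul_eq_iff_eq_mul₀ hp]
  linear_combination (-((z.1⁻¹ : ℝ) : ℂ)) * hs

/-- A single scale of the form with multiplier `symb`. -/
theorem Nice.integral_pr_kernel {f : Corner m → (Fin m → ℝ) → ℝ} (hJ : Reg Δ J) (hf : Nice f)
    (L : Finset (Fin m)) (hd : ∀ h, 0 < d h) {a b : ℝ} (ha : 0 < a) :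
    ∫ x, (pr f x : ℂ) * ∫ t in Set.Ioc a b,
        (∫ ξ, (symb L J (fun h => t * d h) ξ : ℂ) * ech J x ξ) * (t : ℂ)⁻¹ =
      ((-(4 * Real.pi ^ 2)⁻¹ * |(Jb1 J).det| *
        ∫ t in Set.Ioc a b, t⁻¹ * Bform L J f (fun h => t * d h) : ℝ) : ℂ) := by
  have h := hf.integral_ech_swap J (integrable_inv_mul_symb L J hd (a := a) (b := b) ha)
  simp only [mul_assoc, integral_const_mul] at h
  have e : ∀ x, ∫ t in Set.Ioc a b,
        (∫ ξ, (symb L J (fun h => t * d h) ξ : ℂ) * ech J x ξ) * (t : ℂ)⁻¹ =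
      ∫ t in Set.Ioc a b, ((t⁻¹ : ℝ) : ℂ) *
        ∫ ξ, (symb L J (fun h => t * d h) ξ : ℂ) * ech J x ξ := fun x => by
    refine integral_congr_ae (Filter.Eventually.of_forall fun t => ?_)
    simp only [Complex.ofReal_inv, mul_comm]
  simp only [e]
  rw [h, ← integral_const_mul]
  refine Eq.trans ?_ integral_complex_ofReal
  refine setIntegral_congr_fun measurableSet_Ioc fun t ht => ?_
  have hb := hf.integral_symb_mul_fhat hJ L (s := fun h => t * d h)
    fun h => mul_pos (ha.trans ht.1) (hd h)
  have hb' : ∫ ξ, (symb L J (fun h => t * d h) ξ : ℂ) * fhat J f ξ = (-(4 * Real.pi ^ 2 : ℂ))⁻¹ *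
      ((|(Jb1 J).det| * Bform L J f (fun h => t * d h) : ℝ) : ℂ) := by
    rw [eq_inv_mul_iff_mul_eq₀ (by simp [Real.pi_ne_zero]), hb]
  simp only [hb']
  push_cast
  rw [inv_neg]
  ring

theorem Tkset_eq_empty (hm : 0 < m) (hT : ConvexTree T Qt) {k : ℤ} (hk : Qt.1 < k) :
    Tkset T k = ∅ := by
  refine Set.eq_empty_of_forall_notMem fun x hx => ?_
  simp only [Tkset, Set.mem_iUnion] at hx
  obtain ⟨Q, ⟨hQ, rfl⟩, -⟩ := hx
  exact absurd (hT.level_le hm hQ) (not_le.2 hk)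

/-- A series over the integers bounded above by `b` is controlled by its partial sums. -/
theorem enorm_tsum_le_of_range {a : ℤ → ℂ} {b : ℤ} (hb : ∀ k, b < k → a k = 0) {X : ℝ≥0∞}
    (hX : ∀ N : ℕ, ‖∑ n ∈ Finset.range N, a (b - n)‖ₑ ≤ X) : ‖∑' k, a k‖ₑ ≤ X := by
  by_cases hs : Summable a
  · have hi : Function.Injective fun n : ℕ => b - (n : ℤ) := fun x y h => by
      simpa using h
    have hsub : Function.support a ⊆ Set.range fun n : ℕ => b - (n : ℤ) := by
      intro k hk
      have : k ≤ b := not_lt.1 fun h => hk (hb k h)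
      exact ⟨(b - k).toNat, by simp only; omega⟩
    rw [← hi.tsum_eq hsub]
    exact le_of_tendsto (hs.comp_injective hi).hasSum.tendsto_sum_nat.enorm
      (Filter.Eventually.of_forall hX)
  · simp [tsum_eq_zero_of_not_summable hs]

theorem Reg.abs_det_le (hJ : Reg Δ J) (j : Corner m) :
    |(Amat J j).det| ≤ m.factorial * Δ ^ m := by
  have h := Matrix.det_le (A := Amat J j) (abv := AbsoluteValue.abs) (x := Δ) (hJ j).1
  simpa only [AbsoluteValue.abs_apply, Fintype.card_fin, nsmul_eq_mul] using h

/-! ### Finiteness of the maximal function -/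

theorem ecc_nonneg {a b : Fin m → ℝ} (hab : ∀ i, a i < b i) : 0 ≤ ecc a b :=
  div_nonneg (Real.iInf_nonneg fun i => (sub_pos.2 (hab i)).le)
    (Real.iSup_nonneg fun i => (sub_pos.2 (hab i)).le)

theorem ecc_le_one (hm : 0 < m) {a b : Fin m → ℝ} (hab : ∀ i, a i < b i) : ecc a b ≤ 1 := by
  have i : Fin m := ⟨0, hm⟩
  refine div_le_one_of_le₀ ?_ (Real.iSup_nonneg fun i => (sub_pos.2 (hab i)).le)
  exact (ciInf_le (Set.finite_range _).bddBelow i).trans 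
    (le_ciSup (f := fun i => b i - a i) (Set.finite_range _).bddAbove i)

theorem avg_box_le {f : (Fin m → ℝ) → ℝ} {B : ℝ} (hB : ∀ x, |f x| ≤ B) (a b : Fin m → ℝ) :
    avg (box a b) f ≤ (B ^ (2 ^ (m - 1) : ℕ)) ^ ((2 : ℝ) ^ ((1 : ℤ) - (m : ℤ))) := by
  have hB0 : 0 ≤ B := (abs_nonneg _).trans (hB 0)
  have hfin : volume (box a b) < ⊤ := by
    rw [box_eq_Icc]; exact isCompact_Icc.measure_lt_top
  have h0 : 0 ≤ ∫ x in box a b, |f x| ^ (2 ^ (m - 1) : ℕ) := integral_nonneg fun x => by positivity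
  have h := norm_setIntegral_le_of_norm_le_const (f := fun x => |f x| ^ (2 ^ (m - 1) : ℕ))
    (C := B ^ (2 ^ (m - 1) : ℕ)) hfin fun x _ => by
      rw [norm_pow, Real.norm_eq_abs, abs_abs]
      exact pow_le_pow_left₀ (abs_nonneg _) (hB x) _
  rw [Real.norm_of_nonneg h0, measureReal_def] at h
  refine Real.rpow_le_rpow (by positivity) ?_ (by positivity)
  refine (mul_le_mul_of_nonneg_left h (by positivity)).trans ?_
  rw [mul_comm, mul_assoc]
  exact mul_le_of_le_one_right (by positivity) (mul_inv_le_one)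

theorem MalTree_ne_top (hm : 0 < m) (hα : 0 ≤ α) {f : (Fin m → ℝ) → ℝ} (hf : Continuous f)
    (hc : HasCompactSupport f) (A : Matrix (Fin m) (Fin m) ℝ) (T : Set (ℤ × (Fin m → ℤ))) :
    MalTree α f A T ≠ ⊤ := by
  obtain ⟨B, hB⟩ := hc.exists_bound_of_continuous hf
  have hB0 : 0 ≤ B := (norm_nonneg _).trans (hB 0)
  refine ne_top_of_le_ne_top (ENNReal.ofReal_ne_top
    (r := (B ^ (2 ^ (m - 1) : ℕ)) ^ ((2 : ℝ) ^ ((1 : ℤ) - (m : ℤ))))) ?_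
  refine iSup₂_le fun Q _ => iSup₂_le fun a b => iSup₂_le fun hab _ => ?_
  refine ENNReal.ofReal_le_ofReal ((mul_le_of_le_one_left ?_ ?_).trans (avg_box_le hB a b))
  · exact Real.rpow_nonneg (mul_nonneg (by positivity)
      (integral_nonneg fun x => by positivity)) _
  · have h0 := ecc_nonneg hab
    exact Real.rpow_le_one (by positivity) (Real.rpow_le_one h0 (ecc_le_one hm hab) hα)
      (by positivity)

theorem le_toReal_MalTree (hm : 0 < m) (hα : 0 ≤ α) {f : (Fin m → ℝ) → ℝ} (hf : Continuous f)
    (hc : HasCompactSupport f) (A : Matrix (Fin m) (Fin m) ℝ) {Q : ℤ × (Fin m → ℤ)} (hQ : Q ∈ T)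
    {a b : Fin m → ℝ} (hab : ∀ i, a i < b i) (hs : A.mulVec '' dC Q ⊆ box a b) :
    (ecc a b ^ α) ^ ((2 : ℝ) ^ ((1 : ℤ) - (m : ℤ))) * avg (box a b) f ≤
      (MalTree α f A T).toReal := by
  rw [← ENNReal.ofReal_le_iff_le_toReal (MalTree_ne_top hm hα hf hc A T)]
  refine le_trans ?_ (le_iSup₂_of_le Q hQ le_rfl)
  exact le_iSup₂_of_le a b (le_iSup₂_of_le hab hs le_rfl)

theorem eq_of_istar_eq {X : Type*} {G : Corner m → X} {i : Fin m}
    (h : ∀ j, G j = G (istar i j)) (j : Corner m) (e : Fin 2) :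
    G (Function.update j i e) = G j := by
  by_cases he : e = j i
  · rw [he, Function.update_eq_self]
  · rw [h j]
    congr 1
    funext k
    by_cases hk : k = i
    · subst hk
      simp only [Function.update_self, istar, if_true]
      revert he
      generalize j k = c
      revert c e
      decide
    · simp [istar, hk]

theorem majorant_eq (hd : ∀ h, 0 < d h) {C : ℝ} (hC : 0 ≤ C) {X : Corner m → ℝ≥0∞}
    (hX : ∀ j, X j ≠ ⊤) : majorant C α Qt d (fun j => (X j).toReal) =
      (C.toNNReal : ℝ≥0∞) * ENNReal.ofReal (∏ h, max (d h ^ (2 * α)) (d h ^ (-2 : ℝ))) *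
        volume (dC Qt) * ∏ j, X j := by
  have h := (cost_pos α hd).le
  rw [majorant, ENNReal.ofReal_mul (by positivity), ENNReal.ofReal_mul hC,
    ENNReal.ofReal_prod_of_nonneg fun j _ => ENNReal.toReal_nonneg]
  simp only [ENNReal.ofReal_toReal (hX _)]
  rw [cost, ENNReal.ofReal]
  ring

end

/-- Induction proposition, bound for the second kernel
`K(t,x) = ∫ |tDΠ^TΘ̃ξ|² g(tDΠ^Tξ) e^{2πi ξ·Πx} dξ`, for `0 < l ≤ m`. -/
theorem statement16 (m l : ℕ) (hm : 2 ≤ m) (hl0 : 0 < l) (hlm : l ≤ m)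
    (Δ α : ℝ) (hΔ : 1 < Δ) (hα0 : 0 < α) (hα : α < 1 / m) :
    ∃ C : ℝ≥0, ∀ J : Matrix (Idx m) (Fin m) ℝ,
      (∀ j : Corner m, IsReg Δ (Amat J j)) →
      (∀ h : Fin m, (h:ℕ) < l → ∀ k, J (Sum.inl h) k = J (Sum.inr h) k) →
      ∀ (T : Set (ℤ × (Fin m → ℤ))) (Qt : ℤ × (Fin m → ℤ)), ConvexTree T Qt →
      ∀ d : Fin m → ℝ, (∀ h, 0 < d h) →
      (∀ h i : Fin m, (h:ℕ) < l → l ≤ (i:ℕ) → d h ≤ d i) →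
      (∀ i i' : Fin m, l ≤ (i:ℕ) → l ≤ (i':ℕ) → d i = d i') →
      ∀ F : Corner m → (Fin m → ℝ) → ℝ,
        (∀ j, ContDiff ℝ (⊤ : ℕ∞) (F j) ∧ HasCompactSupport (F j)) →
        (∀ j : Corner m, ∀ i : Fin m, (i:ℕ) < l → F j = F (istar i j)) →
        ENNReal.ofReal ‖LambdaK J T
            (fun t x => ∫ ξ : Fin m → ℝ,
              Complex.ofReal
                ((en ((t • Matrix.diagonal (Sum.elim d d)).mulVec
                    ((PiJ J).transpose.mulVec ((Th l).mulVec ξ)))) ^ 2 *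
                  gss ((t • Matrix.diagonal (Sum.elim d d)).mulVec
                    ((PiJ J).transpose.mulVec ξ))) *
              Complex.exp (2 * Real.pi * Complex.I *
                (∑ i' : Fin m, ξ i' * ((PiJ J).mulVec x) i'))) F‖ ≤
          C * ENNReal.ofReal (∏ h : Fin m, max (d h ^ (2*α)) (d h ^ (-2 : ℝ))) *
            volume (dC Qt) * ∏ j : Corner m, MalTree α (F j) (Amat J j) T := by
  have hm0 : 0 < m := by omega
  have hαm : α * m < 1 := by
    have : (0 : ℝ) < m := by exact_mod_cast hm0
    rwa [lt_div_iff₀ this] at hα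
  set L : Finset (Fin m) := Finset.univ.filter fun h : Fin m => (h : ℕ) < l with hL
  have mem : ∀ h : Fin m, h ∈ L ↔ (h : ℕ) < l := fun h => by simp [hL]
  obtain ⟨C, hC, hbd⟩ := formBound hm0 hΔ.le hα0.le hαm L
  refine ⟨((4 * Real.pi ^ 2)⁻¹ * (m.factorial * Δ ^ m) * C).toNNReal, ?_⟩
  intro J hreg hrow T Qt hT d hd hdle hdeq F hF hsym
  have hJ := reg_of_isReg hreg
  have hs : SymRows L J := fun h hh => hrow h ((mem h).1 hh)
  have htop : ∀ j, MalTree α (F j) (Amat J j) T ≠ ⊤ := fun j =>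
    MalTree_ne_top hm0 hα0.le (hF j).1.continuous (hF j).2 _ _
  have H : Adm Δ α L J T Qt d F (fun j => (MalTree α (F j) (Amat J j) T).toReal) :=
    ⟨hJ, hs, hT, hd,
      fun h hh i hi => hdle h i ((mem h).1 hh) (not_lt.1 (mt (mem i).2 hi)),
      fun i hi i' hi' => hdeq i i' (not_lt.1 (mt (mem i).2 hi)) (not_lt.1 (mt (mem i').2 hi')),
      fun j => (hF j).1.continuous, fun j => (hF j).2,
      fun j i hi e => eq_of_istar_eq (fun j' => hsym j' i ((mem i).1 hi)) j e,
      fun j => ENNReal.toReal_nonneg,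
      fun j Q hQ a b hab hsub =>
        le_toReal_MalTree hm0 hα0.le (hF j).1.continuous (hF j).2 _ hQ hab hsub⟩
  have hΔ0 : 0 < Δ := by linarith
  rw [← majorant_eq hd (by positivity) htop, ofReal_norm, LambdaK]
  simp only [kernel_eq_symb hJ hs, exp_pairing_eq_ech, ← hL]
  have term := fun k : ℤ =>
    (H.nice k).integral_pr_kernel hJ L hd (a := (2 : ℝ) ^ (k - 1)) (b := (2 : ℝ) ^ k)
      (by positivity)
  simp only [pr, floc] at term
  refine enorm_tsum_le_of_range (b := Qt.1) (fun k hk => ?_) fun N => ?_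
  · have : Nonempty (Corner m) := ⟨0⟩
    simp [Tkset_eq_empty hm0 hT hk]
  · simp only [term]
    rw [← Complex.ofReal_sum, ← Finset.mul_sum]
    have h := hbd J T Qt d F _ H N
    simp only [scales] at h
    rw [← mul_majorant (by positivity), ← ofReal_norm, Complex.norm_real, norm_mul,
      ENNReal.ofReal_mul (norm_nonneg _), ofReal_norm (∑ n ∈ Finset.range N, _)]
    refine mul_le_mul' (ENNReal.ofReal_le_ofReal ?_) h
    rw [Real.norm_eq_abs, abs_mul, abs_neg, abs_abs, abs_of_pos (by positivity), Jb1_eq]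
    exact mul_le_mul_of_nonneg_left (hJ.abs_det_le _) (by positivity)

end SBL
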